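/- arXiv:1304.0188 — 2 statements merged into one kernel-verified Lean document; each statement's English description precedes it below -/
import Mathlib

section
/- There exist constants c > 0 and C > 0 such that for all x ≥ 2, the number of integers n ≤ x for which there is NO quadruple (k, p, q, r) with k ≥ 1 an integer, p, q, r primes, n = k·p + r, r ≡ 1 (mod q), and min{p²·k, p·k·r, q·r} ≥ c · n^(3/2), is at most C · (log x)⁴. -/
namespace EvasiveNumbers

open Finset Filter

/-- The additive character `θ ↦ exp (2πiθ)`. -/
noncomputable def e (θ : ℝ) : ℂ := Complex.exp (Complex.I * ((2 * Real.pi * θ : ℝ) : ℂ))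

lemma e_add (x y : ℝ) : e (x + y) = e x * e y := by
  unfold e
  rw [← Complex.exp_add]
  congr 1
  push_cast
  ring

lemma e_zero : e 0 = 1 := by simp [e]

lemma norm_e (x : ℝ) : ‖e x‖ = 1 := by
  unfold e
  rw [mul_comm]
  exact Complex.norm_exp_ofReal_mul_I _

lemma e_nat_mul (n : ℕ) (x : ℝ) : e (n * x) = e x ^ n := by
  unfold e
  rw [← Complex.exp_nat_mul]
  congr 1
  push_cast
  ring

lemma conj_e (x : ℝ) : (starRingEnd ℂ) (e x) = e (-x) := by
  unfold e
  rw [← Complex.exp_conj]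
  congr 1
  simp only [map_mul, Complex.conj_I, Complex.conj_ofReal]
  push_cast
  ring

lemma e_natCast (n : ℕ) : e n = 1 := by
  unfold e
  rw [Complex.exp_eq_one_iff]
  refine ⟨n, ?_⟩
  push_cast
  ring

lemma four_mul_min_le_norm_e_sub_one {θ : ℝ} (h : |θ| ≤ 1) :
    4 * min |θ| (1 - |θ|) ≤ ‖e θ - 1‖ := by
  have hπ := Real.pi_pos
  unfold e
  rw [Complex.norm_exp_I_mul_ofReal_sub_one, norm_mul, Real.norm_eq_abs, Real.norm_eq_abs,
    abs_of_pos (by norm_num : (0 : ℝ) < 2),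
    show 2 * Real.pi * θ / 2 = Real.pi * θ by ring]
  have hs : |Real.sin (Real.pi * θ)| = |Real.sin (Real.pi * |θ|)| := by
    rcases abs_cases θ with ⟨h, _⟩ | ⟨h, _⟩ <;> simp [h]
  rw [hs]
  have h0 := abs_nonneg θ
  rcases le_total |θ| (1 / 2) with h1 | h1
  · have := Real.mul_le_sin (x := Real.pi * |θ|) (by positivity) (by nlinarith)
    have h2 : 2 / Real.pi * (Real.pi * |θ|) = 2 * |θ| := by field_simp
    rw [h2] at this
    have h3 := min_le_left |θ| (1 - |θ|)
    have h4 := le_abs_self (Real.sin (Real.pi * |θ|))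
    linarith
  · have := Real.mul_le_sin (x := Real.pi * (1 - |θ|))
      (mul_nonneg hπ.le (by linarith)) (by nlinarith)
    have h2 : 2 / Real.pi * (Real.pi * (1 - |θ|)) = 2 * (1 - |θ|) := by field_simp
    rw [h2, show Real.pi * (1 - |θ|) = Real.pi - Real.pi * |θ| by ring, Real.sin_pi_sub] at this
    have h3 := min_le_right |θ| (1 - |θ|)
    have h4 := le_abs_self (Real.sin (Real.pi * |θ|))
    linarith

/-- The Dirichlet kernel. -/
noncomputable def dirichletKernel (L : ℕ) (θ : ℝ) : ℂ := ∑ i ∈ range L, e (i * θ)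

lemma norm_dirichletKernel_le (L : ℕ) (θ : ℝ) : ‖dirichletKernel L θ‖ ≤ L := by
  unfold dirichletKernel
  refine (norm_sum_le _ _).trans ?_
  simp [norm_e]

lemma norm_dirichletKernel_mul_le (L : ℕ) (θ : ℝ) :
    ‖dirichletKernel L θ‖ * ‖e θ - 1‖ ≤ 2 := by
  unfold dirichletKernel
  simp_rw [e_nat_mul]
  rw [← norm_mul, geom_sum_mul]
  refine (norm_sub_le _ _).trans ?_
  rw [norm_pow, norm_e]
  norm_num

lemma norm_dirichletKernel_sq_le (L : ℕ) {θ : ℝ} (h0 : θ ≠ 0) (h : |θ| < 1) :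
    ‖dirichletKernel L θ‖ ^ 2 ≤
      (1 / 4) * (1 / θ ^ 2 + 1 / (1 - θ) ^ 2 + 1 / (1 + θ) ^ 2) := by
  have hm : 0 < min |θ| (1 - |θ|) := lt_min (abs_pos.mpr h0) (by linarith)
  have h1 := four_mul_min_le_norm_e_sub_one h.le
  have h2 := norm_dirichletKernel_mul_le L θ
  have h3 := norm_nonneg (dirichletKernel L θ)
  have h4 : ‖dirichletKernel L θ‖ ≤ 1 / (2 * min |θ| (1 - |θ|)) := by
    rw [le_div_iff₀ (by positivity)]
    nlinarith
  have h5 : ‖dirichletKernel L θ‖ ^ 2 ≤ (1 / 4) * (1 / min |θ| (1 - |θ|) ^ 2) := by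
    calc _ ≤ (1 / (2 * min |θ| (1 - |θ|))) ^ 2 := by gcongr
      _ = _ := by field_simp; norm_num
  refine h5.trans ?_
  gcongr
  have p1 : 0 ≤ 1 / θ ^ 2 := by positivity
  have p2 : 0 ≤ 1 / (1 - θ) ^ 2 := by positivity
  have p3 : 0 ≤ 1 / (1 + θ) ^ 2 := by positivity
  rcases min_choice |θ| (1 - |θ|) with h6 | h6
  · rw [h6, sq_abs]; linarith
  · rw [h6]
    rcases abs_cases θ with ⟨h7, _⟩ | ⟨h7, _⟩
    · rw [h7]; linarith
    · rw [h7, sub_neg_eq_add]; linarith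

lemma sum_one_div_sq_le (n : ℕ) : ∑ j ∈ Icc 1 n, (1 : ℝ) / (j : ℝ) ^ 2 ≤ 2 := by
  have : ∀ n : ℕ, ∑ j ∈ Icc 1 n, (1 : ℝ) / (j : ℝ) ^ 2 ≤ 2 - 1 / n := by
    intro n
    induction n with
    | zero => simp
    | succ n ih =>
      rw [Finset.sum_Icc_succ_top (by omega)]
      rcases Nat.eq_zero_or_pos n with rfl | hn
      · norm_num
      · have h : (0 : ℝ) < n := by exact_mod_cast hn
        have h2 : (1 : ℝ) / ((n + 1 : ℕ) : ℝ) ^ 2 ≤ 1 / n - 1 / ((n + 1 : ℕ) : ℝ) := by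
          push_cast
          rw [div_sub_div _ _ (by positivity) (by positivity),
            div_le_div_iff₀ (by positivity) (by positivity)]
          nlinarith
        linarith
  have h2 : (0 : ℝ) ≤ 1 / n := by positivity
  linarith [this n]

lemma sum_one_div_sq_le_of_pos_separated {ι : Type*} (s : Finset ι) (u : ι → ℝ) {δ : ℝ}
    (hδ : 0 < δ) (hu : ∀ i ∈ s, δ ≤ u i)
    (hsep : ∀ i ∈ s, ∀ j ∈ s, i ≠ j → δ ≤ |u i - u j|) :
    ∑ i ∈ s, 1 / u i ^ 2 ≤ 2 / δ ^ 2 := by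
  set g : ι → ℕ := fun i => ⌊u i / δ⌋₊ with hg
  have hinj : Set.InjOn g s := by
    intro i hi j hj hij
    by_contra hne
    have h1 := hsep i hi j hj hne
    have a1 := Nat.floor_le (show 0 ≤ u i / δ from div_nonneg (hδ.le.trans (hu i hi)) hδ.le)
    have a2 := Nat.lt_floor_add_one (u i / δ)
    have b1 := Nat.floor_le (show 0 ≤ u j / δ from div_nonneg (hδ.le.trans (hu j hj)) hδ.le)
    have b2 := Nat.lt_floor_add_one (u j / δ)
    simp only [hg] at hij
    rw [hij] at a1 a2
    have : |u i / δ - u j / δ| < 1 := by rw [abs_lt]; constructor <;> linarith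
    rw [← sub_div, abs_div, abs_of_pos hδ, div_lt_one hδ] at this
    linarith
  have hg1 : ∀ i ∈ s, 1 ≤ g i := fun i hi =>
    (Nat.one_le_floor_iff _).mpr ((one_le_div hδ).mpr (hu i hi))
  calc ∑ i ∈ s, 1 / u i ^ 2 ≤ ∑ i ∈ s, (1 / (g i : ℝ) ^ 2) * (1 / δ ^ 2) := by
        refine sum_le_sum fun i hi => ?_
        have h1 : (g i : ℝ) ≤ u i / δ :=
          Nat.floor_le (div_nonneg (hδ.le.trans (hu i hi)) hδ.le)
        rw [le_div_iff₀ hδ] at h1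
        have h2 : (0 : ℝ) < g i := by exact_mod_cast hg1 i hi
        rw [div_mul_div_comm, one_mul, ← mul_pow]
        gcongr
    _ = (∑ j ∈ s.image g, 1 / (j : ℝ) ^ 2) * (1 / δ ^ 2) := by
        rw [← sum_mul, sum_image hinj]
    _ ≤ (∑ j ∈ Icc 1 (s.sup g), 1 / (j : ℝ) ^ 2) * (1 / δ ^ 2) := by
        gcongr
        · intro j hj
          obtain ⟨i, hi, rfl⟩ := mem_image.mp hj
          exact mem_Icc.mpr ⟨hg1 i hi, le_sup hi⟩
    _ ≤ 2 * (1 / δ ^ 2) := by gcongr; exact sum_one_div_sq_le _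
    _ = _ := by ring

lemma sum_one_div_sq_le_of_separated {ι : Type*} (s : Finset ι) (u : ι → ℝ) {δ : ℝ}
    (hδ : 0 < δ) (hu : ∀ i ∈ s, δ ≤ |u i|)
    (hsep : ∀ i ∈ s, ∀ j ∈ s, i ≠ j → δ ≤ |u i - u j|) :
    ∑ i ∈ s, 1 / u i ^ 2 ≤ 4 / δ ^ 2 := by
  rw [← sum_filter_add_sum_filter_not s (fun i => 0 ≤ u i)]
  have h1 := sum_one_div_sq_le_of_pos_separated (s.filter fun i => 0 ≤ u i) u hδ
    (fun i hi => by
      obtain ⟨h, h'⟩ := mem_filter.mp hi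
      simpa [abs_of_nonneg h'] using hu i h)
    (fun i hi j hj => hsep i (mem_filter.mp hi).1 j (mem_filter.mp hj).1)
  have h2 := sum_one_div_sq_le_of_pos_separated (s.filter fun i => ¬ 0 ≤ u i) (fun i => - u i) hδ
    (fun i hi => by
      obtain ⟨h, h'⟩ := mem_filter.mp hi
      simpa [abs_of_neg (not_le.mp h')] using hu i h)
    (fun i hi j hj hij => by
      rw [show - u i - - u j = -(u i - u j) by ring, abs_neg]
      exact hsep i (mem_filter.mp hi).1 j (mem_filter.mp hj).1 hij)
  simp only [neg_sq] at h2
  calc _ ≤ 2 / δ ^ 2 + 2 / δ ^ 2 := add_le_add h1 h2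
    _ = _ := by ring

lemma sum_norm_dirichletKernel_sq_le {ι : Type*} [DecidableEq ι] (s : Finset ι) (α : ι → ℝ)
    (K : ℕ) (hK : 0 < K)
    (hsep : ∀ i ∈ s, ∀ j ∈ s, i ≠ j →
      1 / (K : ℝ) ≤ |α i - α j| ∧ |α i - α j| ≤ 1 - 1 / (K : ℝ))
    (r : ι) (hr : r ∈ s) :
    ∑ i ∈ s, ‖dirichletKernel (2 * K) (α i - α r)‖ ^ 2 ≤ 7 * (K : ℝ) ^ 2 := by
  have hK' : (0 : ℝ) < K := by exact_mod_cast hK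
  have hδ : (0 : ℝ) < 1 / K := by positivity
  rw [← add_sum_erase s _ hr]
  have h0 : ‖dirichletKernel (2 * K) (α r - α r)‖ ^ 2 ≤ 4 * (K : ℝ) ^ 2 := by
    have := norm_dirichletKernel_le (2 * K) (α r - α r)
    push_cast at this
    calc _ ≤ (2 * (K : ℝ)) ^ 2 := by gcongr
      _ = _ := by ring
  have key : ∀ i ∈ s.erase r, 1 / (K : ℝ) ≤ |α i - α r| ∧ |α i - α r| ≤ 1 - 1 / (K : ℝ) :=
    fun i hi => hsep i (mem_of_mem_erase hi) r hr (ne_of_mem_erase hi)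
  have sep : ∀ i ∈ s.erase r, ∀ j ∈ s.erase r, i ≠ j → 1 / (K : ℝ) ≤ |α i - α j| :=
    fun i hi j hj hij => (hsep i (mem_of_mem_erase hi) j (mem_of_mem_erase hj) hij).1
  have h1 := sum_one_div_sq_le_of_separated (s.erase r) (fun i => α i - α r) hδ
    (fun i hi => (key i hi).1)
    (fun i hi j hj hij => by simpa using sep i hi j hj hij)
  have h2 := sum_one_div_sq_le_of_separated (s.erase r) (fun i => 1 - (α i - α r)) hδ
    (fun i hi => by
      have := le_abs_self (α i - α r)
      exact (by linarith [(key i hi).2] : 1 / (K : ℝ) ≤ 1 - (α i - α r)).trans (le_abs_self _))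
    (fun i hi j hj hij => by
      rw [show 1 - (α i - α r) - (1 - (α j - α r)) = -(α i - α j) by ring, abs_neg]
      exact sep i hi j hj hij)
  have h3 := sum_one_div_sq_le_of_separated (s.erase r) (fun i => 1 + (α i - α r)) hδ
    (fun i hi => by
      have := neg_abs_le (α i - α r)
      exact (by linarith [(key i hi).2] : 1 / (K : ℝ) ≤ 1 + (α i - α r)).trans (le_abs_self _))
    (fun i hi j hj hij => by
      rw [show 1 + (α i - α r) - (1 + (α j - α r)) = α i - α j by ring]
      exact sep i hi j hj hij)
  have h4 : ∑ i ∈ s.erase r, ‖dirichletKernel (2 * K) (α i - α r)‖ ^ 2 ≤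
      ∑ i ∈ s.erase r, (1 / 4) * (1 / (α i - α r) ^ 2 + 1 / (1 - (α i - α r)) ^ 2 +
        1 / (1 + (α i - α r)) ^ 2) := by
    refine sum_le_sum fun i hi => norm_dirichletKernel_sq_le _ ?_ ?_
    · intro h
      have := (key i hi).1
      rw [h, abs_zero] at this
      linarith
    · linarith [(key i hi).2]
  rw [← mul_sum, sum_add_distrib, sum_add_distrib] at h4
  have h5 : 4 / (1 / (K : ℝ)) ^ 2 = 4 * (K : ℝ) ^ 2 := by field_simp
  rw [h5] at h1 h2 h3
  linarith

lemma norm_sum_mul_e_sq {ι : Type*} (s : Finset ι) (α : ι → ℝ) (b : ι → ℂ) (n : ℕ) :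
    ((‖∑ i ∈ s, b i * e (n * α i)‖ ^ 2 : ℝ) : ℂ) =
      ∑ i ∈ s, ∑ j ∈ s, b i * (starRingEnd ℂ) (b j) * e (n * (α i - α j)) := by
  rw [← Complex.normSq_eq_norm_sq, Complex.normSq_eq_conj_mul_self, mul_comm, map_sum,
    sum_mul_sum]
  refine sum_congr rfl fun i _ => sum_congr rfl fun j _ => ?_
  rw [map_mul, conj_e, mul_sub, sub_eq_add_neg, e_add]
  ring

/-- The dual large sieve inequality. -/
lemma dual_large_sieve {ι : Type*} [DecidableEq ι] (s : Finset ι) (α : ι → ℝ)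
    (K : ℕ) (hK : 0 < K)
    (hsep : ∀ i ∈ s, ∀ j ∈ s, i ≠ j →
      1 / (K : ℝ) ≤ |α i - α j| ∧ |α i - α j| ≤ 1 - 1 / (K : ℝ)) (b : ι → ℂ) :
    ∑ n ∈ range K, ‖∑ i ∈ s, b i * e ((n + K : ℕ) * α i)‖ ^ 2 ≤
      7 * K * ∑ i ∈ s, ‖b i‖ ^ 2 := by
  have hK' : (0 : ℝ) < K := by exact_mod_cast hK
  set T : ℕ → ℝ := fun n => ‖∑ i ∈ s, b i * e (n * α i)‖ ^ 2 with hT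
  have hTnn : ∀ n, 0 ≤ T n := fun n => by positivity
  have lower : K * ∑ n ∈ range K, T (n + K) ≤
      ∑ x ∈ range (2 * K), ∑ y ∈ range (2 * K), T (x + y) := by
    have h1 : (K : ℝ) * ∑ n ∈ range K, T (n + K) =
        ∑ x ∈ range K, ∑ n ∈ range K, T (n + K) := by simp
    rw [h1]
    calc ∑ x ∈ range K, ∑ n ∈ range K, T (n + K)
        ≤ ∑ x ∈ range K, ∑ y ∈ range (2 * K), T (x + y) := by
          refine sum_le_sum fun x hx => ?_
          have hx := mem_range.mp hx
          have : ∑ n ∈ range K, T (n + K) = ∑ y ∈ (range K).image (fun n => n + K - x),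
              T (x + y) := by
            rw [sum_image]
            · refine sum_congr rfl fun n _ => ?_
              congr 1
              omega
            · intro a _ b _ hab
              simp only at hab
              omega
          rw [this]
          refine sum_le_sum_of_subset_of_nonneg ?_ fun _ _ _ => hTnn _
          intro y hy
          obtain ⟨n, hn, rfl⟩ := mem_image.mp hy
          have := mem_range.mp hn
          exact mem_range.mpr (by omega)
      _ ≤ _ := sum_le_sum_of_subset_of_nonneg (range_mono (by omega))
          fun _ _ _ => sum_nonneg fun _ _ => hTnn _
  have expand : ((∑ x ∈ range (2 * K), ∑ y ∈ range (2 * K), T (x + y) : ℝ) : ℂ) =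
      ∑ i ∈ s, ∑ j ∈ s, b i * (starRingEnd ℂ) (b j) *
        dirichletKernel (2 * K) (α i - α j) ^ 2 := by
    push_cast
    simp_rw [hT, norm_sum_mul_e_sq]
    have : ∀ i j, b i * (starRingEnd ℂ) (b j) * dirichletKernel (2 * K) (α i - α j) ^ 2 =
        ∑ x ∈ range (2 * K), ∑ y ∈ range (2 * K),
          b i * (starRingEnd ℂ) (b j) * e ((x + y : ℕ) * (α i - α j)) := by
      intro i j
      rw [sq, dirichletKernel, sum_mul_sum, mul_sum]
      refine sum_congr rfl fun x _ => ?_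
      rw [mul_sum]
      refine sum_congr rfl fun y _ => ?_
      rw [← e_add]
      push_cast
      ring_nf
    simp_rw [this]
    calc _ = ∑ x ∈ range (2 * K), ∑ i ∈ s, ∑ j ∈ s, ∑ y ∈ range (2 * K),
          b i * (starRingEnd ℂ) (b j) * e ((x + y : ℕ) * (α i - α j)) := by
          refine sum_congr rfl fun x _ => ?_
          rw [sum_comm]
          refine sum_congr rfl fun i _ => ?_
          rw [sum_comm]
      _ = _ := by
          rw [sum_comm]
          refine sum_congr rfl fun i _ => ?_
          rw [sum_comm]
  have upper : ∑ x ∈ range (2 * K), ∑ y ∈ range (2 * K), T (x + y) ≤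
      7 * (K : ℝ) ^ 2 * ∑ i ∈ s, ‖b i‖ ^ 2 := by
    have h0 : 0 ≤ ∑ x ∈ range (2 * K), ∑ y ∈ range (2 * K), T (x + y) :=
      sum_nonneg fun _ _ => sum_nonneg fun _ _ => hTnn _
    have h1 : ∑ x ∈ range (2 * K), ∑ y ∈ range (2 * K), T (x + y) =
        ‖∑ i ∈ s, ∑ j ∈ s, b i * (starRingEnd ℂ) (b j) *
          dirichletKernel (2 * K) (α i - α j) ^ 2‖ := by
      rw [← expand, Complex.norm_real, Real.norm_of_nonneg h0]
    rw [h1]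
    have hsymm : ∀ i j, ‖dirichletKernel (2 * K) (α i - α j)‖ =
        ‖dirichletKernel (2 * K) (α j - α i)‖ := by
      intro i j
      rw [← Complex.norm_conj]
      congr 1
      unfold dirichletKernel
      rw [map_sum]
      refine sum_congr rfl fun x _ => ?_
      rw [conj_e]
      ring_nf
    calc _ ≤ ∑ i ∈ s, ∑ j ∈ s, (‖b i‖ ^ 2 * ‖dirichletKernel (2 * K) (α i - α j)‖ ^ 2 / 2 +
          ‖b j‖ ^ 2 * ‖dirichletKernel (2 * K) (α i - α j)‖ ^ 2 / 2) := by
          refine (norm_sum_le _ _).trans (sum_le_sum fun i _ => ?_)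
          refine (norm_sum_le _ _).trans (sum_le_sum fun j _ => ?_)
          rw [norm_mul, norm_mul, norm_pow, Complex.norm_conj]
          nlinarith [sq_nonneg (‖b i‖ - ‖b j‖), sq_nonneg ‖dirichletKernel (2 * K) (α i - α j)‖]
      _ = ∑ i ∈ s, ‖b i‖ ^ 2 * ∑ j ∈ s, ‖dirichletKernel (2 * K) (α j - α i)‖ ^ 2 := by
          simp_rw [sum_add_distrib]
          rw [sum_comm (f := fun i j => ‖b j‖ ^ 2 * ‖dirichletKernel (2 * K) (α i - α j)‖ ^ 2 / 2),
            ← sum_add_distrib]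
          refine sum_congr rfl fun i _ => ?_
          rw [← sum_add_distrib, mul_sum]
          refine sum_congr rfl fun j _ => ?_
          rw [hsymm i j]
          ring
      _ ≤ ∑ i ∈ s, ‖b i‖ ^ 2 * (7 * (K : ℝ) ^ 2) := by
          refine sum_le_sum fun i hi => ?_
          gcongr
          exact sum_norm_dirichletKernel_sq_le s α K hK hsep i hi
      _ = _ := by rw [← sum_mul]; ring
  have h := lower.trans upper
  rw [show 7 * (K : ℝ) ^ 2 * ∑ i ∈ s, ‖b i‖ ^ 2 = K * (7 * K * ∑ i ∈ s, ‖b i‖ ^ 2) by ring] at h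
  exact le_of_mul_le_mul_left h hK'

/-- The large sieve inequality for well-spaced points. -/
lemma large_sieve {ι : Type*} [DecidableEq ι] (s : Finset ι) (α : ι → ℝ)
    (K : ℕ) (hK : 0 < K)
    (hsep : ∀ i ∈ s, ∀ j ∈ s, i ≠ j →
      1 / (K : ℝ) ≤ |α i - α j| ∧ |α i - α j| ≤ 1 - 1 / (K : ℝ))
    (M : ℕ) (hM : M ≤ K) (f : ℕ → ℝ) :
    ∑ i ∈ s, ‖∑ n ∈ range M, (f n : ℂ) * e (n * α i)‖ ^ 2 ≤ 7 * K * ∑ n ∈ range M, f n ^ 2 := by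
  set S : ι → ℂ := fun i => ∑ n ∈ range M, (f n : ℂ) * e ((n + K : ℕ) * α i) with hS
  have hnorm : ∀ i, ‖∑ n ∈ range M, (f n : ℂ) * e (n * α i)‖ = ‖S i‖ := by
    intro i
    have : S i = (∑ n ∈ range M, (f n : ℂ) * e (n * α i)) * e (K * α i) := by
      rw [hS, sum_mul]
      refine sum_congr rfl fun n _ => ?_
      push_cast
      rw [add_mul, e_add]
      ring
    rw [this, norm_mul, norm_e, mul_one]
  simp_rw [hnorm]
  set T := ∑ i ∈ s, ‖S i‖ ^ 2 with hT
  have hT0 : 0 ≤ T := sum_nonneg fun _ _ => by positivity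
  set U : ℕ → ℂ := fun n => ∑ i ∈ s, (starRingEnd ℂ) (S i) * e ((n + K : ℕ) * α i) with hU
  have h1 : (T : ℂ) = ∑ n ∈ range M, (f n : ℂ) * U n := by
    rw [hT]
    push_cast
    simp_rw [hU, mul_sum]
    rw [sum_comm]
    refine sum_congr rfl fun i _ => ?_
    rw [← Complex.ofReal_pow, ← Complex.normSq_eq_norm_sq, Complex.normSq_eq_conj_mul_self]
    nth_rewrite 2 [hS]
    rw [mul_sum]
    refine sum_congr rfl fun n _ => ?_
    ring
  have h2 : T ≤ ∑ n ∈ range M, |f n| * ‖U n‖ := by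
    calc T = ‖(T : ℂ)‖ := by rw [Complex.norm_real, Real.norm_of_nonneg hT0]
      _ ≤ _ := by
        rw [h1]
        refine (norm_sum_le _ _).trans (sum_le_sum fun n _ => ?_)
        rw [norm_mul, Complex.norm_real, Real.norm_eq_abs]
  have h3 : T ^ 2 ≤ (∑ n ∈ range M, f n ^ 2) * (7 * K * T) := by
    calc T ^ 2 ≤ (∑ n ∈ range M, |f n| * ‖U n‖) ^ 2 := by gcongr
      _ ≤ (∑ n ∈ range M, |f n| ^ 2) * ∑ n ∈ range M, ‖U n‖ ^ 2 := sum_mul_sq_le_sq_mul_sq _ _ _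
      _ ≤ (∑ n ∈ range M, f n ^ 2) * (7 * K * T) := by
        simp_rw [sq_abs]
        refine mul_le_mul_of_nonneg_left ?_ (sum_nonneg fun _ _ => sq_nonneg _)
        have := dual_large_sieve s α K hK hsep (fun i => (starRingEnd ℂ) (S i))
        simp_rw [Complex.norm_conj] at this
        refine le_trans ?_ this
        exact sum_le_sum_of_subset_of_nonneg (range_mono hM) fun _ _ _ => by positivity
  rcases hT0.eq_or_lt with h | h
  · rw [← h]
    have := sum_nonneg fun n (_ : n ∈ range M) => sq_nonneg (f n)
    positivity
  · refine le_of_mul_le_mul_right ?_ h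
    nlinarith

/-- The sum of `f` over the integers below `M` congruent to `a` modulo `q`. -/
noncomputable def classSum (M q a : ℕ) (f : ℕ → ℝ) : ℝ := ∑ n ∈ range M with n % q = a, f n

/-- The variance of `f`, restricted to the integers below `M`, over residue classes modulo `q`. -/
noncomputable def classVar (M q : ℕ) (f : ℕ → ℝ) : ℝ :=
  ∑ a ∈ range q, (classSum M q a f - (∑ n ∈ range M, f n) / q) ^ 2

lemma classVar_nonneg (M q : ℕ) (f : ℕ → ℝ) : 0 ≤ classVar M q f :=
  sum_nonneg fun _ _ => sq_nonneg _

lemma sum_classSum {q : ℕ} (hq : 0 < q) (M : ℕ) (f : ℕ → ℝ) :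
    ∑ a ∈ range q, classSum M q a f = ∑ n ∈ range M, f n :=
  sum_fiberwise_of_maps_to (fun _ _ => mem_range.mpr (Nat.mod_lt _ hq)) f

lemma mul_classVar {q : ℕ} (hq : 0 < q) (M : ℕ) (f : ℕ → ℝ) :
    q * classVar M q f = q * ∑ a ∈ range q, classSum M q a f ^ 2 - (∑ n ∈ range M, f n) ^ 2 := by
  have hq' : (q : ℝ) ≠ 0 := by exact_mod_cast hq.ne'
  unfold classVar
  simp_rw [sub_sq, sum_add_distrib, sum_sub_distrib, ← sum_mul, ← mul_sum, sum_classSum hq]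
  rw [sum_const, card_range, nsmul_eq_mul]
  field_simp
  ring

lemma sum_e_div {q : ℕ} (hq : 0 < q) (i j : ℕ) :
    ∑ b ∈ range q, e (b * ((i : ℝ) / q - (j : ℝ) / q)) = if i % q = j % q then (q : ℂ) else 0 := by
  have hq' : (q : ℝ) ≠ 0 := by exact_mod_cast hq.ne'
  simp_rw [e_nat_mul]
  have hx : e ((i : ℝ) / q - (j : ℝ) / q) ^ q = 1 := by
    rw [← e_nat_mul, show (q : ℝ) * ((i : ℝ) / q - (j : ℝ) / q) = i + -j by field_simp; ring,
      e_add, ← conj_e, e_natCast, e_natCast]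
    simp
  by_cases h : i % q = j % q
  · have : e ((i : ℝ) / q - (j : ℝ) / q) = 1 := by
      have hz : (q : ℤ) ∣ (i : ℤ) - j := (Nat.modEq_iff_dvd.mp (show j ≡ i [MOD q] from h.symm))
      obtain ⟨k, hk⟩ := hz
      have hk' : (i : ℝ) - j = q * k := by exact_mod_cast hk
      rw [show (i : ℝ) / q - (j : ℝ) / q = k by field_simp; linarith]
      unfold e
      rw [Complex.exp_eq_one_iff]
      exact ⟨k, by push_cast; ring⟩
    simp [this, h]
  · have : e ((i : ℝ) / q - (j : ℝ) / q) ≠ 1 := by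
      intro h1
      unfold e at h1
      rw [Complex.exp_eq_one_iff] at h1
      obtain ⟨k, hk⟩ := h1
      apply h
      have h2 : (2 * Real.pi * Complex.I) * (((i : ℝ) / q - (j : ℝ) / q : ℝ) : ℂ) =
          (2 * Real.pi * Complex.I) * ((k : ℝ) : ℂ) := by
        push_cast at hk ⊢
        linear_combination hk
      have h3 := mul_left_cancel₀ Complex.two_pi_I_ne_zero h2
      have h4 : (i : ℝ) / q - (j : ℝ) / q = k := by exact_mod_cast h3
      field_simp at h4
      have h5 : (i : ℤ) - j = q * k := by exact_mod_cast h4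
      have : j ≡ i [MOD q] := Nat.modEq_iff_dvd.mpr ⟨k, h5⟩
      exact this.symm
    rw [if_neg h]
    have h2 := geom_sum_mul (e ((i : ℝ) / q - (j : ℝ) / q)) q
    rw [hx, sub_self] at h2
    exact (mul_eq_zero.mp h2).resolve_right (sub_ne_zero.mpr this)

lemma sum_classSum_sq {q : ℕ} (hq : 0 < q) (M : ℕ) (f : ℕ → ℝ) :
    ∑ a ∈ range q, classSum M q a f ^ 2 =
      ∑ i ∈ range M, ∑ j ∈ range M, if i % q = j % q then f i * f j else 0 := by
  have h1 : ∀ a, classSum M q a f ^ 2 = ∑ i ∈ range M, ∑ j ∈ range M,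
      if i % q = a ∧ j % q = a then f i * f j else 0 := by
    intro a
    unfold classSum
    rw [sq, sum_filter, sum_mul_sum]
    refine sum_congr rfl fun i _ => sum_congr rfl fun j _ => ?_
    split_ifs <;> simp_all
  simp_rw [h1]
  rw [sum_comm]
  refine sum_congr rfl fun i _ => ?_
  rw [sum_comm]
  refine sum_congr rfl fun j _ => ?_
  by_cases h : i % q = j % q
  · rw [if_pos h, ← h]
    simp [sum_ite_eq, Nat.mod_lt _ hq]
  · rw [if_neg h]
    refine sum_eq_zero fun a _ => if_neg ?_
    rintro ⟨rfl, h2⟩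
    exact h h2.symm

lemma sum_norm_sq_eq_mul_classVar {q : ℕ} (hq : 0 < q) (M : ℕ) (f : ℕ → ℝ) :
    ∑ b ∈ (range q).erase 0, ‖∑ n ∈ range M, (f n : ℂ) * e (n * ((b : ℝ) / q))‖ ^ 2 =
      q * classVar M q f := by
  have h0 : ∑ b ∈ range q, ‖∑ n ∈ range M, (f n : ℂ) * e (n * ((b : ℝ) / q))‖ ^ 2 =
      q * ∑ a ∈ range q, classSum M q a f ^ 2 := by
    rw [← Complex.ofReal_inj]
    have h1 : ∀ b : ℕ, ∑ n ∈ range M, (f n : ℂ) * e (n * ((b : ℝ) / q)) =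
        ∑ n ∈ range M, (f n : ℂ) * e (b * ((n : ℝ) / q)) := by
      intro b
      refine sum_congr rfl fun n _ => ?_
      congr 2
      ring
    simp_rw [h1]
    rw [Complex.ofReal_sum]
    simp_rw [norm_sum_mul_e_sq]
    rw [sum_comm, sum_classSum_sq hq]
    push_cast
    rw [mul_sum]
    refine sum_congr rfl fun i _ => ?_
    rw [sum_comm, mul_sum]
    refine sum_congr rfl fun j _ => ?_
    rw [← mul_sum, sum_e_div hq, Complex.conj_ofReal]
    split_ifs <;> push_cast <;> ring
  have h2 := add_sum_erase (range q)
    (fun b : ℕ => ‖∑ n ∈ range M, (f n : ℂ) * e (n * ((b : ℝ) / q))‖ ^ 2) (mem_range.mpr hq)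
  rw [h0] at h2
  rw [mul_classVar hq, ← h2]
  simp only [Nat.cast_zero, zero_div, mul_zero, e_zero, mul_one]
  rw [← Complex.ofReal_sum, Complex.norm_real, Real.norm_eq_abs, sq_abs]
  ring

/-- The large sieve inequality for prime moduli, in variance form. -/
lemma sum_mul_classVar_le (P : Finset ℕ) (Q : ℕ) (hQ : 0 < Q) (hP : ∀ p ∈ P, p.Prime ∧ p ≤ Q)
    (M : ℕ) (f : ℕ → ℝ) :
    ∑ q ∈ P, q * classVar M q f ≤ 7 * (M + (Q : ℝ) ^ 2) * ∑ n ∈ range M, f n ^ 2 := by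
  have h1 : ∑ q ∈ P, q * classVar M q f = ∑ x ∈ P.sigma (fun q => (range q).erase 0),
      ‖∑ n ∈ range M, (f n : ℂ) * e (n * ((x.2 : ℝ) / x.1))‖ ^ 2 := by
    rw [sum_sigma]
    exact sum_congr rfl fun q hq => (sum_norm_sq_eq_mul_classVar (hP q hq).1.pos M f).symm
  rw [h1]
  refine (large_sieve _ (fun x : (_ : ℕ) × ℕ => (x.2 : ℝ) / x.1) (M + Q ^ 2) (by positivity) ?_ M
    (by omega) f).trans (by push_cast; exact le_rfl)
  rintro ⟨p, a⟩ hx ⟨q, b⟩ hy hne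
  simp only [mem_sigma, mem_erase, mem_range] at hx hy
  obtain ⟨hp, ha0, ha⟩ := hx
  obtain ⟨hq, hb0, hb⟩ := hy
  have hpp := (hP p hp).1
  have hqp := (hP q hq).1
  have hp0 : (0 : ℝ) < p := by exact_mod_cast hpp.pos
  have hq0 : (0 : ℝ) < q := by exact_mod_cast hqp.pos
  have hdiff : (a : ℤ) * q - b * p ≠ 0 := by
    intro h
    have h' : a * q = b * p := by zify; linarith
    by_cases hpq : p = q
    · subst hpq
      have := Nat.eq_of_mul_eq_mul_right hpp.pos h'
      subst this
      exact hne rfl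
    · have hd : p ∣ a * q := h' ▸ Dvd.intro_left b rfl
      rcases hpp.dvd_mul.mp hd with h2 | h2
      · exact absurd (Nat.le_of_dvd (Nat.pos_of_ne_zero ha0) h2) (by omega)
      · exact hpq ((Nat.prime_dvd_prime_iff_eq hpp hqp).mp h2)
  have heq : (a : ℝ) / p - (b : ℝ) / q = ((a * q - b * p : ℤ) : ℝ) / (p * q) := by
    push_cast
    field_simp
  have hlt : |(a : ℤ) * q - b * p| < p * q := by
    have h1 : (a : ℤ) < p := by exact_mod_cast ha
    have h2 : (b : ℤ) < q := by exact_mod_cast hb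
    have h3 : (0 : ℤ) ≤ a := by positivity
    have h4 : (0 : ℤ) ≤ b := by positivity
    have h5 : (0 : ℤ) < p := by exact_mod_cast hpp.pos
    have h6 : (0 : ℤ) < q := by exact_mod_cast hqp.pos
    rw [abs_lt]
    constructor <;> nlinarith
  have hge : 1 ≤ |(a : ℤ) * q - b * p| := Int.one_le_abs hdiff
  have hge' : (1 : ℝ) ≤ |((a * q - b * p : ℤ) : ℝ)| := by exact_mod_cast hge
  have hlt' : |((a * q - b * p : ℤ) : ℝ)| ≤ p * q - 1 := by
    have : |(a : ℤ) * q - b * p| ≤ p * q - 1 := by omega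
    exact_mod_cast this
  have hpq : (p : ℝ) * q ≤ M + (Q : ℝ) ^ 2 := by
    have h1 : (p : ℝ) ≤ Q := by exact_mod_cast (hP p hp).2
    have h2 : (q : ℝ) ≤ Q := by exact_mod_cast (hP q hq).2
    have h3 : (0 : ℝ) ≤ M := by positivity
    nlinarith
  have h3 : 1 / ((M + Q ^ 2 : ℕ) : ℝ) ≤ 1 / (p * q) := by
    push_cast
    exact one_div_le_one_div_of_le (by positivity) hpq
  simp only
  rw [heq, abs_div, abs_of_pos (mul_pos hp0 hq0)]
  constructor
  · exact h3.trans (by gcongr)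
  · calc _ ≤ (p * q - 1) / ((p : ℝ) * q) := by gcongr
      _ = 1 - 1 / (p * q) := by field_simp
      _ ≤ _ := by linarith

lemma sq_le_classVar (M : ℕ) {q a : ℕ} (ha : a < q) (f : ℕ → ℝ) :
    (classSum M q a f - (∑ n ∈ range M, f n) / q) ^ 2 ≤ classVar M q f :=
  single_le_sum (f := fun a => (classSum M q a f - (∑ n ∈ range M, f n) / q) ^ 2)
    (fun _ _ => sq_nonneg _) (mem_range.mpr ha)

/-- A sieve bound: a set which misses a residue class modulo every prime in `P` is small. -/
lemma card_mul_sum_inv_le (P : Finset ℕ) (Q : ℕ) (hQ : 0 < Q) (hP : ∀ p ∈ P, p.Prime ∧ p ≤ Q)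
    (M : ℕ) (S : Finset ℕ) (hS : S ⊆ range M) (b : ℕ → ℕ)
    (hb : ∀ p ∈ P, b p < p ∧ ∀ n ∈ S, n % p ≠ b p) :
    (S.card : ℝ) * ∑ p ∈ P, 1 / (p : ℝ) ≤ 7 * (M + (Q : ℝ) ^ 2) := by
  set f : ℕ → ℝ := fun n => if n ∈ S then 1 else 0 with hf
  have h1 : ∑ n ∈ range M, f n = S.card := by
    simp only [hf, sum_ite_mem, sum_const, nsmul_eq_mul, mul_one]
    rw [inter_eq_right.mpr hS]
  have h2 : ∑ n ∈ range M, f n ^ 2 = S.card := by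
    rw [← h1]
    exact sum_congr rfl fun n _ => by simp [hf]
  have h3 := sum_mul_classVar_le P Q hQ hP M f
  rw [h2] at h3
  have h4 : ∑ p ∈ P, (S.card : ℝ) ^ 2 * (1 / (p : ℝ)) ≤ ∑ p ∈ P, p * classVar M p f := by
    refine sum_le_sum fun p hp => ?_
    have h5 := sq_le_classVar M (hb p hp).1 f
    have h6 : classSum M p (b p) f = 0 := by
      refine sum_eq_zero fun n hn => ?_
      have := (mem_filter.mp hn).2
      exact if_neg fun hnS => (hb p hp).2 n hnS this
    rw [h6, h1] at h5
    have hp0 : (0 : ℝ) < p := by exact_mod_cast (hP p hp).1.pos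
    calc (S.card : ℝ) ^ 2 * (1 / (p : ℝ)) = p * (0 - S.card / p) ^ 2 := by field_simp; ring
      _ ≤ _ := by gcongr
  rw [← mul_sum] at h4
  rcases (Nat.cast_nonneg (α := ℝ) S.card).eq_or_lt with h | h
  · rw [← h, zero_mul]
    positivity
  · refine le_of_mul_le_mul_left ?_ h
    nlinarith

/-- Two sets which are disjoint modulo every prime in `P` cannot both be large. -/
lemma card_sq_mul_card_mul_card_le (P : Finset ℕ) (Q : ℕ) (hQ : 0 < Q)
    (hP : ∀ p ∈ P, p.Prime ∧ p ≤ Q) (M : ℕ) (A B : Finset ℕ) (hA : A ⊆ range M) (hB : B ⊆ range M)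
    (hAB : ∀ p ∈ P, ∀ a ∈ A, ∀ b ∈ B, a % p ≠ b % p) :
    (P.card : ℝ) ^ 2 * (A.card * B.card) ≤ (7 * (M + (Q : ℝ) ^ 2)) ^ 2 := by
  set f : ℕ → ℝ := fun n => if n ∈ A then 1 else 0 with hf
  set g : ℕ → ℝ := fun n => if n ∈ B then 1 else 0 with hg
  have sums : ∀ S : Finset ℕ, S ⊆ range M →
      ∑ n ∈ range M, (if n ∈ S then (1 : ℝ) else 0) = S.card ∧
      ∑ n ∈ range M, (if n ∈ S then (1 : ℝ) else 0) ^ 2 = S.card := by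
    intro S hS
    have h1 : ∑ n ∈ range M, (if n ∈ S then (1 : ℝ) else 0) = S.card := by
      simp only [sum_ite_mem, sum_const, nsmul_eq_mul, mul_one]
      rw [inter_eq_right.mpr hS]
    refine ⟨h1, ?_⟩
    rw [← h1]
    exact sum_congr rfl fun n _ => by simp
  obtain ⟨hA1, hA2⟩ := sums A hA
  obtain ⟨hB1, hB2⟩ := sums B hB
  have hVA := sum_mul_classVar_le P Q hQ hP M f
  have hVB := sum_mul_classVar_le P Q hQ hP M g
  simp only [hf] at hVA
  simp only [hg] at hVB
  rw [hA2] at hVA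
  rw [hB2] at hVB
  set X : ℝ := 7 * (M + (Q : ℝ) ^ 2) with hX
  have hX0 : 0 ≤ X := by positivity
  have key : ∀ p ∈ P, (A.card : ℝ) * B.card ≤
      Real.sqrt (p * classVar M p f) * Real.sqrt (p * classVar M p g) := by
    intro p hp
    have hp0 : (0 : ℝ) < p := by exact_mod_cast (hP p hp).1.pos
    have h0 : ∑ a ∈ range p, classSum M p a f * classSum M p a g = 0 := by
      refine sum_eq_zero fun a _ => ?_
      by_contra hne
      obtain ⟨h1, h2⟩ := mul_ne_zero_iff.mp hne
      obtain ⟨x, hx, hx'⟩ := exists_ne_zero_of_sum_ne_zero h1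
      obtain ⟨y, hy, hy'⟩ := exists_ne_zero_of_sum_ne_zero h2
      have hxA : x ∈ A := by by_contra h; simp [hf, h] at hx'
      have hyB : y ∈ B := by by_contra h; simp [hg, h] at hy'
      exact hAB p hp x hxA y hyB ((mem_filter.mp hx).2.trans (mem_filter.mp hy).2.symm)
    have h1 : ∑ a ∈ range p, (classSum M p a f - A.card / p) * (classSum M p a g - B.card / p) =
        - ((A.card : ℝ) * B.card / p) := by
      have : ∀ a, (classSum M p a f - A.card / p) * (classSum M p a g - B.card / p) =
          classSum M p a f * classSum M p a g - classSum M p a f * (B.card / p) -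
            A.card / p * classSum M p a g + A.card / p * (B.card / p) := fun a => by ring
      simp_rw [this, sum_add_distrib, sum_sub_distrib, ← sum_mul, ← mul_sum,
        sum_classSum (hP p hp).1.pos, h0]
      simp only [hf, hg]
      rw [hA1, hB1, sum_const, card_range, nsmul_eq_mul]
      field_simp
      ring
    have h2 : ((A.card : ℝ) * B.card / p) ^ 2 ≤ classVar M p f * classVar M p g := by
      rw [← neg_sq, ← h1]
      refine (sum_mul_sq_le_sq_mul_sq _ _ _).trans (le_of_eq ?_)
      unfold classVar
      simp only [hf, hg]
      rw [hA1, hB1]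
    rw [← Real.sqrt_mul (mul_nonneg hp0.le (classVar_nonneg _ _ _))]
    refine Real.le_sqrt_of_sq_le ?_
    calc ((A.card : ℝ) * B.card) ^ 2 = p ^ 2 * (A.card * B.card / p) ^ 2 := by field_simp
      _ ≤ p ^ 2 * (classVar M p f * classVar M p g) := by gcongr
      _ = _ := by ring
  have h1 : (P.card : ℝ) * (A.card * B.card) ≤
      ∑ p ∈ P, Real.sqrt (p * classVar M p f) * Real.sqrt (p * classVar M p g) := by
    have := card_nsmul_le_sum P _ _ key
    rwa [nsmul_eq_mul] at this
  have h2 : ((P.card : ℝ) * (A.card * B.card)) ^ 2 ≤ (X * A.card) * (X * B.card) := by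
    calc _ ≤ (∑ p ∈ P, Real.sqrt (p * classVar M p f) * Real.sqrt (p * classVar M p g)) ^ 2 := by
          gcongr
      _ ≤ (∑ p ∈ P, Real.sqrt (p * classVar M p f) ^ 2) *
          ∑ p ∈ P, Real.sqrt (p * classVar M p g) ^ 2 := sum_mul_sq_le_sq_mul_sq _ _ _
      _ = (∑ p ∈ P, p * classVar M p f) * ∑ p ∈ P, p * classVar M p g := by
          congr 1 <;> refine sum_congr rfl fun p _ => Real.sq_sqrt ?_ <;>
            exact mul_nonneg (Nat.cast_nonneg _) (classVar_nonneg _ _ _)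
      _ ≤ _ := by
          refine mul_le_mul hVA hVB ?_ (by positivity)
          exact sum_nonneg fun p _ => mul_nonneg (Nat.cast_nonneg _) (classVar_nonneg _ _ _)
  rcases (by positivity : (0 : ℝ) ≤ A.card * B.card).eq_or_lt with h | h
  · rw [← h]
    simp only [mul_zero]
    positivity
  · refine le_of_mul_le_mul_right ?_ h
    nlinarith

/-- The indicator of `1` minus the normalised indicator of the units. -/
noncomputable def unitKernel {F : Type*} [Field F] [Fintype F] [DecidableEq F] (z : F) : ℝ :=
  (if z = 1 then 1 else 0) - (if z = 0 then 0 else 1 / ((Fintype.card F : ℝ) - 1))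

lemma sum_ne_zero_const {F : Type*} [Field F] [Fintype F] [DecidableEq F] (c : ℝ) :
    ∑ z : F, (if z = 0 then 0 else c) = ((Fintype.card F : ℝ) - 1) * c := by
  have h : ∀ z : F, (if z = 0 then 0 else c) = c - (if z = 0 then c else 0) := by
    intro z; split_ifs <;> simp
  rw [sum_congr rfl fun z _ => h z, sum_sub_distrib]
  simp
  ring

lemma one_lt_card_field {F : Type*} [Field F] [Fintype F] : (1 : ℝ) < Fintype.card F := by
  exact_mod_cast Fintype.one_lt_card

lemma sum_unitKernel_mul {F : Type*} [Field F] [Fintype F] [DecidableEq F] (y : F) :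
    ∑ x : F, unitKernel (x * y) = 0 := by
  by_cases hy : y = 0
  · simp [hy, unitKernel]
  · have h := Equiv.sum_comp (Equiv.mulRight₀ y hy) (fun z => unitKernel z)
    simp only [Equiv.mulRight₀_apply] at h
    rw [h]
    unfold unitKernel
    rw [sum_sub_distrib, sum_ne_zero_const]
    have := one_lt_card_field (F := F)
    rw [mul_one_div_cancel (by linarith)]
    simp

lemma abs_sum_unitKernel_le {F : Type*} [Field F] [Fintype F] [DecidableEq F] (A B : F → ℝ) :
    |∑ x, ∑ y, unitKernel (x * y) * (A x * B y)| ≤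
      2 * (√(∑ x, A x ^ 2) * √(∑ y, B y ^ 2)) := by
  have hq := one_lt_card_field (F := F)
  set c : ℝ := (Fintype.card F : ℝ) - 1 with hc
  have hc0 : 0 < c := by linarith
  set A' : F → ℝ := fun x => if x = 0 then 0 else A x with hA'
  set B' : F → ℝ := fun x => if x = 0 then 0 else B x with hB'
  have h1 : ∑ x, ∑ y, unitKernel (x * y) * (A x * B y) =
      ∑ x, A' x * B' x⁻¹ - 1 / c * ((∑ x, A' x) * ∑ y, B' y) := by
    rw [sum_mul_sum, mul_sum, ← sum_sub_distrib]
    refine sum_congr rfl fun x _ => ?_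
    by_cases hx : x = 0
    · simp [hx, unitKernel, hA']
    · have h2 : ∀ y, unitKernel (x * y) * (A x * B y) =
          (if y = x⁻¹ then A x * B y else 0) - 1 / c * (A' x * B' y) := by
        intro y
        by_cases hy : y = 0
        · have : ¬ (0 : F) = x⁻¹ := fun h => hx (inv_eq_zero.mp h.symm)
          rw [hy, if_neg this]
          simp [unitKernel, hB']
        · have : x * y = 1 ↔ y = x⁻¹ := by
            rw [← mul_right_inj' hx (b := y), mul_inv_cancel₀ hx]
          simp only [unitKernel, this, mul_eq_zero, hx, hy, or_self, if_false, hA', hB']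
          split_ifs <;> ring
      rw [sum_congr rfl fun y _ => h2 y, sum_sub_distrib, ← mul_sum]
      simp [hA', hB', hx]
  have hA2 : ∑ x, A' x ^ 2 ≤ ∑ x, A x ^ 2 := by
    refine sum_le_sum fun x _ => ?_
    simp only [hA']; split_ifs
    · simpa using sq_nonneg _
    · rfl
  have hB2 : ∑ x, B' x ^ 2 ≤ ∑ x, B x ^ 2 := by
    refine sum_le_sum fun x _ => ?_
    simp only [hB']; split_ifs
    · simpa using sq_nonneg _
    · rfl
  have h3 : |∑ x, A' x * B' x⁻¹| ≤ √(∑ x, A x ^ 2) * √(∑ y, B y ^ 2) := by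
    rw [← Real.sqrt_mul (by positivity)]
    refine Real.abs_le_sqrt ?_
    refine (sum_mul_sq_le_sq_mul_sq _ _ _).trans ?_
    have : ∑ x, B' x⁻¹ ^ 2 = ∑ x, B' x ^ 2 :=
      Equiv.sum_comp (Equiv.inv F) (fun x => B' x ^ 2)
    rw [this]
    gcongr
  have cs : ∀ G : F → ℝ, |∑ x, (if x = 0 then 0 else G x)| ≤ √c * √(∑ x, G x ^ 2) := by
    intro G
    rw [← Real.sqrt_mul hc0.le]
    refine Real.abs_le_sqrt ?_
    have : ∑ x, (if x = 0 then 0 else G x) = ∑ x, (if x = 0 then 0 else 1) * G x :=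
      sum_congr rfl fun x _ => by split_ifs <;> simp
    rw [this]
    refine (sum_mul_sq_le_sq_mul_sq _ _ _).trans ?_
    have : ∑ x : F, (if x = 0 then (0 : ℝ) else 1) ^ 2 = c := by
      have := sum_ne_zero_const (F := F) 1
      rw [mul_one] at this
      rw [hc, ← this]
      exact sum_congr rfl fun x _ => by split_ifs <;> simp
    rw [this]
  have h4 : |1 / c * ((∑ x, A' x) * ∑ y, B' y)| ≤ √(∑ x, A x ^ 2) * √(∑ y, B y ^ 2) := by
    rw [abs_mul, abs_mul, abs_of_pos (by positivity)]
    calc _ ≤ 1 / c * ((√c * √(∑ x, A x ^ 2)) * (√c * √(∑ y, B y ^ 2))) := by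
          gcongr <;> exact cs _
      _ = 1 / c * (√c * √c) * (√(∑ x, A x ^ 2) * √(∑ y, B y ^ 2)) := by ring
      _ = _ := by rw [Real.mul_self_sqrt hc0.le]; field_simp
  rw [h1, two_mul]
  exact (abs_sub _ _).trans (add_le_add h3 h4)

lemma sum_unitKernel_sub_const {F : Type*} [Field F] [Fintype F] [DecidableEq F] (A B : F → ℝ)
    (s t : ℝ) :
    ∑ x, ∑ y, unitKernel (x * y) * ((A x - s) * (B y - t)) =
      ∑ x, ∑ y, unitKernel (x * y) * (A x * B y) := by
  have h1 : ∀ x y, unitKernel (x * y) * ((A x - s) * (B y - t)) =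
      unitKernel (x * y) * (A x * B y) - unitKernel (x * y) * (s * (B y - t))
        - unitKernel (x * y) * (A x * t) := fun x y => by ring
  simp_rw [h1, sum_sub_distrib]
  have h2 : ∑ x : F, ∑ y, unitKernel (x * y) * (s * (B y - t)) = 0 := by
    rw [sum_comm]
    refine sum_eq_zero fun y _ => ?_
    rw [← sum_mul, sum_unitKernel_mul, zero_mul]
  have h3 : ∑ x : F, ∑ y, unitKernel (x * y) * (A x * t) = 0 := by
    refine sum_eq_zero fun x _ => ?_
    simp_rw [mul_comm x]
    rw [← sum_mul, sum_unitKernel_mul, zero_mul]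
  rw [h2, h3]; ring

/-- The indicator of `k ≡ 1 (mod q)` minus its average over residue classes coprime to `q`. -/
noncomputable def residueKernel (q k : ℕ) : ℝ :=
  (if k % q = 1 then 1 else 0) - (if q ∣ k then 0 else 1 / ((q : ℝ) - 1))

lemma residueKernel_eq_unitKernel {q : ℕ} [Fact q.Prime] (k : ℕ) :
    residueKernel q k = unitKernel (k : ZMod q) := by
  have h1 : (k : ZMod q) = 1 ↔ k % q = 1 := by
    have := ZMod.natCast_eq_natCast_iff' k 1 q
    rw [Nat.cast_one, Nat.mod_eq_of_lt (Fact.out (p := q.Prime)).one_lt] at this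
    exact this
  simp only [residueKernel, unitKernel, h1, ZMod.natCast_eq_zero_iff, ZMod.card]

lemma sum_val_eq_sum_range {q : ℕ} [NeZero q] (G : ℕ → ℝ) :
    ∑ x : ZMod q, G x.val = ∑ a ∈ range q, G a := by
  refine sum_nbij' (fun x => x.val) (fun a => (a : ZMod q)) ?_ ?_ ?_ ?_ ?_
  · intro x _; exact mem_range.mpr (ZMod.val_lt x)
  · intro a _; exact mem_univ _
  · intro x _; simp
  · intro a ha; exact ZMod.val_cast_of_lt (mem_range.mp ha)
  · intro x _; rfl

lemma sum_mul_natCast_eq {q : ℕ} [NeZero q] (M : ℕ) (α : ℕ → ℝ) (g : ZMod q → ℝ) :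
    ∑ m ∈ range M, α m * g m = ∑ x : ZMod q, g x * classSum M q x.val α := by
  rw [← sum_fiberwise (range M) (fun m => (m : ZMod q))]
  refine sum_congr rfl fun x _ => ?_
  rw [classSum, mul_sum]
  have : (range M).filter (fun m : ℕ => (m : ZMod q) = x) =
      (range M).filter (fun m : ℕ => m % q = x.val) := by
    refine filter_congr fun m _ => ?_
    rw [← ZMod.val_natCast]
    exact (ZMod.val_injective q).eq_iff.symm
  rw [← this]
  refine sum_congr rfl fun m hm => ?_
  rw [(mem_filter.mp hm).2, mul_comm]

lemma abs_bilinear_le {q : ℕ} (hq : q.Prime) (M N : ℕ) (α β : ℕ → ℝ) :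
    |∑ m ∈ range M, ∑ n ∈ range N, α m * β n * residueKernel q (m * n)| ≤
      2 * (√(classVar M q α) * √(classVar N q β)) := by
  have : Fact q.Prime := ⟨hq⟩
  have h1 : ∑ m ∈ range M, ∑ n ∈ range N, α m * β n * residueKernel q (m * n) =
      ∑ x : ZMod q, ∑ y : ZMod q,
        unitKernel (x * y) * (classSum M q x.val α * classSum N q y.val β) := by
    have h2 : ∀ m, ∑ n ∈ range N, α m * β n * residueKernel q (m * n) =
        α m * ∑ y : ZMod q, unitKernel ((m : ZMod q) * y) * classSum N q y.val β := by
      intro m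
      rw [← sum_mul_natCast_eq N β (fun y => unitKernel ((m : ZMod q) * y)), mul_sum]
      refine sum_congr rfl fun n _ => ?_
      rw [residueKernel_eq_unitKernel, Nat.cast_mul]; ring
    rw [sum_congr rfl fun m _ => h2 m, sum_mul_natCast_eq M α
      (fun x => ∑ y : ZMod q, unitKernel (x * y) * classSum N q y.val β)]
    refine sum_congr rfl fun x _ => ?_
    rw [sum_mul]
    exact sum_congr rfl fun y _ => by ring
  rw [h1, ← sum_unitKernel_sub_const _ _ ((∑ n ∈ range M, α n) / q) ((∑ n ∈ range N, β n) / q)]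
  refine (abs_sum_unitKernel_le _ _).trans_eq ?_
  rw [classVar, classVar,
    ← sum_val_eq_sum_range (fun a => (classSum M q a α - (∑ n ∈ range M, α n) / q) ^ 2),
    ← sum_val_eq_sum_range (fun a => (classSum N q a β - (∑ n ∈ range N, β n) / q) ^ 2)]

lemma sum_abs_bilinear_le (P : Finset ℕ) {Q : ℕ} (hQ : 0 < Q)
    (hP : ∀ q ∈ P, q.Prime ∧ Q < q ∧ q ≤ 2 * Q) (M N : ℕ) (α β : ℕ → ℝ) :
    ∑ q ∈ P, |∑ m ∈ range M, ∑ n ∈ range N, α m * β n * residueKernel q (m * n)| ≤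
      14 / Q * (√((M + 4 * (Q : ℝ) ^ 2) * ∑ m ∈ range M, α m ^ 2) *
        √((N + 4 * (Q : ℝ) ^ 2) * ∑ n ∈ range N, β n ^ 2)) := by
  have hQ0 : (0 : ℝ) < Q := by exact_mod_cast hQ
  have key : ∀ (M : ℕ) (α : ℕ → ℝ), ∑ q ∈ P, classVar M q α ≤
      7 / Q * ((M + 4 * (Q : ℝ) ^ 2) * ∑ m ∈ range M, α m ^ 2) := by
    intro M α
    have h := sum_mul_classVar_le P (2 * Q) (by omega) (fun p hp => ⟨(hP p hp).1, (hP p hp).2.2⟩)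
      M α
    have h2 : Q * ∑ q ∈ P, classVar M q α ≤ ∑ q ∈ P, q * classVar M q α := by
      rw [mul_sum]
      refine sum_le_sum fun q hq => ?_
      have := classVar_nonneg M q α
      have h3 : (Q : ℝ) ≤ q := by exact_mod_cast (hP q hq).2.1.le
      gcongr
    rw [div_mul_eq_mul_div, le_div_iff₀ hQ0, mul_comm]
    refine h2.trans (h.trans_eq ?_)
    push_cast; ring
  calc _ ≤ ∑ q ∈ P, 2 * (√(classVar M q α) * √(classVar N q β)) :=
        sum_le_sum fun q hq => abs_bilinear_le (hP q hq).1 M N α β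
    _ = 2 * ∑ q ∈ P, √(classVar M q α) * √(classVar N q β) := by rw [mul_sum]
    _ ≤ 2 * (√(∑ q ∈ P, classVar M q α) * √(∑ q ∈ P, classVar N q β)) := by
        gcongr
        exact Real.sum_sqrt_mul_sqrt_le _ (fun q => classVar_nonneg _ _ _)
          (fun q => classVar_nonneg _ _ _)
    _ ≤ 2 * (√(7 / Q * ((M + 4 * (Q : ℝ) ^ 2) * ∑ m ∈ range M, α m ^ 2)) *
          √(7 / Q * ((N + 4 * (Q : ℝ) ^ 2) * ∑ n ∈ range N, β n ^ 2))) := by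
        gcongr <;> exact key _ _
    _ = _ := by
        rw [Real.sqrt_mul (by positivity), Real.sqrt_mul (by positivity : (0 : ℝ) ≤ 7 / Q)]
        have : √(7 / (Q : ℝ)) * √(7 / (Q : ℝ)) = 7 / Q := Real.mul_self_sqrt (by positivity)
        linear_combination 2 * √((M + 4 * (Q : ℝ) ^ 2) * ∑ m ∈ range M, α m ^ 2) *
          √((N + 4 * (Q : ℝ) ^ 2) * ∑ n ∈ range N, β n ^ 2) * this

lemma sum_log_filter_dvd_le (P : Finset ℕ) (hP : ∀ q ∈ P, q.Prime) {k : ℕ} (hk : k ≠ 0) :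
    ∑ q ∈ P with q ∣ k, Real.log q ≤ Real.log k := by
  rw [← Real.log_prod fun q hq => by
    exact_mod_cast (hP q (mem_filter.mp hq).1).ne_zero, ← Nat.cast_prod]
  have h : ∏ q ∈ P with q ∣ k, q ∣ k :=
    prod_primes_dvd k (fun q hq => (hP q (mem_filter.mp hq).1).prime)
      fun q hq => (mem_filter.mp hq).2
  refine Real.log_le_log ?_ ?_
  · exact_mod_cast prod_pos fun q hq => (hP q (mem_filter.mp hq).1).pos
  · exact_mod_cast Nat.le_of_dvd (Nat.pos_of_ne_zero hk) h

lemma log_four_le : Real.log 4 ≤ 1.4 := by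
  have : Real.log 4 = 2 * Real.log 2 := by
    rw [show (4 : ℝ) = 2 ^ 2 by norm_num, Real.log_pow]; norm_num
  rw [this]
  linarith [Real.log_two_lt_d9]

lemma sum_log_le_theta (P : Finset ℕ) (R : ℝ) (hP : ∀ q ∈ P, q.Prime ∧ (q : ℝ) ≤ R) :
    ∑ q ∈ P, Real.log q ≤ 1.4 * max R 0 := by
  have h1 : ∑ q ∈ P, Real.log q ≤ Chebyshev.theta (max R 0) := by
    rw [Chebyshev.theta]
    refine sum_le_sum_of_subset_of_nonneg ?_ fun q _ _ => Real.log_natCast_nonneg q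
    intro q hq
    have := hP q hq
    simp only [mem_filter, mem_Ioc]
    exact ⟨⟨this.1.pos, Nat.le_floor (this.2.trans (le_max_left _ _))⟩, this.1⟩
  have h2 := Chebyshev.theta_le_log4_mul_x (le_max_right R 0)
  have h3 := log_four_le
  have h4 : 0 ≤ max R 0 := le_max_right _ _
  nlinarith

lemma sum_log_dyadic_le (P : Finset ℕ) {Q : ℕ} (hP : ∀ q ∈ P, q.Prime ∧ Q < q ∧ q ≤ 2 * Q) :
    ∑ q ∈ P, Real.log q ≤ 3 * Q := by
  have h := sum_log_le_theta P (2 * Q) fun q hq => ⟨(hP q hq).1, by exact_mod_cast (hP q hq).2.2⟩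
  rw [max_eq_left (by positivity)] at h
  have : (0 : ℝ) ≤ Q := by positivity
  linarith

lemma abs_residueKernel_le {q k : ℕ} (hq : 1 < q) :
    |residueKernel q k| ≤ (if q ∣ k - 1 then 1 else 0) + 1 / ((q : ℝ) - 1) := by
  have hq1 : (0 : ℝ) < (q : ℝ) - 1 := by
    have : (1 : ℝ) < q := by exact_mod_cast hq
    linarith
  have h1 : (0 : ℝ) < 1 / ((q : ℝ) - 1) := by positivity
  unfold residueKernel
  refine (abs_sub _ _).trans (add_le_add ?_ ?_)
  · split_ifs with h h'
    · simp
    · exact absurd (by simpa [h] using Nat.dvd_sub_mod (n := q) k) h'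
    · simp
    · simp
  · split_ifs
    · simpa using h1.le
    · rw [abs_of_pos h1]

lemma sum_log_mul_abs_residueKernel_le (P : Finset ℕ) {Q : ℕ} (hQ : 0 < Q)
    (hP : ∀ q ∈ P, q.Prime ∧ Q < q ∧ q ≤ 2 * Q) {k : ℕ} (hk : 2 ≤ k) :
    ∑ q ∈ P, Real.log q * |residueKernel q k| ≤ Real.log k + 3 := by
  have hQ0 : (0 : ℝ) < Q := by exact_mod_cast hQ
  have h1 : ∀ q ∈ P, Real.log q * |residueKernel q k| ≤
      (if q ∣ k - 1 then Real.log q else 0) + Real.log q * (1 / Q) := by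
    intro q hq
    have hq1 : (Q : ℝ) ≤ (q : ℝ) - 1 := by
      have : (Q : ℝ) + 1 ≤ q := by exact_mod_cast (hP q hq).2.1
      linarith
    have h2 : Real.log q * |residueKernel q k| ≤
        Real.log q * ((if q ∣ k - 1 then 1 else 0) + 1 / Q) := by
      refine mul_le_mul_of_nonneg_left ?_ (Real.log_natCast_nonneg q)
      refine (abs_residueKernel_le (hP q hq).1.one_lt).trans ?_
      gcongr
    refine h2.trans_eq ?_
    split_ifs <;> ring
  refine (sum_le_sum h1).trans ?_
  rw [sum_add_distrib, ← sum_filter, ← sum_mul]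
  refine add_le_add ?_ ?_
  · refine (sum_log_filter_dvd_le P (fun q hq => (hP q hq).1) (by omega)).trans ?_
    refine Real.log_le_log ?_ ?_
    · exact_mod_cast (by omega : 0 < k - 1)
    · exact_mod_cast Nat.sub_le k 1
  · rw [mul_one_div, div_le_iff₀ hQ0]
    exact sum_log_dyadic_le P hP

lemma residueKernel_add_mul (q k l : ℕ) : residueKernel q (k + q * l) = residueKernel q k := by
  unfold residueKernel
  have : q ∣ k + q * l ↔ q ∣ k := (Nat.dvd_add_left (dvd_mul_right q l))
  simp only [Nat.add_mul_mod_self_left, this]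

lemma sum_residueKernel_period {q : ℕ} (hq : q.Prime) (d : ℕ) :
    ∑ m ∈ range q, residueKernel q (d * m) = 0 := by
  have : Fact q.Prime := ⟨hq⟩
  rw [← sum_val_eq_sum_range (fun m => residueKernel q (d * m))]
  have h : ∀ x : ZMod q, residueKernel q (d * x.val) = unitKernel (x * (d : ZMod q)) := by
    intro x
    rw [residueKernel_eq_unitKernel, Nat.cast_mul, ZMod.natCast_zmod_val, mul_comm]
  rw [sum_congr rfl fun x _ => h x, sum_unitKernel_mul]

lemma abs_sum_residueKernel_le {q d : ℕ} (hq : q.Prime) (hd : ¬ q ∣ d) (X : ℕ) :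
    |∑ m ∈ range X, residueKernel q (d * m)| ≤ 1 := by
  have hper : ∀ t m, residueKernel q (d * (q * t + m)) = residueKernel q (d * m) := by
    intro t m
    rw [← residueKernel_add_mul q (d * m) (d * t)]
    congr 1; ring
  have hblock : ∀ t, ∑ m ∈ range (q * t), residueKernel q (d * m) = 0 := by
    intro t
    induction t with
    | zero => simp
    | succ t ih =>
      rw [Nat.mul_succ, sum_range_add, ih, zero_add, sum_congr rfl fun m _ => hper t m]
      exact sum_residueKernel_period hq d
  rw [← Nat.div_add_mod X q, sum_range_add, hblock, zero_add, sum_congr rfl fun m _ => hper _ m]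
  set s := X % q with hs
  have hsq : s < q := Nat.mod_lt _ hq.pos
  have hq1 : (0 : ℝ) < (q : ℝ) - 1 := by
    have : (1 : ℝ) < q := by exact_mod_cast hq.one_lt
    linarith
  simp only [residueKernel, sum_sub_distrib]
  have h1 : ∑ m ∈ range s, (if d * m % q = 1 then (1 : ℝ) else 0) ≤ 1 := by
    rw [← sum_filter, sum_const, nsmul_eq_mul, mul_one]
    have : ((range s).filter fun m => d * m % q = 1).card ≤ 1 := by
      rw [card_le_one]
      intro a ha b hb
      simp only [mem_filter, mem_range] at ha hb
      have h2 : d * a ≡ d * b [MOD q] := ha.2.trans hb.2.symm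
      have h3 := Nat.ModEq.cancel_left_of_coprime ((Nat.Prime.coprime_iff_not_dvd hq).mpr hd) h2
      exact Nat.ModEq.eq_of_lt_of_lt h3 (by omega) (by omega)
    exact_mod_cast this
  have h1' : 0 ≤ ∑ m ∈ range s, (if d * m % q = 1 then (1 : ℝ) else 0) :=
    sum_nonneg fun m _ => by split_ifs <;> norm_num
  have h2' : 0 ≤ ∑ m ∈ range s, (if q ∣ d * m then (0 : ℝ) else 1 / ((q : ℝ) - 1)) :=
    sum_nonneg fun m _ => by split_ifs <;> positivity
  have h2 : ∑ m ∈ range s, (if q ∣ d * m then (0 : ℝ) else 1 / ((q : ℝ) - 1)) ≤ 1 := by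
    calc _ ≤ ∑ m ∈ range q, (if q ∣ d * m then (0 : ℝ) else 1 / ((q : ℝ) - 1)) :=
          sum_le_sum_of_subset_of_nonneg (range_subset_range.mpr hsq.le)
            fun m _ _ => by split_ifs <;> positivity
      _ ≤ ∑ m ∈ range q, (if m = 0 then (0 : ℝ) else 1 / ((q : ℝ) - 1)) := by
          refine sum_le_sum fun m _ => ?_
          by_cases hm : m = 0
          · simp [hm]
          · rw [if_neg hm]; split_ifs
            · positivity
            · rfl
      _ = 1 := by
          obtain ⟨r, rfl⟩ : ∃ r, q = r + 1 := ⟨q - 1, by have := hq.pos; omega⟩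
          rw [sum_range_succ']
          push_cast at hq1 ⊢
          simp at hq1 ⊢
          field_simp
  rw [abs_le]; constructor <;> linarith

lemma abs_sum_monotone_mul_le {h f : ℕ → ℝ} (hm : Monotone h) (h0 : 0 ≤ h 0)
    (hf : ∀ X, |∑ m ∈ range X, f m| ≤ 1) (X : ℕ) :
    |∑ m ∈ range (X + 1), h m * f m| ≤ 2 * h X := by
  have := sum_range_by_parts h f (X + 1)
  simp only [smul_eq_mul, add_tsub_cancel_right] at this
  rw [this]
  have hX : 0 ≤ h X := h0.trans (hm (Nat.zero_le X))
  refine (abs_sub _ _).trans ?_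
  have h1 : |h X * ∑ i ∈ range (X + 1), f i| ≤ h X := by
    rw [abs_mul, abs_of_nonneg hX]
    exact mul_le_of_le_one_right hX (hf _)
  have h2 : |∑ i ∈ range X, (h (i + 1) - h i) * ∑ i ∈ range (i + 1), f i| ≤ h X - h 0 := by
    rw [← sum_range_sub]
    refine (abs_sum_le_sum_abs _ _).trans (sum_le_sum fun i _ => ?_)
    have : 0 ≤ h (i + 1) - h i := sub_nonneg.mpr (hm (Nat.le_succ i))
    rw [abs_mul, abs_of_nonneg this]
    exact mul_le_of_le_one_right this (hf _)
  linarith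

lemma monotone_log_natCast : Monotone fun n : ℕ => Real.log n := by
  intro a b hab
  rcases Nat.eq_zero_or_pos a with rfl | ha
  · simpa using Real.log_natCast_nonneg b
  · exact Real.log_le_log (by exact_mod_cast ha) (by exact_mod_cast hab)

lemma abs_sum_Ioc_residueKernel_le {q : ℕ} (hq : q.Prime) (d X : ℕ) :
    |∑ m ∈ Ioc 0 X, residueKernel q (d * m)| ≤ 1 := by
  by_cases hd : q ∣ d
  · have : ∀ m, residueKernel q (d * m) = 0 := by
      intro m
      obtain ⟨c, rfl⟩ := hd
      simp [residueKernel, mul_assoc, Nat.mul_mod_right]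
    simp [this]
  · have h := abs_sum_residueKernel_le hq hd (X + 1)
    rw [range_eq_Ico, sum_eq_sum_Ico_succ_bot (by omega)] at h
    have h0 : residueKernel q (d * 0) = 0 := by simp [residueKernel]
    rw [h0, zero_add] at h
    exact h

lemma abs_sum_Ioc_log_mul_residueKernel_le {q : ℕ} (hq : q.Prime) (d X : ℕ) :
    |∑ m ∈ Ioc 0 X, Real.log m * residueKernel q (d * m)| ≤ 2 * Real.log X := by
  by_cases hd : q ∣ d
  · have : ∀ m, residueKernel q (d * m) = 0 := by
      intro m
      obtain ⟨c, rfl⟩ := hd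
      simp [residueKernel, mul_assoc, Nat.mul_mod_right]
    simpa [this] using Real.log_natCast_nonneg X
  · have h := abs_sum_monotone_mul_le monotone_log_natCast (by simp)
      (abs_sum_residueKernel_le hq hd) X
    rw [range_eq_Ico, sum_eq_sum_Ico_succ_bot (by omega)] at h
    simp only [Nat.cast_zero, Real.log_zero, zero_mul, zero_add] at h
    exact h

section Vaughan

open ArithmeticFunction ArithmeticFunction.Moebius ArithmeticFunction.zeta

/-- Truncation of an arithmetic function to arguments at most `U`. -/
def lowPart (U : ℕ) (f : ArithmeticFunction ℝ) : ArithmeticFunction ℝ :=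
  ⟨fun n => if n ≤ U then f n else 0, by simp⟩

/-- Truncation of an arithmetic function to arguments exceeding `U`. -/
def highPart (U : ℕ) (f : ArithmeticFunction ℝ) : ArithmeticFunction ℝ :=
  ⟨fun n => if n ≤ U then 0 else f n, by simp⟩

lemma lowPart_apply (U : ℕ) (f : ArithmeticFunction ℝ) (n : ℕ) :
    lowPart U f n = if n ≤ U then f n else 0 := rfl

lemma highPart_apply (U : ℕ) (f : ArithmeticFunction ℝ) (n : ℕ) :
    highPart U f n = if n ≤ U then 0 else f n := rfl

lemma lowPart_add_highPart (U : ℕ) (f : ArithmeticFunction ℝ) :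
    lowPart U f + highPart U f = f := by
  ext n
  rw [ArithmeticFunction.add_apply, lowPart_apply, highPart_apply]
  split_ifs <;> simp

lemma vaughan_identity (U : ℕ) :
    (Λ : ArithmeticFunction ℝ) = lowPart U Λ + lowPart U (μ : ArithmeticFunction ℝ) * log
      - lowPart U (μ : ArithmeticFunction ℝ) * lowPart U Λ * (ζ : ArithmeticFunction ℝ)
      + highPart U (μ : ArithmeticFunction ℝ) * ((ζ : ArithmeticFunction ℝ) * highPart U Λ) := by
  have h1 := lowPart_add_highPart U (μ : ArithmeticFunction ℝ)
  have h2 := lowPart_add_highPart U Λ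
  have h3 : ((μ : ArithmeticFunction ℝ) * (ζ : ArithmeticFunction ℝ)) = 1 :=
    coe_moebius_mul_coe_zeta
  have h4 : (Λ : ArithmeticFunction ℝ) * (ζ : ArithmeticFunction ℝ) = log := vonMangoldt_mul_zeta
  linear_combination (-1 : ArithmeticFunction ℝ) * h2 - highPart U Λ * h3
    - highPart U Λ * (ζ : ArithmeticFunction ℝ) * h1
    + lowPart U (μ : ArithmeticFunction ℝ) * h4
    + lowPart U (μ : ArithmeticFunction ℝ) * (ζ : ArithmeticFunction ℝ) * h2

lemma sum_Ioc_mul_apply_mul (f g : ArithmeticFunction ℝ) (w : ℕ → ℝ) (N : ℕ) :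
    ∑ n ∈ Ioc 0 N, (f * g) n * w n =
      ∑ d ∈ Ioc 0 N, f d * ∑ m ∈ Ioc 0 (N / d), g m * w (d * m) := by
  have h1 : ∑ n ∈ Ioc 0 N, (f * g) n * w n =
      ∑ x ∈ Ioc 0 N ×ˢ Ioc 0 N with x.1 * x.2 ≤ N, f x.1 * g x.2 * w (x.1 * x.2) := by
    simp only [mul_apply]
    trans ∑ n ∈ Ioc 0 N, ∑ x ∈ Ioc 0 N ×ˢ Ioc 0 N with x.1 * x.2 = n,
      f x.1 * g x.2 * w (x.1 * x.2)
    · refine sum_congr rfl fun n hn => ?_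
      simp only [mem_Ioc] at hn
      rw [Nat.divisorsAntidiagonal_eq_prod_filter_of_le hn.1.ne' hn.2, sum_mul]
      exact sum_congr rfl fun x hx => by rw [(mem_filter.mp hx).2]
    · simp_rw [sum_filter]
      rw [sum_comm]
      exact sum_congr rfl fun _ _ => (by simp_all)
  rw [h1, sum_filter, sum_product]
  refine sum_congr rfl fun n hn => ?_
  rw [← sum_filter, mul_sum]
  have h2 : (Ioc 0 N).filter (fun m => n * m ≤ N) = Ioc 0 (N / n) := by
    ext m
    simp only [mem_filter, mem_Ioc] at hn ⊢
    rw [Nat.le_div_iff_mul_le hn.1, mul_comm m n]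
    constructor
    · exact fun h => ⟨h.1.1, h.2⟩
    · exact fun h => ⟨⟨h.1, (Nat.le_mul_of_pos_left m hn.1).trans h.2⟩, h.2⟩
  rw [h2]
  exact sum_congr rfl fun m _ => by ring

/-- Weighted total discrepancy of `f` in the residue class `1` over the moduli in `P`. -/
noncomputable def discrepancy (P : Finset ℕ) (N : ℕ) (f : ArithmeticFunction ℝ) : ℝ :=
  ∑ q ∈ P, Real.log q * |∑ n ∈ Ioc 0 N, f n * residueKernel q n|

lemma discrepancy_add_le (P : Finset ℕ) (N : ℕ) (f g : ArithmeticFunction ℝ) :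
    discrepancy P N (f + g) ≤ discrepancy P N f + discrepancy P N g := by
  rw [discrepancy, discrepancy, discrepancy, ← sum_add_distrib]
  refine sum_le_sum fun q _ => ?_
  rw [← mul_add]
  refine mul_le_mul_of_nonneg_left ?_ (Real.log_natCast_nonneg q)
  simp_rw [ArithmeticFunction.add_apply, add_mul]
  rw [sum_add_distrib]
  exact abs_add_le _ _

lemma discrepancy_neg (P : Finset ℕ) (N : ℕ) (f : ArithmeticFunction ℝ) :
    discrepancy P N (-f) = discrepancy P N f := by
  refine sum_congr rfl fun q _ => ?_
  congr 1
  rw [← abs_neg, ← sum_neg_distrib]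
  congr 1
  exact sum_congr rfl fun n _ => by rw [ArithmeticFunction.neg_apply]; ring

lemma discrepancy_convolution_le (P : Finset ℕ) {Q : ℕ}
    (hP : ∀ q ∈ P, q.Prime ∧ Q < q ∧ q ≤ 2 * Q) (N D : ℕ) (f g : ArithmeticFunction ℝ) (G B : ℝ)
    (hB : 0 ≤ B) (hf : ∀ d ∈ Ioc 0 N, |f d| ≤ G) (hfD : ∀ d, D < d → f d = 0)
    (hg : ∀ q ∈ P, ∀ d ∈ Ioc 0 N,
      |∑ m ∈ Ioc 0 (N / d), g m * residueKernel q (d * m)| ≤ B) (hG : 0 ≤ G) :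
    discrepancy P N (f * g) ≤ 3 * Q * (D * (G * B)) := by
  have h : ∀ q ∈ P, Real.log q * |∑ n ∈ Ioc 0 N, (f * g) n * residueKernel q n| ≤
      Real.log q * (D * (G * B)) := by
    intro q hq
    refine mul_le_mul_of_nonneg_left ?_ (Real.log_natCast_nonneg q)
    rw [sum_Ioc_mul_apply_mul]
    refine (abs_sum_le_sum_abs _ _).trans ?_
    have h1 : ∀ d ∈ Ioc 0 N, |f d * ∑ m ∈ Ioc 0 (N / d), g m * residueKernel q (d * m)| ≤
        if d ≤ D then G * B else 0 := by
      intro d hd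
      split_ifs with hdD
      · rw [abs_mul]
        exact mul_le_mul (hf d hd) (hg q hq d hd) (abs_nonneg _) hG
      · rw [hfD d (by omega)]; simp
    refine (sum_le_sum h1).trans ?_
    rw [← sum_filter, sum_const, nsmul_eq_mul]
    refine mul_le_mul_of_nonneg_right ?_ (by positivity)
    have : (Ioc 0 N).filter (fun d => d ≤ D) ⊆ Ioc 0 D := by
      intro d hd
      simp only [mem_filter, mem_Ioc] at hd ⊢
      omega
    exact_mod_cast (card_le_card this).trans_eq (by simp)
  refine (sum_le_sum h).trans ?_
  rw [← sum_mul]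
  exact mul_le_mul_of_nonneg_right (sum_log_dyadic_le P hP) (by positivity)

lemma abs_lowPart_moebius_le (U n : ℕ) : |lowPart U (μ : ArithmeticFunction ℝ) n| ≤ 1 := by
  rw [lowPart_apply]
  split_ifs
  · rw [intCoe_apply]; exact_mod_cast abs_moebius_le_one
  · simp

lemma abs_highPart_moebius_le (U n : ℕ) : |highPart U (μ : ArithmeticFunction ℝ) n| ≤ 1 := by
  rw [highPart_apply]
  split_ifs
  · simp
  · rw [intCoe_apply]; exact_mod_cast abs_moebius_le_one

lemma lowPart_vonMangoldt_nonneg (U n : ℕ) : 0 ≤ lowPart U Λ n := by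
  rw [lowPart_apply]; split_ifs <;> simp [vonMangoldt_nonneg]

lemma lowPart_vonMangoldt_le (U n : ℕ) : lowPart U Λ n ≤ Λ n := by
  rw [lowPart_apply]; split_ifs <;> simp [vonMangoldt_nonneg]

lemma highPart_vonMangoldt_nonneg (U n : ℕ) : 0 ≤ highPart U Λ n := by
  rw [highPart_apply]; split_ifs <;> simp [vonMangoldt_nonneg]

lemma highPart_vonMangoldt_le (U n : ℕ) : highPart U Λ n ≤ Λ n := by
  rw [highPart_apply]; split_ifs <;> simp [vonMangoldt_nonneg]

lemma zeta_mul_highPart_nonneg (U n : ℕ) :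
    0 ≤ ((ζ : ArithmeticFunction ℝ) * highPart U Λ) n := by
  rw [coe_zeta_mul_apply]
  exact sum_nonneg fun i _ => highPart_vonMangoldt_nonneg U i

lemma zeta_mul_highPart_le (U n : ℕ) :
    ((ζ : ArithmeticFunction ℝ) * highPart U Λ) n ≤ Real.log n := by
  rw [coe_zeta_mul_apply, ← vonMangoldt_sum]
  exact sum_le_sum fun i _ => highPart_vonMangoldt_le U i

lemma zeta_mul_highPart_eq_zero {U n : ℕ} (h : n ≤ U) :
    ((ζ : ArithmeticFunction ℝ) * highPart U Λ) n = 0 := by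
  rw [coe_zeta_mul_apply]
  refine sum_eq_zero fun i hi => ?_
  rw [highPart_apply, if_pos ((Nat.divisor_le hi).trans h)]

lemma abs_lowPart_mul_lowPart_le (U n : ℕ) :
    |(lowPart U (μ : ArithmeticFunction ℝ) * lowPart U Λ) n| ≤ Real.log n := by
  rw [mul_apply]
  refine (abs_sum_le_sum_abs _ _).trans ?_
  have h : ∀ x ∈ n.divisorsAntidiagonal,
      |lowPart U (μ : ArithmeticFunction ℝ) x.1 * lowPart U Λ x.2| ≤ Λ x.2 := by
    intro x _
    rw [abs_mul, abs_of_nonneg (lowPart_vonMangoldt_nonneg U _)]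
    calc _ ≤ 1 * Λ x.2 := mul_le_mul (abs_lowPart_moebius_le U _) (lowPart_vonMangoldt_le U _)
          (lowPart_vonMangoldt_nonneg U _) zero_le_one
      _ = _ := one_mul _
  refine (sum_le_sum h).trans ?_
  rw [Nat.sum_divisorsAntidiagonal' (f := fun _ j => Λ j), vonMangoldt_sum]

lemma lowPart_mul_lowPart_eq_zero {U n : ℕ} (h : U * U < n) :
    (lowPart U (μ : ArithmeticFunction ℝ) * lowPart U Λ) n = 0 := by
  rw [mul_apply]
  refine sum_eq_zero fun x hx => ?_
  have hx' := (Nat.mem_divisorsAntidiagonal.mp hx).1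
  rw [lowPart_apply, lowPart_apply]
  split_ifs with h1 h2
  · exact absurd (Nat.mul_le_mul h1 h2) (by omega)
  all_goals simp

lemma discrepancy_lowPart_mul_log_le (P : Finset ℕ) {Q : ℕ}
    (hP : ∀ q ∈ P, q.Prime ∧ Q < q ∧ q ≤ 2 * Q) (N U : ℕ) :
    discrepancy P N (lowPart U (μ : ArithmeticFunction ℝ) * log) ≤
      6 * Q * U * Real.log N := by
  refine (discrepancy_convolution_le P hP N U _ _ 1 (2 * Real.log N)
    (by have := Real.log_natCast_nonneg N; positivity)
    (fun d _ => abs_lowPart_moebius_le U d)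
    (fun d hd => by rw [lowPart_apply, if_neg (by omega)]) ?_ zero_le_one).trans_eq (by ring)
  intro q hq d hd
  simp_rw [log_apply]
  refine (abs_sum_Ioc_log_mul_residueKernel_le (hP q hq).1 d _).trans ?_
  gcongr 2 * ?_
  exact monotone_log_natCast (Nat.div_le_self _ _)

lemma discrepancy_lowPart_mul_lowPart_mul_zeta_le (P : Finset ℕ) {Q : ℕ}
    (hP : ∀ q ∈ P, q.Prime ∧ Q < q ∧ q ≤ 2 * Q) (N U : ℕ) :
    discrepancy P N (lowPart U (μ : ArithmeticFunction ℝ) * lowPart U Λ *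
       (ζ : ArithmeticFunction ℝ))
      ≤ 3 * Q * (U : ℝ) ^ 2 * Real.log N := by
  refine (discrepancy_convolution_le P hP N (U * U) _ _ (Real.log N) 1 zero_le_one ?_
    (fun d hd => lowPart_mul_lowPart_eq_zero hd) ?_ (Real.log_natCast_nonneg N)).trans_eq
      (by push_cast; ring)
  · intro d hd
    exact (abs_lowPart_mul_lowPart_le U d).trans (monotone_log_natCast (mem_Ioc.mp hd).2)
  · intro q hq d hd
    have h : ∀ m ∈ Ioc 0 (N / d), (ζ : ArithmeticFunction ℝ) m * residueKernel q (d * m) =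
        residueKernel q (d * m) := by
      intro m hm
      rw [natCoe_apply, zeta_apply, if_neg (mem_Ioc.mp hm).1.ne']; simp
    rw [sum_congr rfl h]
    exact abs_sum_Ioc_residueKernel_le (hP q hq).1 d _

lemma discrepancy_le_sum (P : Finset ℕ) {Q : ℕ} (hQ : 0 < Q)
    (hP : ∀ q ∈ P, q.Prime ∧ Q < q ∧ q ≤ 2 * Q) (N : ℕ) (f : ArithmeticFunction ℝ)
    (h1 : f 1 = 0) :
    discrepancy P N f ≤ ∑ n ∈ Ioc 0 N, |f n| * (Real.log N + 3) := by
  calc discrepancy P N f ≤ ∑ q ∈ P, ∑ n ∈ Ioc 0 N, |f n| * (Real.log q * |residueKernel q n|) := by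
        refine sum_le_sum fun q _ => ?_
        refine (mul_le_mul_of_nonneg_left (abs_sum_le_sum_abs _ _)
          (Real.log_natCast_nonneg q)).trans_eq ?_
        rw [mul_sum]
        exact sum_congr rfl fun n _ => by rw [abs_mul]; ring
    _ = ∑ n ∈ Ioc 0 N, |f n| * ∑ q ∈ P, Real.log q * |residueKernel q n| := by
        rw [sum_comm]
        exact sum_congr rfl fun n _ => by rw [mul_sum]
    _ ≤ _ := by
        refine sum_le_sum fun n hn => ?_
        rcases eq_or_ne n 1 with rfl | hn1
        · simp [h1]
        · have hn' := mem_Ioc.mp hn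
          refine mul_le_mul_of_nonneg_left ?_ (abs_nonneg _)
          refine (sum_log_mul_abs_residueKernel_le P hQ hP (by omega)).trans ?_
          have := monotone_log_natCast hn'.2
          simp only at this
          linarith

lemma discrepancy_lowPart_vonMangoldt_le (P : Finset ℕ) {Q : ℕ} (hQ : 0 < Q)
    (hP : ∀ q ∈ P, q.Prime ∧ Q < q ∧ q ≤ 2 * Q) (N U : ℕ) :
    discrepancy P N (lowPart U Λ) ≤ U * Real.log N * (Real.log N + 3) := by
  have hL := Real.log_natCast_nonneg N
  refine (discrepancy_le_sum P hQ hP N _ (by rw [lowPart_apply]; simp)).trans ?_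
  rw [← sum_mul]
  refine mul_le_mul_of_nonneg_right ?_ (by positivity)
  calc ∑ n ∈ Ioc 0 N, |lowPart U Λ n| ≤ ∑ n ∈ Ioc 0 N, if n ≤ U then Real.log N else 0 := by
        refine sum_le_sum fun n hn => ?_
        rw [lowPart_apply]
        split_ifs
        · rw [abs_of_nonneg vonMangoldt_nonneg]
          exact vonMangoldt_le_log.trans (monotone_log_natCast (mem_Ioc.mp hn).2)
        · simp
    _ ≤ _ := by
        rw [← sum_filter, sum_const, nsmul_eq_mul]
        refine mul_le_mul_of_nonneg_right ?_ hL
        have : (Ioc 0 N).filter (fun d => d ≤ U) ⊆ Ioc 0 U := by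
          intro d hd
          simp only [mem_filter, mem_Ioc] at hd ⊢
          omega
        exact_mod_cast (card_le_card this).trans_eq (by simp)

end Vaughan

lemma bilinear_block_arith {Q L a x u : ℝ} (hQ : 0 < Q) (hL : 0 ≤ L) (hu : 0 < u) (ha : u ≤ a)
    (hx : u ≤ 2 * x) :
    14 / Q * ((2 * (a ^ 2 + Q * a)) * (2 * L * (x ^ 2 + Q * x))) ≤
      56 * L * ((a * x) ^ 2 / Q + 3 * (a * x) ^ 2 / u + Q * (a * x)) := by
  have hx0 : 0 < x := by linarith
  have ha0 : 0 < a := by linarith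
  have h1 : a ^ 2 * x ≤ 2 * (a * x) ^ 2 / u := by
    rw [le_div_iff₀ hu]
    calc a ^ 2 * x * u ≤ a ^ 2 * x * (2 * x) := by gcongr
      _ = _ := by ring
  have h2 : a * x ^ 2 ≤ (a * x) ^ 2 / u := by
    rw [le_div_iff₀ hu]
    calc a * x ^ 2 * u ≤ a * x ^ 2 * a := by gcongr
      _ = _ := by ring
  have h3 : 14 / Q * ((2 * (a ^ 2 + Q * a)) * (2 * L * (x ^ 2 + Q * x))) =
      56 * L * ((a * x) ^ 2 / Q + a ^ 2 * x + a * x ^ 2 + Q * (a * x)) := by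
    field_simp; ring
  have h4 : 3 * (a * x) ^ 2 / u = 2 * (a * x) ^ 2 / u + (a * x) ^ 2 / u := by ring
  rw [h3, h4]
  refine mul_le_mul_of_nonneg_left ?_ (by positivity)
  linarith

lemma floor_log_bounds {K : ℝ} (hK : 0 < K) {d : ℕ} (hd : 0 < d) :
    Real.exp (⌊K * Real.log d⌋₊ / K) ≤ d ∧ (d : ℝ) < Real.exp ((⌊K * Real.log d⌋₊ + 1) / K) := by
  have hd0 : (0 : ℝ) < d := by exact_mod_cast hd
  have h0 : 0 ≤ K * Real.log d := mul_nonneg hK.le (Real.log_natCast_nonneg d)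
  constructor
  · rw [← Real.le_log_iff_exp_le hd0, div_le_iff₀ hK, mul_comm (Real.log _)]
    exact Nat.floor_le h0
  · rw [← Real.log_lt_iff_lt_exp hd0, lt_div_iff₀ hK, mul_comm (Real.log _)]
    exact Nat.lt_floor_add_one _

lemma sum_log_mul_abs_block_le (P : Finset ℕ) {Q N U : ℕ} (hQ : 0 < Q)
    (hP : ∀ q ∈ P, q.Prime ∧ Q < q ∧ q ≤ 2 * Q) (hQN : 2 * Q ≤ N) (hU : 3 ≤ U)
    {K : ℝ} (hK : 1 ≤ K) {α β : ℕ → ℝ} (hα : ∀ m, |α m| ≤ 1) (hβ : ∀ n, |β n| ≤ Real.log n)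
    (D : Finset ℕ) (j : ℕ)
    (hD : ∀ d ∈ D, 0 < d ∧ U < d ∧ d * U ≤ N ∧ ⌊K * Real.log d⌋₊ = j) :
    ∑ q ∈ P, Real.log q * |∑ d ∈ D, α d *
        ∑ m ∈ Ioc 0 ⌊N / Real.exp ((j + 1) / K)⌋₊, β m * residueKernel q (d * m)| ≤
      Real.log N * (56 * Real.log N * (N / Q + 3 * N / √U + Q * √N)) := by
  have hL := Real.log_natCast_nonneg N
  have hQ0 : (0 : ℝ) < Q := by exact_mod_cast hQ
  have hK0 : 0 < K := by linarith
  rcases D.eq_empty_or_nonempty with rfl | ⟨d₀, hd₀⟩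
  · simp only [sum_empty, abs_zero, mul_zero, sum_const_zero]
    positivity
  set Me := Real.exp ((j + 1) / K) with hMe
  have hMe0 : 0 < Me := Real.exp_pos _
  set Xe := N / Me with hXe
  have hU0 : (3 : ℝ) ≤ U := by exact_mod_cast hU
  obtain ⟨hd1, hd2, hd3, hd4⟩ := hD d₀ hd₀
  have hN0 : (0 : ℝ) < N := by exact_mod_cast (by omega : 0 < N)
  have hb := floor_log_bounds hK0 hd1
  rw [hd4] at hb
  have hUd : (U : ℝ) ≤ d₀ := by exact_mod_cast hd2.le
  have hMU : (U : ℝ) ≤ Me := hUd.trans hb.2.le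
  have hM3 : Me ≤ 3 * d₀ := by
    have h1 : Me = Real.exp (j / K) * Real.exp (1 / K) := by
      rw [hMe, ← Real.exp_add]; congr 1; ring
    have h2 : Real.exp (1 / K) ≤ 3 := by
      refine (Real.exp_le_exp.mpr ((div_le_one hK0).mpr hK)).trans ?_
      linarith [Real.exp_one_lt_d9]
    rw [h1, mul_comm]
    exact mul_le_mul h2 hb.1 (Real.exp_pos _).le (by norm_num)
  have hXU : (U : ℝ) / 3 ≤ Xe := by
    rw [hXe, le_div_iff₀ hMe0]
    have h1 : (d₀ : ℝ) * U ≤ N := by exact_mod_cast hd3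
    have h2 : (U : ℝ) / 3 * Me ≤ U / 3 * (3 * d₀) := by gcongr
    linarith
  have hX1 : 1 ≤ Xe := by linarith
  have hM1 : 1 ≤ Me := by linarith
  have hXN : Xe ≤ N := div_le_self hN0.le hM1
  set α' : ℕ → ℝ := fun d => if d ∈ D then α d else 0 with hα'
  have hDr : D ⊆ Ioc 0 ⌊Me⌋₊ := by
    intro d hd
    have hd' := hD d hd
    rw [mem_Ioc]
    refine ⟨hd'.1, Nat.le_floor ?_⟩
    have := (floor_log_bounds hK0 hd'.1).2
    rw [hd'.2.2.2] at this
    exact this.le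
  have hDr' : D ⊆ range (⌊Me⌋₊ + 1) := fun d hd => by
    have := mem_Ioc.mp (hDr hd)
    rw [mem_range]; omega
  have hβ0 : β 0 = 0 := by
    have := hβ 0
    simp only [Nat.cast_zero, Real.log_zero] at this
    exact abs_nonpos_iff.mp this
  have hbil : ∀ q, ∑ d ∈ D, α d * ∑ m ∈ Ioc 0 ⌊Xe⌋₊, β m * residueKernel q (d * m) =
      ∑ d ∈ range (⌊Me⌋₊ + 1), ∑ m ∈ range (⌊Xe⌋₊ + 1), α' d * β m * residueKernel q (d * m) := by
    intro q
    have h1 : ∀ d, ∑ m ∈ range (⌊Xe⌋₊ + 1), α' d * β m * residueKernel q (d * m) =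
        if d ∈ D then α d * ∑ m ∈ Ioc 0 ⌊Xe⌋₊, β m * residueKernel q (d * m) else 0 := by
      intro d
      rw [range_eq_Ico, sum_eq_sum_Ico_succ_bot (by omega), hβ0]
      split_ifs with h
      · simp only [hα', if_pos h, mul_zero, zero_mul, zero_add, mul_sum]
        exact sum_congr rfl fun m _ => by ring
      · simp [hα', if_neg h]
    rw [sum_congr rfl fun d _ => h1 d, sum_ite_mem, inter_eq_right.mpr hDr']
  have hα2 : ∑ m ∈ range (⌊Me⌋₊ + 1), α' m ^ 2 ≤ Me := by
    have h1 : ∀ m, α' m ^ 2 ≤ if m ∈ D then 1 else 0 := by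
      intro m
      simp only [hα']
      split_ifs
      · exact (sq_le_one_iff_abs_le_one _).mpr (hα m)
      · simp
    refine (sum_le_sum fun m _ => h1 m).trans ?_
    rw [sum_ite_mem, inter_eq_right.mpr hDr', sum_const, nsmul_eq_mul, mul_one]
    calc (D.card : ℝ) ≤ ⌊Me⌋₊ := by exact_mod_cast (card_le_card hDr).trans_eq (by simp)
      _ ≤ Me := Nat.floor_le hMe0.le
  have hβ2 : ∑ n ∈ range (⌊Xe⌋₊ + 1), β n ^ 2 ≤ Xe * Real.log N ^ 2 := by
    rw [range_eq_Ico, sum_eq_sum_Ico_succ_bot (by omega), hβ0]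
    have h1 : ∀ n ∈ Ico (0 + 1) (⌊Xe⌋₊ + 1), β n ^ 2 ≤ Real.log N ^ 2 := by
      intro n hn
      rw [← sq_abs]
      refine pow_le_pow_left₀ (abs_nonneg _) ((hβ n).trans (monotone_log_natCast ?_)) 2
      have h2 : n ≤ ⌊Xe⌋₊ := by have := (mem_Ico.mp hn).2; omega
      have h3 : (n : ℝ) ≤ N := (Nat.le_floor_iff (by linarith)).mp h2 |>.trans hXN
      exact_mod_cast h3
    rw [zero_pow two_ne_zero, zero_add]
    refine (sum_le_sum h1).trans ?_
    rw [sum_const, nsmul_eq_mul]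
    refine mul_le_mul_of_nonneg_right ?_ (by positivity)
    simpa using Nat.floor_le (by linarith : 0 ≤ Xe)
  set a := √Me with ha
  set x := √Xe with hx
  have ha0 : 0 < a := Real.sqrt_pos.mpr hMe0
  have hx0 : 0 < x := Real.sqrt_pos.mpr (by linarith)
  have ha2 : a ^ 2 = Me := Real.sq_sqrt hMe0.le
  have hx2 : x ^ 2 = Xe := Real.sq_sqrt (by linarith)
  have hax2 : (a * x) ^ 2 = N := by
    rw [mul_pow, ha2, hx2, hXe, mul_div_cancel₀ _ hMe0.ne']
  have hax : a * x = √N := by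
    rw [← hax2, Real.sqrt_sq (by positivity)]
  have hsM : √(((⌊Me⌋₊ + 1 : ℕ) + 4 * (Q : ℝ) ^ 2) * ∑ m ∈ range (⌊Me⌋₊ + 1), α' m ^ 2) ≤
      2 * (a ^ 2 + Q * a) := by
    rw [Real.sqrt_le_left (by positivity)]
    have h1 : ((⌊Me⌋₊ + 1 : ℕ) : ℝ) ≤ 2 * a ^ 2 := by
      push_cast; rw [ha2]; linarith [Nat.floor_le hMe0.le]
    calc _ ≤ (2 * a ^ 2 + 4 * (Q : ℝ) ^ 2) * a ^ 2 := by
          refine mul_le_mul (by linarith) (by rw [ha2]; exact hα2)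
            (sum_nonneg fun _ _ => sq_nonneg _) (by positivity)
      _ ≤ _ := by nlinarith [mul_pos (pow_pos ha0 3) hQ0, pow_pos ha0 4]
  have hsX : √(((⌊Xe⌋₊ + 1 : ℕ) + 4 * (Q : ℝ) ^ 2) * ∑ m ∈ range (⌊Xe⌋₊ + 1), β m ^ 2) ≤
      2 * Real.log N * (x ^ 2 + Q * x) := by
    rw [Real.sqrt_le_left (by positivity)]
    have h1 : ((⌊Xe⌋₊ + 1 : ℕ) : ℝ) ≤ 2 * x ^ 2 := by
      push_cast; rw [hx2]; linarith [Nat.floor_le (by linarith : 0 ≤ Xe)]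
    calc _ ≤ (2 * x ^ 2 + 4 * (Q : ℝ) ^ 2) * (x ^ 2 * Real.log N ^ 2) := by
          refine mul_le_mul (by linarith) (by rw [hx2]; exact hβ2)
            (sum_nonneg fun _ _ => sq_nonneg _) (by positivity)
      _ = Real.log N ^ 2 * ((2 * x ^ 2 + 4 * (Q : ℝ) ^ 2) * x ^ 2) := by ring
      _ ≤ Real.log N ^ 2 * (2 * (x ^ 2 + Q * x)) ^ 2 := by
          refine mul_le_mul_of_nonneg_left ?_ (by positivity)
          nlinarith [mul_pos (pow_pos hx0 3) hQ0, pow_pos hx0 4]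
      _ = _ := by ring
  have hu : 0 < √(U : ℝ) := Real.sqrt_pos.mpr (by linarith)
  calc _ ≤ ∑ q ∈ P, Real.log N * |∑ d ∈ range (⌊Me⌋₊ + 1), ∑ m ∈ range (⌊Xe⌋₊ + 1),
          α' d * β m * residueKernel q (d * m)| := by
        refine sum_le_sum fun q hq => ?_
        rw [hbil]
        refine mul_le_mul_of_nonneg_right ?_ (abs_nonneg _)
        exact monotone_log_natCast ((hP q hq).2.2.trans hQN)
    _ = Real.log N * ∑ q ∈ P, |∑ d ∈ range (⌊Me⌋₊ + 1), ∑ m ∈ range (⌊Xe⌋₊ + 1),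
          α' d * β m * residueKernel q (d * m)| := by rw [mul_sum]
    _ ≤ _ := by
        refine mul_le_mul_of_nonneg_left ?_ hL
        refine (sum_abs_bilinear_le P hQ hP _ _ α' β).trans ?_
        have hux : √(U : ℝ) ≤ 2 * x := by
          rw [hx, show (2 : ℝ) = √4 by
            rw [show (4 : ℝ) = 2 ^ 2 by norm_num, Real.sqrt_sq (by norm_num)],
            ← Real.sqrt_mul (by norm_num)]
          exact Real.sqrt_le_sqrt (by linarith)
        have h := bilinear_block_arith hQ0 hL hu (Real.sqrt_le_sqrt hMU) hux
        rw [hax2, hax] at h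
        refine le_trans ?_ h
        gcongr

lemma floor_div_exp_le {K : ℝ} (hK : 0 < K) (N : ℕ) {d : ℕ} (hd : 0 < d) :
    ⌊N / Real.exp ((⌊K * Real.log d⌋₊ + 1) / K)⌋₊ ≤ N / d := by
  rw [← Nat.floor_div_eq_div (K := ℝ)]
  refine Nat.floor_le_floor ?_
  have hd0 : (0 : ℝ) < d := by exact_mod_cast hd
  exact div_le_div_of_nonneg_left (by positivity) hd0 (floor_log_bounds hK hd).2.le

lemma card_boundary_le {K : ℝ} (hK : 0 < K) (N : ℕ) {d : ℕ} (hd : 0 < d) :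
    ((Ioc ⌊N / Real.exp ((⌊K * Real.log d⌋₊ + 1) / K)⌋₊ (N / d)).card : ℝ) ≤
      1 + N / K * (1 / d) := by
  have hd0 : (0 : ℝ) < d := by exact_mod_cast hd
  rw [Nat.card_Ioc, Nat.cast_sub (floor_div_exp_le hK N hd)]
  have h1 : ((N / d : ℕ) : ℝ) ≤ N / d := Nat.cast_div_le
  set j : ℝ := ((⌊K * Real.log d⌋₊ : ℕ) : ℝ) with hj
  have h2 : (N : ℝ) / d * (1 - 1 / K) ≤ N / Real.exp ((j + 1) / K) := by
    have h3 : Real.exp ((j + 1) / K) ≤ d * Real.exp (1 / K) := by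
      rw [show (j + 1) / K = j / K + 1 / K by ring, Real.exp_add]
      gcongr
      exact (floor_log_bounds hK hd).1
    have h4 : 1 - 1 / K ≤ (Real.exp (1 / K))⁻¹ := by
      rw [← Real.exp_neg]
      linarith [Real.add_one_le_exp (-(1 / K))]
    calc (N : ℝ) / d * (1 - 1 / K) ≤ N / d * (Real.exp (1 / K))⁻¹ := by gcongr
      _ = N / (d * Real.exp (1 / K)) := by rw [div_mul_eq_div_div]; rfl
      _ ≤ _ := by gcongr
  have h5 := Nat.lt_floor_add_one (N / Real.exp ((j + 1) / K))
  have h6 : (N : ℝ) / d - N / d * (1 - 1 / K) = N / K * (1 / d) := by field_simp; ring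
  linarith

lemma sum_Ioc_one_div_le {N : ℕ} : ∑ d ∈ Ioc 0 N, (1 : ℝ) / d ≤ 1 + Real.log N := by
  have h := harmonic_le_one_add_log N
  rw [harmonic_eq_sum_Icc] at h
  push_cast at h
  refine le_trans (le_of_eq ?_) h
  refine sum_congr ?_ fun d _ => one_div _
  ext; simp [Nat.succ_le_iff]

lemma sum_boundary_le (P : Finset ℕ) {Q N U : ℕ} (hQ : 0 < Q)
    (hP : ∀ q ∈ P, q.Prime ∧ Q < q ∧ q ≤ 2 * Q) (hU : 0 < U)
    {K : ℝ} (hK : 0 < K) {α β : ℕ → ℝ} (hα : ∀ m, |α m| ≤ 1) (hβ : ∀ n, |β n| ≤ Real.log n)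
    (D : Finset ℕ) (hD : ∀ d ∈ D, 2 ≤ d ∧ d * U ≤ N) :
    ∑ q ∈ P, Real.log q * |∑ d ∈ D, α d *
        ∑ m ∈ Ioc ⌊N / Real.exp ((⌊K * Real.log d⌋₊ + 1) / K)⌋₊ (N / d),
          β m * residueKernel q (d * m)| ≤
      Real.log N * (Real.log N + 3) * (N / U + N / K * (1 + Real.log N)) := by
  have hL := Real.log_natCast_nonneg N
  have hU0 : (0 : ℝ) < U := by exact_mod_cast hU
  set X : ℕ → ℕ := fun d => ⌊N / Real.exp ((⌊K * Real.log d⌋₊ + 1) / K)⌋₊ with hX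
  have h1 : ∀ q ∈ P, Real.log q * |∑ d ∈ D, α d *
        ∑ m ∈ Ioc (X d) (N / d), β m * residueKernel q (d * m)| ≤
      ∑ d ∈ D, ∑ m ∈ Ioc (X d) (N / d),
        Real.log N * (Real.log q * |residueKernel q (d * m)|) := by
    intro q _
    have hq := Real.log_natCast_nonneg q
    refine (mul_le_mul_of_nonneg_left (abs_sum_le_sum_abs _ _) hq).trans ?_
    rw [mul_sum]
    refine sum_le_sum fun d hd => ?_
    have hd' : 0 < d := by have := (hD d hd).1; omega
    rw [abs_mul]
    calc _ ≤ Real.log q * (1 * ∑ m ∈ Ioc (X d) (N / d), |β m * residueKernel q (d * m)|) := by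
          gcongr
          · exact hα d
          · exact abs_sum_le_sum_abs _ _
      _ = ∑ m ∈ Ioc (X d) (N / d), |β m| * (Real.log q * |residueKernel q (d * m)|) := by
          rw [one_mul, mul_sum]
          exact sum_congr rfl fun m _ => by rw [abs_mul]; ring
      _ ≤ _ := by
          refine sum_le_sum fun m hm => ?_
          refine mul_le_mul_of_nonneg_right ?_ (by positivity)
          refine (hβ m).trans (monotone_log_natCast ?_)
          exact (mem_Ioc.mp hm).2.trans (Nat.div_le_self _ _)
  refine (sum_le_sum h1).trans ?_
  rw [sum_comm]
  calc _ ≤ ∑ d ∈ D, Real.log N * (Real.log N + 3) * (1 + N / K * (1 / d)) := by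
        refine sum_le_sum fun d hd => ?_
        have hd' : 0 < d := by have := (hD d hd).1; omega
        rw [sum_comm]
        have h2 : ∀ m ∈ Ioc (X d) (N / d),
            ∑ q ∈ P, Real.log N * (Real.log q * |residueKernel q (d * m)|) ≤
              Real.log N * (Real.log N + 3) := by
          intro m hm
          rw [← mul_sum]
          refine mul_le_mul_of_nonneg_left ?_ hL
          have hm' := mem_Ioc.mp hm
          have hdm : d * m ≤ N := by
            rw [mul_comm]; exact (Nat.le_div_iff_mul_le hd').mp hm'.2
          have h2dm : 2 ≤ d * m := (hD d hd).1.trans (Nat.le_mul_of_pos_right d (by omega))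
          refine (sum_log_mul_abs_residueKernel_le P hQ hP h2dm).trans ?_
          have := monotone_log_natCast hdm
          simp only at this
          linarith
        refine (sum_le_sum h2).trans ?_
        rw [sum_const, nsmul_eq_mul, mul_comm]
        exact mul_le_mul_of_nonneg_left (card_boundary_le hK N hd') (by positivity)
    _ = Real.log N * (Real.log N + 3) * (D.card + N / K * ∑ d ∈ D, (1 : ℝ) / d) := by
        rw [← mul_sum, sum_add_distrib, ← mul_sum]; simp
    _ ≤ _ := by
        gcongr
        · rw [le_div_iff₀ hU0]
          have h3 : D ⊆ Ioc 0 (N / U) := fun d hd => by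
            rw [mem_Ioc, Nat.le_div_iff_mul_le hU]
            have := hD d hd
            exact ⟨by omega, this.2⟩
          have h4 := card_le_card h3
          rw [Nat.card_Ioc, Nat.sub_zero] at h4
          exact_mod_cast (Nat.mul_le_mul_right U h4).trans (Nat.div_mul_le_self N U)
        · refine le_trans (sum_le_sum_of_subset_of_nonneg ?_ fun _ _ _ => by positivity)
            sum_Ioc_one_div_le
          intro d hd
          have := hD d hd
          rw [mem_Ioc]
          exact ⟨by omega, (Nat.le_mul_of_pos_right d hU).trans this.2⟩

lemma discrepancy_bilinear_le (P : Finset ℕ) {Q N U : ℕ} (hQ : 0 < Q)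
    (hP : ∀ q ∈ P, q.Prime ∧ Q < q ∧ q ≤ 2 * Q) (hQN : 2 * Q ≤ N) (hU : 3 ≤ U)
    {K : ℝ} (hK : 1 ≤ K) (f g : ArithmeticFunction ℝ) (hf : ∀ m, |f m| ≤ 1)
    (hg : ∀ n, |g n| ≤ Real.log n) (hfU : ∀ m ≤ U, f m = 0) (hgU : ∀ n ≤ U, g n = 0) :
    discrepancy P N (f * g) ≤
      (K * Real.log N + 1) * (Real.log N * (56 * Real.log N * (N / Q + 3 * N / √U + Q * √N))) +
        Real.log N * (Real.log N + 3) * (N / U + N / K * (1 + Real.log N)) := by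
  have hL := Real.log_natCast_nonneg N
  have hK0 : 0 < K := by linarith
  set D : Finset ℕ := (Ioc 0 N).filter fun d => U < d ∧ d * U ≤ N with hD
  have hDmem : ∀ d ∈ D, 0 < d ∧ d ≤ N ∧ U < d ∧ d * U ≤ N := by
    intro d hd
    simpa [hD, and_assoc] using hd
  set b : ℕ → ℕ := fun d => ⌊K * Real.log d⌋₊ with hb
  set X : ℕ → ℕ := fun j => ⌊N / Real.exp ((j + 1) / K)⌋₊ with hX
  set J : ℕ := ⌊K * Real.log N⌋₊ + 1 with hJ
  have hbJ : ∀ d ∈ D, b d ∈ range J := by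
    intro d hd
    rw [mem_range, hJ, Nat.lt_succ_iff]
    refine Nat.floor_le_floor (mul_le_mul_of_nonneg_left ?_ hK0.le)
    exact monotone_log_natCast (hDmem d hd).2.1
  have hsplit : ∀ q, ∑ n ∈ Ioc 0 N, (f * g) n * residueKernel q n =
      ∑ j ∈ range J, ∑ d ∈ D with b d = j, f d *
        ∑ m ∈ Ioc 0 (X j), g m * residueKernel q (d * m) +
      ∑ d ∈ D, f d * ∑ m ∈ Ioc (X (b d)) (N / d), g m * residueKernel q (d * m) := by
    intro q
    have h1 : ∑ n ∈ Ioc 0 N, (f * g) n * residueKernel q n =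
        ∑ d ∈ D, f d * ∑ m ∈ Ioc 0 (N / d), g m * residueKernel q (d * m) := by
      rw [sum_Ioc_mul_apply_mul, hD, sum_filter]
      refine sum_congr rfl fun d hd => ?_
      split_ifs with h
      · rfl
      · by_cases hdU : d ≤ U
        · rw [hfU d hdU, zero_mul]
        · have hd' := (mem_Ioc.mp hd).1
          have h2 : N / d ≤ U := by
            have : N < d * U := by
              by_contra h3
              exact h ⟨by omega, by omega⟩
            exact Nat.div_le_of_le_mul this.le
          rw [sum_eq_zero, mul_zero]
          intro m hm
          rw [hgU m ((mem_Ioc.mp hm).2.trans h2), zero_mul]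
    have h2 : ∑ j ∈ range J, ∑ d ∈ D with b d = j, f d *
        ∑ m ∈ Ioc 0 (X j), g m * residueKernel q (d * m) =
        ∑ d ∈ D, f d * ∑ m ∈ Ioc 0 (X (b d)), g m * residueKernel q (d * m) := by
      rw [← sum_fiberwise_of_maps_to hbJ]
      refine sum_congr rfl fun j _ => sum_congr rfl fun d hd => ?_
      rw [(mem_filter.mp hd).2]
    rw [h1, h2, ← sum_add_distrib]
    refine sum_congr rfl fun d hd => ?_
    rw [← mul_add]
    congr 1
    exact (sum_Ioc_consecutive (fun m => g m * residueKernel q (d * m)) (Nat.zero_le _)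
      (floor_div_exp_le hK0 N (hDmem d hd).1)).symm
  have hbound : discrepancy P N (f * g) ≤
      ∑ j ∈ range J, ∑ q ∈ P, Real.log q * |∑ d ∈ D with b d = j, f d *
        ∑ m ∈ Ioc 0 (X j), g m * residueKernel q (d * m)| +
      ∑ q ∈ P, Real.log q * |∑ d ∈ D, f d *
        ∑ m ∈ Ioc (X (b d)) (N / d), g m * residueKernel q (d * m)| := by
    rw [sum_comm, ← sum_add_distrib]
    refine sum_le_sum fun q _ => ?_
    rw [hsplit, ← mul_sum, ← mul_add]
    refine mul_le_mul_of_nonneg_left ?_ (Real.log_natCast_nonneg q)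
    exact (abs_add_le _ _).trans (add_le_add (abs_sum_le_sum_abs _ _) le_rfl)
  refine hbound.trans (add_le_add ?_ ?_)
  · calc _ ≤ ∑ j ∈ range J,
          Real.log N * (56 * Real.log N * (N / Q + 3 * N / √U + Q * √N)) := by
          refine sum_le_sum fun j _ => ?_
          refine sum_log_mul_abs_block_le P hQ hP hQN hU hK hf hg _ j fun d hd => ?_
          obtain ⟨h1, h2⟩ := mem_filter.mp hd
          have h3 := hDmem d h1
          exact ⟨h3.1, h3.2.2.1, h3.2.2.2, h2⟩
      _ ≤ _ := by
          rw [sum_const, card_range, nsmul_eq_mul]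
          refine mul_le_mul_of_nonneg_right ?_ (by positivity)
          rw [hJ]; push_cast
          linarith [Nat.floor_le (mul_nonneg hK0.le hL)]
  · refine sum_boundary_le P hQ hP (by omega) hK0 hf hg D fun d hd => ?_
    have := hDmem d hd
    exact ⟨by omega, this.2.2.2⟩

open ArithmeticFunction ArithmeticFunction.Moebius ArithmeticFunction.zeta in
lemma discrepancy_vonMangoldt_le (P : Finset ℕ) {Q N U : ℕ} (hQ : 0 < Q)
    (hP : ∀ q ∈ P, q.Prime ∧ Q < q ∧ q ≤ 2 * Q) (hQN : 2 * Q ≤ N) (hU : 3 ≤ U)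
    {K : ℝ} (hK : 1 ≤ K) :
    discrepancy P N Λ ≤
      U * Real.log N * (Real.log N + 3) + 6 * Q * U * Real.log N +
        3 * Q * (U : ℝ) ^ 2 * Real.log N +
      ((K * Real.log N + 1) * (Real.log N * (56 * Real.log N * (N / Q + 3 * N / √U + Q * √N))) +
        Real.log N * (Real.log N + 3) * (N / U + N / K * (1 + Real.log N))) := by
  rw [vaughan_identity U, sub_eq_add_neg]
  refine (discrepancy_add_le _ _ _ _).trans (add_le_add ?_ ?_)
  · refine (discrepancy_add_le _ _ _ _).trans (add_le_add ?_ ?_)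
    · refine (discrepancy_add_le _ _ _ _).trans (add_le_add ?_ ?_)
      · exact discrepancy_lowPart_vonMangoldt_le P hQ hP N U
      · exact discrepancy_lowPart_mul_log_le P hP N U
    · rw [discrepancy_neg]
      exact discrepancy_lowPart_mul_lowPart_mul_zeta_le P hP N U
  · refine discrepancy_bilinear_le P hQ hP hQN hU hK _ _ (abs_highPart_moebius_le U) ?_ ?_ ?_
    · intro n
      rw [abs_of_nonneg (zeta_mul_highPart_nonneg U n)]
      exact zeta_mul_highPart_le U n
    · intro m hm
      rw [highPart_apply, if_pos hm]
    · intro n hn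
      exact zeta_mul_highPart_eq_zero hn

lemma midrange_arith {w L Q U u : ℝ} (hL : 3 ≤ L) (hw : L ^ 20 ≤ w) (hQ1 : L ^ 10 / 2 ≤ Q)
    (hQ2 : Q ≤ w ^ 5 / L ^ 10) (hU1 : w ^ 2 ≤ U) (hU2 : U ≤ 2 * w ^ 2) (hu : w ≤ u) :
    U * L * (L + 3) + 6 * Q * U * L + 3 * Q * U ^ 2 * L +
      ((L ^ 5 * L + 1) * (L * (56 * L * (w ^ 10 / Q + 3 * w ^ 10 / u + Q * w ^ 5))) +
        L * (L + 3) * (w ^ 10 / U + w ^ 10 / L ^ 5 * (1 + L))) ≤ 1000 * (w ^ 10 / L) := by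
  have hL0 : 0 < L := by linarith
  have hL20 : (1 : ℝ) ≤ L ^ 19 := one_le_pow₀ (by linarith)
  have hLw : L ≤ w := by
    calc L = L * 1 := by ring
      _ ≤ L * L ^ 19 := by gcongr
      _ = L ^ 20 := by ring
      _ ≤ w := hw
  have hw0 : 0 < w := by linarith
  have hw1 : 1 ≤ w := by linarith
  have hQ0 : 0 < Q := lt_of_lt_of_le (by positivity) hQ1
  have hU0 : 0 < U := lt_of_lt_of_le (by positivity) hU1
  have hu0 : 0 < u := by linarith
  have hL3 : L + 3 ≤ 2 * L := by linarith
  have hL1 : 1 + L ≤ 2 * L := by linarith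
  have hone : ∀ n : ℕ, 1 ≤ L ^ n := fun n => one_le_pow₀ (by linarith)
  have t1 : U * L * (L + 3) ≤ 4 * (w ^ 10 / L) := by
    calc _ ≤ 2 * w ^ 2 * L * (2 * L) := by gcongr
      _ = 4 * (w ^ 2 * L ^ 3 / L) := by field_simp; ring
      _ ≤ 4 * (w ^ 2 * w ^ 3 / L) := by gcongr
      _ = 4 * (w ^ 5 / L) := by ring
      _ ≤ _ := by gcongr 4 * (?_ / L); exact pow_le_pow_right₀ hw1 (by norm_num)
  have t2 : 6 * Q * U * L ≤ 12 * (w ^ 10 / L) := by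
    calc _ ≤ 6 * (w ^ 5 / L ^ 10) * (2 * w ^ 2) * L := by gcongr
      _ = 12 * (w ^ 7 / (L * L ^ 8)) := by field_simp; ring
      _ ≤ 12 * (w ^ 10 / (L * 1)) := by
        gcongr
        · norm_num
        · exact hone 8
      _ = _ := by rw [mul_one]
  have t3 : 3 * Q * U ^ 2 * L ≤ 12 * (w ^ 10 / L) := by
    calc _ ≤ 3 * (w ^ 5 / L ^ 10) * (2 * w ^ 2) ^ 2 * L := by gcongr
      _ = 12 * (w ^ 9 / (L * L ^ 8)) := by field_simp; ring
      _ ≤ 12 * (w ^ 10 / (L * 1)) := by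
        gcongr
        · norm_num
        · exact hone 8
      _ = _ := by rw [mul_one]
  have t4 : (L ^ 5 * L + 1) * (L * (56 * L * (w ^ 10 / Q + 3 * w ^ 10 / u + Q * w ^ 5))) ≤
      672 * (w ^ 10 / L) := by
    have h1 : L ^ 5 * L + 1 ≤ 2 * L ^ 6 := by nlinarith [hone 6]
    have h2 : w ^ 10 / Q ≤ 2 * (w ^ 10 / L ^ 10) := by
      calc _ ≤ w ^ 10 / (L ^ 10 / 2) := by gcongr
        _ = _ := by field_simp
    have h3 : 3 * w ^ 10 / u ≤ 3 * (w ^ 10 / L ^ 10) := by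
      calc _ ≤ 3 * w ^ 10 / L ^ 10 := by
            gcongr
            exact (pow_le_pow_right₀ (by linarith) (by norm_num : 10 ≤ 20)).trans (hw.trans hu)
        _ = _ := by ring
    have h4 : Q * w ^ 5 ≤ w ^ 10 / L ^ 10 := by
      calc _ ≤ w ^ 5 / L ^ 10 * w ^ 5 := by gcongr
        _ = _ := by ring
    calc _ ≤ 2 * L ^ 6 * (L * (56 * L * (2 * (w ^ 10 / L ^ 10) + 3 * (w ^ 10 / L ^ 10) +
          w ^ 10 / L ^ 10))) := by gcongr
      _ = 672 * (w ^ 10 / (L * L)) := by field_simp; ring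
      _ ≤ 672 * (w ^ 10 / (L * 1)) := by gcongr; linarith
      _ = _ := by rw [mul_one]
  have t5 : L * (L + 3) * (w ^ 10 / U + w ^ 10 / L ^ 5 * (1 + L)) ≤ 6 * (w ^ 10 / L) := by
    have h1 : w ^ 10 / U ≤ w ^ 10 / L ^ 4 := by
      gcongr
      have : L ^ 4 ≤ L ^ 20 := pow_le_pow_right₀ (by linarith) (by norm_num)
      nlinarith
    calc _ ≤ L * (2 * L) * (w ^ 10 / L ^ 4 + w ^ 10 / L ^ 5 * (2 * L)) := by gcongr
      _ = 6 * (w ^ 10 / (L * L)) := by field_simp; ring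
      _ ≤ 6 * (w ^ 10 / (L * 1)) := by gcongr; linarith
      _ = _ := by rw [mul_one]
  have : 0 ≤ w ^ 10 / L := by positivity
  linarith

lemma tendsto_log_natCast : Tendsto (fun N : ℕ => Real.log N) atTop atTop :=
  Real.tendsto_log_atTop.comp tendsto_natCast_atTop_atTop

lemma eventually_log_pow_le_rpow (k : ℕ) {s : ℝ} (hs : 0 < s) :
    ∀ᶠ N : ℕ in atTop, Real.log N ^ k ≤ (N : ℝ) ^ s := by
  have h := (isLittleO_log_rpow_rpow_atTop (k : ℝ) hs).bound one_pos
  have h2 := tendsto_natCast_atTop_atTop (R := ℝ) |>.eventually h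
  filter_upwards [h2, eventually_ge_atTop 1] with N hN hN1
  rw [one_mul, Real.norm_eq_abs, Real.norm_eq_abs, Real.rpow_natCast] at hN
  exact (le_abs_self _).trans (hN.trans_eq (abs_of_nonneg (by positivity)))

lemma discrepancy_dyadic_le : ∀ᶠ N : ℕ in atTop, ∀ (Q : ℕ) (P : Finset ℕ),
    (∀ q ∈ P, q.Prime ∧ Q < q ∧ q ≤ 2 * Q) → Real.log N ^ 10 / 2 ≤ Q →
      (Q : ℝ) ≤ √N / Real.log N ^ 10 →
        discrepancy P N ArithmeticFunction.vonMangoldt ≤ 1000 * (N / Real.log N) := by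
  filter_upwards [tendsto_log_natCast.eventually_ge_atTop 3,
    eventually_log_pow_le_rpow 20 (by norm_num : (0 : ℝ) < 1 / 10), eventually_ge_atTop 4]
    with N hL hw hN4 Q P hP hQ1 hQ2
  set L := Real.log N with hLdef
  set w : ℝ := (N : ℝ) ^ (1 / 10 : ℝ) with hwdef
  have hN0 : (0 : ℝ) < N := by exact_mod_cast (by omega : 0 < N)
  have hw10 : w ^ 10 = N := by
    rw [hwdef, ← Real.rpow_natCast, ← Real.rpow_mul hN0.le]; norm_num
  have hw0 : 0 < w := Real.rpow_pos_of_pos hN0 _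
  have hw5 : √(N : ℝ) = w ^ 5 := by
    rw [← hw10, show w ^ 10 = (w ^ 5) ^ 2 by ring, Real.sqrt_sq (by positivity)]
  have hL10 : (3 : ℝ) ^ 10 ≤ L ^ 10 := pow_le_pow_left₀ (by norm_num) hL 10
  have hL20 : (3 : ℝ) ^ 20 ≤ L ^ 20 := pow_le_pow_left₀ (by norm_num) hL 20
  have hQ0 : 0 < Q := by
    have : (0 : ℝ) < Q := lt_of_lt_of_le (by positivity) hQ1
    exact_mod_cast this
  have hw1 : 3 ≤ w := by norm_num at hL20; linarith
  set U := ⌈w ^ 2⌉₊ with hU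
  have hU1 : w ^ 2 ≤ U := Nat.le_ceil _
  have hU2 : (U : ℝ) ≤ 2 * w ^ 2 := by
    have := Nat.ceil_lt_add_one (by positivity : 0 ≤ w ^ 2)
    nlinarith
  have hU3 : 3 ≤ U := by
    have : (3 : ℝ) ≤ U := by nlinarith
    exact_mod_cast this
  have hQN : 2 * Q ≤ N := by
    have h1 : (Q : ℝ) ≤ w ^ 5 := by
      rw [← hw5]
      refine hQ2.trans (div_le_self (Real.sqrt_nonneg _) ?_)
      norm_num at hL10; linarith
    have h2 : (2 * Q : ℝ) ≤ N := by
      rw [← hw10]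
      have : (3 : ℝ) ^ 5 ≤ w ^ 5 := pow_le_pow_left₀ (by norm_num) hw1 5
      nlinarith
    exact_mod_cast h2
  have h := discrepancy_vonMangoldt_le P hQ0 hP hQN hU3 (K := L ^ 5) (one_le_pow₀ (by linarith))
  have hu : w ≤ √(U : ℝ) := Real.le_sqrt_of_sq_le hU1
  rw [hw5] at hQ2
  have h2 := midrange_arith hL hw hQ1 hQ2 hU1 hU2 hu
  rw [hw10] at h2
  rw [← hLdef, hw5] at h
  exact h.trans h2

/-- The primes between a power of the logarithm and nearly the square root have small total
discrepancy for the von Mangoldt function. -/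
lemma discrepancy_midrange_le : ∀ᶠ N : ℕ in atTop, ∀ P : Finset ℕ,
    (∀ q ∈ P, q.Prime ∧ Real.log N ^ 10 < q ∧ (q : ℝ) ≤ √N / Real.log N ^ 10) →
      discrepancy P N ArithmeticFunction.vonMangoldt ≤ 3000 * N := by
  filter_upwards [discrepancy_dyadic_le, tendsto_log_natCast.eventually_ge_atTop 3,
    eventually_ge_atTop 4] with N hdy hL hN4 P hP
  set L := Real.log N with hLdef
  have hN0 : (0 : ℝ) < N := by exact_mod_cast (by omega : 0 < N)
  have hL10 : (3 : ℝ) ^ 10 ≤ L ^ 10 := pow_le_pow_left₀ (by norm_num) hL 10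
  norm_num at hL10
  set y := ⌊L ^ 10⌋₊ with hy
  have hy1 : L ^ 10 / 2 ≤ y := by
    have := Nat.lt_floor_add_one (L ^ 10)
    rw [← hy] at this
    linarith
  have hy0 : 0 < y := by
    have : (0 : ℝ) < y := by linarith
    exact_mod_cast this
  set i : ℕ → ℕ := fun q => Nat.log 2 ((q - 1) / y) with hi
  have hyq : ∀ q ∈ P, y < q := by
    intro q hq
    have := (hP q hq).2.1
    have h2 : (y : ℝ) < q := (Nat.floor_le (by positivity)).trans_lt this
    exact_mod_cast h2
  have hiq : ∀ q ∈ P, y * 2 ^ i q < q ∧ q ≤ 2 * (y * 2 ^ i q) := by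
    intro q hq
    have h1 := hyq q hq
    have h2 : (q - 1) / y ≠ 0 := by
      have := Nat.div_pos (by omega : y ≤ q - 1) hy0
      omega
    have h3 : 2 ^ i q ≤ (q - 1) / y := Nat.pow_log_le_self 2 h2
    have h4 : (q - 1) / y < 2 ^ (i q + 1) := Nat.lt_pow_succ_log_self (by norm_num) _
    rw [Nat.le_div_iff_mul_le hy0] at h3
    rw [Nat.div_lt_iff_lt_mul hy0, pow_succ] at h4
    constructor
    · rw [mul_comm]; omega
    · have : 2 ^ i q * 2 * y = 2 * (y * 2 ^ i q) := by ring
      omega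
  set J := ⌊2 * L⌋₊ + 1 with hJ
  have hiJ : ∀ q ∈ P, i q ∈ range J := by
    intro q hq
    rw [mem_range, hJ, Nat.lt_succ_iff]
    refine Nat.le_floor ?_
    have h1 := (hiq q hq).1
    have h2 : (2 : ℝ) ^ i q ≤ N := by
      have h3 : 2 ^ i q ≤ q := by nlinarith [Nat.two_pow_pos (i q)]
      have h4 : (q : ℝ) ≤ N := by
        refine (hP q hq).2.2.trans ((div_le_self (Real.sqrt_nonneg _) (by linarith)).trans ?_)
        rw [Real.sqrt_le_left hN0.le]
        have : (1 : ℝ) ≤ N := by exact_mod_cast (by omega : 1 ≤ N)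
        nlinarith
      have h5 : ((2 ^ i q : ℕ) : ℝ) ≤ q := by exact_mod_cast h3
      push_cast at h5
      linarith
    have h3 := Real.log_le_log (by positivity) h2
    rw [Real.log_pow] at h3
    have := Real.log_two_gt_d9
    have h0 : (0 : ℝ) ≤ i q := by positivity
    nlinarith
  have hsum : discrepancy P N ArithmeticFunction.vonMangoldt =
      ∑ j ∈ range J, discrepancy (P.filter fun q => i q = j) N
        ArithmeticFunction.vonMangoldt := by
    simp only [discrepancy]
    rw [sum_fiberwise_of_maps_to hiJ]
  rw [hsum]
  calc _ ≤ ∑ j ∈ range J, 1000 * (N / L) := by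
        refine sum_le_sum fun j _ => ?_
        rcases (P.filter fun q => i q = j).eq_empty_or_nonempty with h | ⟨q₀, hq₀⟩
        · rw [h]
          simp only [discrepancy, sum_empty]
          positivity
        · have hmem : ∀ q ∈ P.filter (fun q => i q = j), q.Prime ∧ y * 2 ^ j < q ∧
              q ≤ 2 * (y * 2 ^ j) := by
            intro q hq
            obtain ⟨h1, h2⟩ := mem_filter.mp hq
            have h3 := hiq q h1
            rw [h2] at h3
            exact ⟨(hP q h1).1, h3⟩
          refine hdy (y * 2 ^ j) _ hmem ?_ ?_
          · refine hy1.trans ?_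
            exact_mod_cast Nat.le_mul_of_pos_right y (by positivity)
          · refine le_trans ?_ (hP q₀ (mem_filter.mp hq₀).1).2.2
            exact_mod_cast (hmem q₀ hq₀).2.1.le
    _ = J * (1000 * (N / L)) := by rw [sum_const, card_range, nsmul_eq_mul]
    _ ≤ 3 * L * (1000 * (N / L)) := by
        refine mul_le_mul_of_nonneg_right ?_ (by positivity)
        rw [hJ]; push_cast
        linarith [Nat.floor_le (by linarith : 0 ≤ 2 * L)]
    _ = 3000 * N := by field_simp; norm_num

lemma sum_Ioc_log (N : ℕ) : ∑ n ∈ Ioc 0 N, Real.log n = Real.log N.factorial := by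
  induction N with
  | zero => simp
  | succ N ih =>
    rw [Finset.sum_Ioc_succ_top (Nat.zero_le N), ih, Nat.factorial_succ, Nat.cast_mul,
      Real.log_mul (by positivity) (by positivity), add_comm]

lemma mul_log_sub_le_log_factorial (N : ℕ) : N * Real.log N - N ≤ Real.log N.factorial := by
  rcases eq_or_ne N 0 with rfl | hN
  · simp
  · have h := Stirling.le_log_factorial_stirling hN
    have h1 : 0 ≤ Real.log N := Real.log_natCast_nonneg N
    have h2 : 0 ≤ Real.log (2 * Real.pi) := Real.log_nonneg (by linarith [Real.pi_gt_three])
    linarith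

lemma sum_vonMangoldt_mul_div (N : ℕ) :
    ∑ n ∈ Ioc 0 N, ArithmeticFunction.vonMangoldt n * ((N / n : ℕ) : ℝ) =
      Real.log N.factorial := by
  rw [← ArithmeticFunction.sum_Ioc_mul_zeta_eq_sum, ArithmeticFunction.vonMangoldt_mul_zeta,
    ← sum_Ioc_log]
  rfl

lemma psi_natCast_le (N : ℕ) : Chebyshev.psi N ≤ 5.4 * N := by
  have := Chebyshev.psi_le_const_mul_self (Nat.cast_nonneg (α := ℝ) N)
  have h4 := log_four_le
  have : (0 : ℝ) ≤ N := by positivity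
  nlinarith

lemma psi_natCast_eq (N : ℕ) :
    Chebyshev.psi N = ∑ n ∈ Ioc 0 N, ArithmeticFunction.vonMangoldt n := by
  rw [Chebyshev.psi, Nat.floor_natCast]

lemma log_sub_one_le_sum_vonMangoldt_div {N : ℕ} (hN : N ≠ 0) :
    Real.log N - 1 ≤ ∑ n ∈ Ioc 0 N, ArithmeticFunction.vonMangoldt n / n := by
  have hN0 : (0 : ℝ) < N := by positivity
  refine le_of_mul_le_mul_left ?_ hN0
  calc N * (Real.log N - 1) = N * Real.log N - N := by ring
    _ ≤ _ := mul_log_sub_le_log_factorial N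
    _ = _ := (sum_vonMangoldt_mul_div N).symm
    _ ≤ _ := by
        rw [mul_sum]
        refine sum_le_sum fun n _ => ?_
        calc _ ≤ ArithmeticFunction.vonMangoldt n * ((N : ℝ) / n) :=
              mul_le_mul_of_nonneg_left Nat.cast_div_le ArithmeticFunction.vonMangoldt_nonneg
          _ = _ := by ring

lemma sum_vonMangoldt_div_le {N : ℕ} (hN : N ≠ 0) :
    ∑ n ∈ Ioc 0 N, ArithmeticFunction.vonMangoldt n / n ≤ Real.log N + 5.4 := by
  have hN0 : (0 : ℝ) < N := by positivity
  refine le_of_mul_le_mul_left ?_ hN0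
  calc _ = ∑ n ∈ Ioc 0 N, ArithmeticFunction.vonMangoldt n * ((N : ℝ) / n) := by
        rw [mul_sum]
        exact sum_congr rfl fun n _ => by ring
    _ ≤ ∑ n ∈ Ioc 0 N, (ArithmeticFunction.vonMangoldt n * ((N / n : ℕ) : ℝ) +
          ArithmeticFunction.vonMangoldt n) := by
        refine sum_le_sum fun n hn => ?_
        have h1 : (N : ℝ) / n ≤ ((N / n : ℕ) : ℝ) + 1 := by
          rw [← Nat.floor_div_eq_div (K := ℝ)]
          exact (Nat.lt_floor_add_one _).le
        have := ArithmeticFunction.vonMangoldt_nonneg (n := n)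
        nlinarith
    _ = Real.log N.factorial + Chebyshev.psi N := by
        rw [sum_add_distrib, sum_vonMangoldt_mul_div, psi_natCast_eq]
    _ ≤ N * Real.log N + 5.4 * N := by
        refine add_le_add ?_ (psi_natCast_le N)
        rw [← Real.log_pow]
        exact Real.log_le_log (by positivity) (by exact_mod_cast Nat.factorial_le_pow N)
    _ = _ := by ring

/-- The mass of `Λ(n)/n` on non-primes `n > Y` is small. -/
lemma summable_vonMangoldt_div_not_prime :
    Summable fun n : ℕ => (if n.Prime then 0 else ArithmeticFunction.vonMangoldt n) / (n : ℝ) := by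
  convert ArithmeticFunction.vonMangoldt.summable_residueClass_non_primes_div (1 : ZMod 1) using 4
  rw [ArithmeticFunction.vonMangoldt.residueClass, Set.indicator_of_mem]
  exact Subsingleton.elim _ _

lemma exists_sum_vonMangoldt_div_not_prime_le :
    ∃ T : ℝ, 0 < T ∧ ∀ A : Finset ℕ, (∀ n ∈ A, ¬ n.Prime) →
      ∑ n ∈ A, ArithmeticFunction.vonMangoldt n / (n : ℝ) ≤ T := by
  refine ⟨(∑' n : ℕ, (if n.Prime then 0 else ArithmeticFunction.vonMangoldt n) / (n : ℝ)) + 1,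
    ?_, fun A hA => ?_⟩
  · have : 0 ≤ ∑' n : ℕ, (if n.Prime then 0 else ArithmeticFunction.vonMangoldt n) / (n : ℝ) := by
      refine tsum_nonneg fun n => div_nonneg ?_ (Nat.cast_nonneg _)
      split_ifs
      · exact le_rfl
      · exact ArithmeticFunction.vonMangoldt_nonneg
    linarith
  · have h := summable_vonMangoldt_div_not_prime.sum_le_tsum A fun n _ => by
      refine div_nonneg ?_ (Nat.cast_nonneg _)
      split_ifs
      · exact le_rfl
      · exact ArithmeticFunction.vonMangoldt_nonneg
    rw [sum_congr rfl fun n hn => by rw [if_neg (hA n hn)]] at h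
    linarith

lemma exists_sum_vonMangoldt_div_not_prime_lt {ε : ℝ} (hε : 0 < ε) :
    ∃ Y : ℕ, ∀ A : Finset ℕ, (∀ n ∈ A, ¬ n.Prime ∧ Y < n) →
      ∑ n ∈ A, ArithmeticFunction.vonMangoldt n / (n : ℝ) ≤ ε := by
  obtain ⟨s, hs⟩ := summable_vonMangoldt_div_not_prime.vanishing (Metric.ball_mem_nhds 0 hε)
  refine ⟨s.sup id, fun A hA => ?_⟩
  have h := hs A (Finset.disjoint_left.mpr fun n hn hns => by
    have := Finset.le_sup (f := id) hns
    have := (hA n hn).2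
    simp only [id] at *
    omega)
  rw [mem_ball_zero_iff, sum_congr rfl fun n hn => by rw [if_neg (hA n hn).1]] at h
  exact (le_abs_self _).trans h.le

lemma sum_log_div_eq_sum_vonMangoldt (P : Finset ℕ) (hP : ∀ q ∈ P, q.Prime) :
    ∑ q ∈ P, Real.log q / q = ∑ q ∈ P, ArithmeticFunction.vonMangoldt q / q :=
  sum_congr rfl fun q hq => by rw [ArithmeticFunction.vonMangoldt_apply_prime (hP q hq)]

lemma sum_log_div_le (P : Finset ℕ) {N : ℕ} (hN : N ≠ 0) (hP : ∀ q ∈ P, q.Prime ∧ q ≤ N) :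
    ∑ q ∈ P, Real.log q / q ≤ Real.log N + 5.4 := by
  rw [sum_log_div_eq_sum_vonMangoldt P fun q hq => (hP q hq).1]
  refine le_trans (sum_le_sum_of_subset_of_nonneg (fun q hq => ?_) fun n _ _ => ?_)
    (sum_vonMangoldt_div_le hN)
  · exact mem_Ioc.mpr ⟨(hP q hq).1.pos, (hP q hq).2⟩
  · exact div_nonneg ArithmeticFunction.vonMangoldt_nonneg (Nat.cast_nonneg _)

lemma sum_log_div_le_of_lt (P : Finset ℕ) {M N : ℕ} (hM : M ≠ 0) (hMN : M ≤ N)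
    (hP : ∀ q ∈ P, q.Prime ∧ M < q ∧ q ≤ N) :
    ∑ q ∈ P, Real.log q / q ≤ Real.log N - Real.log M + 6.4 := by
  rw [sum_log_div_eq_sum_vonMangoldt P fun q hq => (hP q hq).1]
  have h1 : ∑ q ∈ P, ArithmeticFunction.vonMangoldt q / (q : ℝ) ≤
      ∑ n ∈ Ioc M N, ArithmeticFunction.vonMangoldt n / (n : ℝ) := by
    refine sum_le_sum_of_subset_of_nonneg (fun q hq => ?_) fun n _ _ => ?_
    · exact mem_Ioc.mpr (hP q hq).2
    · exact div_nonneg ArithmeticFunction.vonMangoldt_nonneg (Nat.cast_nonneg _)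
  have h2 := sum_Ioc_consecutive (fun n => ArithmeticFunction.vonMangoldt n / (n : ℝ))
    (Nat.zero_le M) hMN
  have h3 := log_sub_one_le_sum_vonMangoldt_div hM
  have h4 := sum_vonMangoldt_div_le (show N ≠ 0 by omega)
  linarith

/-- `∑ 1/ℓ` over primes `y < ℓ ≤ y⁴` is at least `1/2` for large `y`. -/
lemma eventually_half_le_sum_one_div_prime :
    ∀ᶠ y : ℕ in atTop, (1 : ℝ) / 2 ≤ ∑ l ∈ Ioc y (y ^ 4) with l.Prime, 1 / (l : ℝ) := by
  obtain ⟨T, hT0, hT⟩ := exists_sum_vonMangoldt_div_not_prime_le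
  filter_upwards [tendsto_log_natCast.eventually_ge_atTop (T + 6.4), eventually_ge_atTop 2]
    with y hy hy2
  have hlog : 0 < Real.log y := by linarith
  have h2 := sum_Ioc_consecutive (fun n => ArithmeticFunction.vonMangoldt n / (n : ℝ))
    (Nat.zero_le y) (Nat.le_self_pow (by norm_num : 4 ≠ 0) y)
  have h3 := log_sub_one_le_sum_vonMangoldt_div (N := y ^ 4) (by positivity)
  have h4 := sum_vonMangoldt_div_le (show y ≠ 0 by omega)
  push_cast at h3
  rw [Real.log_pow] at h3
  push_cast at h3
  have h5 := sum_filter_add_sum_filter_not (Ioc y (y ^ 4)) Nat.Prime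
    (fun n => ArithmeticFunction.vonMangoldt n / (n : ℝ))
  have h6 := hT ((Ioc y (y ^ 4)).filter fun n => ¬ n.Prime) fun n hn => (mem_filter.mp hn).2
  have h7 : ∑ l ∈ Ioc y (y ^ 4) with l.Prime, ArithmeticFunction.vonMangoldt l / (l : ℝ) ≤
      4 * Real.log y * ∑ l ∈ Ioc y (y ^ 4) with l.Prime, 1 / (l : ℝ) := by
    rw [mul_sum]
    refine sum_le_sum fun l hl => ?_
    obtain ⟨h8, h9⟩ := mem_filter.mp hl
    have h8 := mem_Ioc.mp h8
    have h10 : Real.log l ≤ 4 * Real.log y := by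
      have := Real.log_le_log (by exact_mod_cast h9.pos) (by exact_mod_cast h8.2 : (l : ℝ) ≤ y ^ 4)
      rwa [Real.log_pow] at this
    rw [ArithmeticFunction.vonMangoldt_apply_prime h9, mul_one_div]
    gcongr
  have h11 : 2 * Real.log y ≤ 4 * Real.log y *
      ∑ l ∈ Ioc y (y ^ 4) with l.Prime, 1 / (l : ℝ) := by linarith
  nlinarith

lemma eventually_mul_le_sum_one_div_prime (K : ℕ) :
    ∀ᶠ y : ℕ in atTop,
      (K : ℝ) / 2 ≤ ∑ l ∈ Ioc y (y ^ 4 ^ K) with l.Prime, 1 / (l : ℝ) := by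
  induction K with
  | zero => simp
  | succ K ih =>
    have ht : Tendsto (fun y : ℕ => y ^ 4 ^ K) atTop atTop :=
      tendsto_pow_atTop (by positivity)
    filter_upwards [ih, ht.eventually eventually_half_le_sum_one_div_prime,
      eventually_ge_atTop 1] with y h1 h2 hy
    have h3 := sum_Ioc_consecutive (fun l : ℕ => if l.Prime then 1 / (l : ℝ) else 0)
      (Nat.le_self_pow (by positivity : 4 ^ K ≠ 0) y)
      (Nat.le_self_pow (by norm_num : 4 ≠ 0) (y ^ 4 ^ K))
    rw [sum_filter] at h1 h2 ⊢
    rw [pow_succ, pow_mul, ← h3]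
    push_cast
    linarith

/-- Mertens' upper bound for the density of integers coprime to all primes up to `z`. -/
lemma totient_primorial_mul_log_le (z : ℕ) :
    ((primorial z).totient : ℝ) * Real.log (z + 1) ≤ primorial z := by
  have hne : primorial z ≠ 0 := (primorial_pos z).ne'
  have hpf : (primorial z).primeFactors = (z + 1).primesBelow := by
    rw [primorial, Nat.primeFactors_prod]
    · ext p; simp [Nat.primesBelow]
    · intro p hp; exact (mem_filter.mp hp).2
  have h1 : ((primorial z).totient : ℝ) =
      primorial z * ∏ p ∈ (z + 1).primesBelow, (1 - (p : ℝ)⁻¹) := by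
    rw [← hpf]
    have h := congrArg (Rat.cast : ℚ → ℝ) (Nat.totient_eq_mul_prod_factors (primorial z))
    push_cast at h
    exact h
  let f : ℕ →* ℝ :=
    { toFun := fun n => (n : ℝ)⁻¹
      map_one' := by simp
      map_mul' := fun a b => by push_cast; rw [mul_inv] }
  have h2 := EulerProduct.summable_and_hasSum_smoothNumbers_prod_primesBelow_geometric (f := f)
    (fun {p} hp => by
      change ‖(p : ℝ)⁻¹‖ < 1
      rw [Real.norm_of_nonneg (by positivity)]
      exact inv_lt_one_of_one_lt₀ (by exact_mod_cast hp.one_lt)) (z + 1)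
  have h3 : Real.log (z + 1) ≤ ∏ p ∈ (z + 1).primesBelow, (1 - (p : ℝ)⁻¹)⁻¹ := by
    have h4 := log_add_one_le_harmonic z
    push_cast at h4
    refine h4.trans ?_
    have hsub : ∀ n ∈ range z, n + 1 ∈ (z + 1).smoothNumbers := fun n hn =>
      Nat.mem_smoothNumbers_of_lt (by omega) (by have := mem_range.mp hn; omega)
    have h5 := h2.2
    change HasSum (fun m : (z + 1).smoothNumbers => ((m : ℕ) : ℝ)⁻¹)
      (∏ p ∈ (z + 1).primesBelow, (1 - (p : ℝ)⁻¹)⁻¹) at h5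
    have h6 := sum_le_hasSum ((range z).attach.image
      fun n : range z => (⟨n.1 + 1, hsub n.1 n.2⟩ : (z + 1).smoothNumbers))
      (fun m _ => by positivity) h5
    rw [sum_image (by
      intro a _ b _ hab
      have := congrArg Subtype.val hab
      exact Subtype.ext (Nat.succ_injective this))] at h6
    refine le_trans (le_of_eq ?_) h6
    rw [sum_attach (range z) (fun n => (((n + 1 : ℕ) : ℝ))⁻¹), harmonic]
    push_cast
    rfl
  have hpos : 0 < ∏ p ∈ (z + 1).primesBelow, (1 - (p : ℝ)⁻¹) := by
    refine prod_pos fun p hp => ?_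
    rw [sub_pos]
    exact inv_lt_one_of_one_lt₀ (by exact_mod_cast (Nat.prime_of_mem_primesBelow hp).one_lt)
  rw [prod_inv_distrib] at h3
  rw [h1, mul_assoc]
  refine mul_le_of_le_one_right (by positivity) ?_
  calc _ ≤ _ := mul_le_mul_of_nonneg_left h3 hpos.le
    _ = 1 := mul_inv_cancel₀ hpos.ne'

lemma exists_lt_dvd_add_mul {l D : ℕ} (hl : l.Prime) (hD : l.Coprime D) (a : ℕ) :
    ∃ b < l, ∀ t, t % l = b → l ∣ a + D * t := by
  have := Fact.mk hl
  have hD0 : (D : ZMod l) ≠ 0 := by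
    rw [Ne, ZMod.natCast_eq_zero_iff]
    exact fun h => hl.one_lt.ne' (Nat.dvd_one.mp (hD ▸ Nat.dvd_gcd dvd_rfl h))
  refine ⟨(-(a : ZMod l) / D).val, ZMod.val_lt _, fun t ht => ?_⟩
  rw [← ZMod.natCast_eq_zero_iff]
  have h : (t : ZMod l) = -(a : ZMod l) / D := by
    rw [← ZMod.natCast_mod t l, ht, ZMod.natCast_zmod_val]
  push_cast
  rw [h]
  field_simp
  ring

/-- A sieve bound for integers in a residue class modulo `D` without prime factors in `P`. -/
lemma card_mul_sum_inv_progression_le (P : Finset ℕ) {Q : ℕ} (hQ : 0 < Q)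
    (hP : ∀ p ∈ P, p.Prime ∧ p ≤ Q) (R : Finset ℕ) {D a N : ℕ}
    (hR : ∀ r ∈ R, r ≤ N ∧ r % D = a ∧ ∀ l ∈ P, ¬ l ∣ r) (hcop : ∀ l ∈ P, l.Coprime D) :
    (R.card : ℝ) * ∑ p ∈ P, 1 / (p : ℝ) ≤ 7 * ((N : ℝ) / D + 1 + (Q : ℝ) ^ 2) := by
  have hinj : Set.InjOn (fun r => r / D) R := fun r hr s hs hrs => by
    rw [← Nat.mod_add_div r D, ← Nat.mod_add_div s D, (hR r hr).2.1, (hR s hs).2.1]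
    simp only at hrs
    rw [hrs]
  choose! b hb using fun l (hl : l ∈ P) => exists_lt_dvd_add_mul (hP l hl).1 (hcop l hl) a
  have h := card_mul_sum_inv_le P Q hQ hP (N / D + 1) (R.image fun r => r / D)
    (fun t ht => by
      obtain ⟨r, hr, rfl⟩ := mem_image.mp ht
      exact mem_range.mpr (Nat.lt_succ_of_le (Nat.div_le_div_right (hR r hr).1)))
    b (fun l hl => ⟨(hb l hl).1, fun t ht htb => by
      obtain ⟨r, hr, rfl⟩ := mem_image.mp ht
      refine (hR r hr).2.2 l hl ?_
      have h1 := (hb l hl).2 _ htb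
      rwa [← (hR r hr).2.1, Nat.mod_add_div] at h1⟩)
  rw [card_image_of_injOn hinj] at h
  refine h.trans ?_
  have : ((N / D : ℕ) : ℝ) ≤ (N : ℝ) / D := Nat.cast_div_le
  push_cast
  linarith

lemma coprime_primorial_of_lt {z r : ℕ} (hr : r.Prime) (hz : z < r) :
    r.Coprime (primorial z) := by
  rw [hr.coprime_iff_not_dvd, primorial, hr.prime.dvd_finsetProd_iff]
  rintro ⟨p, hp, hrp⟩
  obtain ⟨h1, h2⟩ := mem_filter.mp hp
  rw [(Nat.prime_dvd_prime_iff_eq hr h2).mp hrp] at hz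
  have := mem_range.mp h1
  omega

/-- A Brun–Titchmarsh type bound for primes `r ≡ 1 (mod q)`. -/
lemma card_prime_mod_eq_one_mul_le {z w q : ℕ} (N : ℕ) (hq : q.Prime) (hw : 0 < w) (hwq : w < q)
    (hzq : z < q) :
    (((Ioc 0 N).filter fun r => r.Prime ∧ r % q = 1).card : ℝ) *
        ∑ l ∈ Ioc z w with l.Prime, 1 / (l : ℝ) ≤
      (primorial z).totient *
        (7 * ((N : ℝ) / (q * primorial z : ℕ) + 1 + (w : ℝ) ^ 2)) := by
  set P := primorial z with hPdef
  set R := (Ioc 0 N).filter fun r => r.Prime ∧ r % q = 1 with hR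
  have hP0 : 0 < P := primorial_pos z
  have hRq : ∀ r ∈ R, r ≤ N ∧ r.Prime ∧ r % q = 1 ∧ q < r := by
    intro r hr
    obtain ⟨h1, h2, h3⟩ := mem_filter.mp hr
    refine ⟨(mem_Ioc.mp h1).2, h2, h3, ?_⟩
    by_contra hlt
    rcases (not_lt.mp hlt).lt_or_eq with h | h
    · rw [Nat.mod_eq_of_lt h] at h3
      exact h2.one_lt.ne' h3
    · rw [h, Nat.mod_self] at h3
      omega
  have hmaps : ∀ r ∈ R, r % P ∈ (range P).filter P.Coprime := by
    intro r hr
    rw [mem_filter, mem_range]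
    refine ⟨Nat.mod_lt _ hP0, ?_⟩
    have := (coprime_primorial_of_lt (hRq r hr).2.1 (hzq.trans (hRq r hr).2.2.2)).symm
    rw [Nat.Coprime, Nat.gcd_comm, ← Nat.gcd_rec]
    exact this
  rw [card_eq_sum_card_fiberwise hmaps, Nat.cast_sum, sum_mul, Nat.totient_eq_card_coprime,
    ← nsmul_eq_mul]
  refine sum_le_card_nsmul _ _ _ fun u _ => ?_
  rcases (R.filter fun r => r % P = u).eq_empty_or_nonempty with h | ⟨r₀, hr₀⟩
  · rw [h]
    simp only [card_empty, Nat.cast_zero, zero_mul]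
    positivity
  · obtain ⟨hr1, hr2⟩ := mem_filter.mp hr₀
    have hqP : q.Coprime P := coprime_primorial_of_lt hq hzq
    refine card_mul_sum_inv_progression_le _ hw (fun l hl => ?_) _ (D := q * P)
      (a := r₀ % (q * P)) (fun r hr => ?_) (fun l hl => ?_)
    · obtain ⟨h1, h2⟩ := mem_filter.mp hl
      exact ⟨h2, (mem_Ioc.mp h1).2⟩
    · obtain ⟨h1, h2⟩ := mem_filter.mp hr
      refine ⟨(hRq r h1).1, ?_, fun l hl hlr => ?_⟩
      · refine (Nat.modEq_and_modEq_iff_modEq_mul hqP).mp ⟨?_, ?_⟩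
        · rw [Nat.ModEq, (hRq r h1).2.2.1, (hRq r₀ hr1).2.2.1]
        · rw [Nat.ModEq, h2, hr2]
      · obtain ⟨h3, h4⟩ := mem_filter.mp hl
        have h5 := (Nat.prime_dvd_prime_iff_eq h4 (hRq r h1).2.1).mp hlr
        have := (hRq r h1).2.2.2
        have := (mem_Ioc.mp h3).2
        omega
    · obtain ⟨h3, h4⟩ := mem_filter.mp hl
      have h5 := mem_Ioc.mp h3
      refine Nat.Coprime.mul_right ?_ (coprime_primorial_of_lt h4 h5.1)
      rw [Nat.coprime_primes h4 hq]
      omega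

/-- The primes `q` just below `√N` contribute little. -/
lemma eventually_gap_le {ε : ℝ} (hε : 0 < ε) :
    ∀ᶠ N : ℕ in atTop, ∀ P : Finset ℕ,
      (∀ q ∈ P, q.Prime ∧ √(N : ℝ) / Real.log N ^ 10 < q ∧ q ^ 2 ≤ N) →
      ∑ q ∈ P, Real.log q * (((Ioc 0 N).filter fun r => r.Prime ∧ r % q = 1).card : ℝ) ≤
        ε * N := by
  obtain ⟨K, hK⟩ := exists_nat_gt (924 / ε)
  have hK0 : (0 : ℝ) < K := lt_trans (by positivity) hK
  have hz : Tendsto (fun N : ℕ => ⌊Real.log N / 10⌋₊) atTop atTop :=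
    tendsto_nat_floor_atTop.comp (tendsto_log_natCast.atTop_div_const (by norm_num))
  filter_upwards [hz.eventually (eventually_mul_le_sum_one_div_prime K),
    eventually_log_pow_le_rpow 10 (by norm_num : (0 : ℝ) < 1 / 10),
    eventually_log_pow_le_rpow (4 ^ K) (by norm_num : (0 : ℝ) < 1 / 10),
    tendsto_log_natCast.eventually_ge_atTop 10000] with N hsum hL10 hLK hLbig P hP
  set L := Real.log N with hL
  have hN0 : (0 : ℝ) < N := by
    rcases Nat.eq_zero_or_pos N with h | h
    · rw [hL, h] at hLbig
      norm_num at hLbig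
    · exact_mod_cast h
  set v : ℝ := (N : ℝ) ^ ((1 : ℝ) / 10) with hv
  have hv0 : 0 < v := by positivity
  have hvN : v ^ 10 = N := by
    rw [hv, ← Real.rpow_natCast, ← Real.rpow_mul hN0.le]; norm_num
  have hlogv : Real.log v = L / 10 := by rw [hv, Real.log_rpow hN0]; ring
  have hv1 : 1 ≤ v := by
    rw [← Real.log_nonneg_iff hv0, hlogv]; linarith
  have hsqrt : √(N : ℝ) = v ^ 5 := by
    rw [← hvN, show v ^ 10 = (v ^ 5) ^ 2 by ring, Real.sqrt_sq (by positivity)]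
  set z := ⌊L / 10⌋₊ with hzdef
  set w := z ^ 4 ^ K with hw
  have hzL : (z : ℝ) ≤ L / 10 := Nat.floor_le (by linarith)
  have hz1 : L / 10 < z + 1 := Nat.lt_floor_add_one _
  have hz0 : 0 < z := Nat.floor_pos.mpr (by linarith)
  have hwv : (w : ℝ) ≤ v := by
    rw [hw]; push_cast
    refine le_trans (pow_le_pow_left₀ (by positivity) (hzL.trans (by linarith)) _) hLK
  have hw0 : 0 < w := by positivity
  have hzw : z ≤ w := Nat.le_self_pow (by positivity) z
  have hprim : (primorial z : ℝ) ≤ v ^ 2 := by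
    calc (primorial z : ℝ) ≤ (4 : ℝ) ^ z := by exact_mod_cast primorial_le_four_pow z
      _ = Real.exp (Real.log 4 * z) := by
          rw [Real.exp_mul, Real.exp_log (by norm_num), Real.rpow_natCast]
      _ ≤ Real.exp (Real.log v * 2) := by
          rw [Real.exp_le_exp, hlogv]
          have := log_four_le
          nlinarith
      _ = v ^ 2 := by rw [Real.exp_mul, Real.exp_log hv0]; norm_cast
  have hprim0 : (0 : ℝ) < primorial z := by exact_mod_cast primorial_pos z
  have hlogL : 1 ≤ Real.log L := by
    rw [Real.le_log_iff_exp_le (by linarith)]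
    linarith [Real.exp_one_lt_d9]
  have hlogz : Real.log L / 2 ≤ Real.log (z + 1) := by
    calc Real.log L / 2 = Real.log √L := (Real.log_sqrt (by linarith)).symm
      _ ≤ Real.log (L / 10) := by
          refine Real.log_le_log (Real.sqrt_pos.mpr (by linarith)) ?_
          rw [Real.sqrt_le_left (by linarith)]
          nlinarith
      _ ≤ _ := Real.log_le_log (by linarith) hz1.le
  have hcount : ∀ q ∈ P, (((Ioc 0 N).filter fun r => r.Prime ∧ r % q = 1).card : ℝ) ≤
      84 * N / (K * Real.log L) * (1 / q) := by
    intro q hq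
    obtain ⟨hqp, hq1, hq2⟩ := hP q hq
    have hq0 : (0 : ℝ) < q := by exact_mod_cast hqp.pos
    have hqv : v ^ 4 < q := by
      refine lt_of_le_of_lt ?_ hq1
      rw [hsqrt, le_div_iff₀ (by positivity)]
      calc v ^ 4 * L ^ 10 ≤ v ^ 4 * v := by gcongr
        _ = v ^ 5 := by ring
    have hqv5 : (q : ℝ) ≤ v ^ 5 := by
      rw [← hsqrt]
      exact Real.le_sqrt_of_sq_le (by exact_mod_cast hq2)
    have hvv4 : v ≤ v ^ 4 := le_self_pow₀ hv1 (by norm_num)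
    have hwq : w < q := by
      have : (w : ℝ) < q := by linarith
      exact_mod_cast this
    have h := card_prime_mod_eq_one_mul_le N hqp hw0 hwq (hzw.trans_lt hwq)
    have hbound : (N : ℝ) / (q * primorial z : ℕ) + 1 + (w : ℝ) ^ 2 ≤
        3 * (N / (q * primorial z)) := by
      push_cast
      have h1 : v ^ 3 ≤ N / (q * primorial z) := by
        rw [le_div_iff₀ (by positivity)]
        calc v ^ 3 * (q * primorial z) ≤ v ^ 3 * (v ^ 5 * v ^ 2) := by gcongr
          _ = (N : ℝ) := by rw [← hvN]; ring
      have h2 : (w : ℝ) ^ 2 ≤ v ^ 3 := by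
        calc (w : ℝ) ^ 2 ≤ v ^ 2 := by gcongr
          _ ≤ v ^ 3 := pow_le_pow_right₀ hv1 (by norm_num)
      have h3 : 1 ≤ v ^ 3 := one_le_pow₀ hv1
      linarith
    have htot := totient_primorial_mul_log_le z
    have htot2 : ((primorial z).totient : ℝ) ≤ primorial z * (2 / Real.log L) := by
      rw [mul_div_assoc', le_div_iff₀ (by linarith)]
      have : ((primorial z).totient : ℝ) * (Real.log L / 2) ≤
          (primorial z).totient * Real.log (z + 1) := by gcongr
      linarith
    have h4 : (((Ioc 0 N).filter fun r => r.Prime ∧ r % q = 1).card : ℝ) * (K / 2) ≤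
        42 * N / Real.log L * (1 / q) := by
      calc _ ≤ _ := mul_le_mul_of_nonneg_left hsum (by positivity)
        _ ≤ _ := h
        _ ≤ primorial z * (2 / Real.log L) * (7 * (3 * (N / (q * primorial z)))) := by gcongr
        _ = _ := by field_simp; norm_num
    calc _ = (((Ioc 0 N).filter fun r => r.Prime ∧ r % q = 1).card : ℝ) * (K / 2) * (2 / K) := by
          field_simp
      _ ≤ 42 * N / Real.log L * (1 / q) * (2 / K) := by gcongr
      _ = _ := by field_simp; norm_num
  set M := ⌊v ^ 5 / L ^ 10⌋₊ with hM
  have hvL : v ^ 4 ≤ v ^ 5 / L ^ 10 := by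
    rw [le_div_iff₀ (by positivity)]
    calc v ^ 4 * L ^ 10 ≤ v ^ 4 * v := by gcongr
      _ = v ^ 5 := by ring
  have hM1 : 1 ≤ v ^ 5 / L ^ 10 := le_trans (one_le_pow₀ hv1) hvL
  have hM0 : 0 < M := Nat.floor_pos.mpr hM1
  have hMhalf : v ^ 5 / L ^ 10 ≤ 2 * M := by
    have h1 := Nat.lt_floor_add_one (v ^ 5 / L ^ 10)
    have h2 : (1 : ℝ) ≤ M := by exact_mod_cast hM0
    rw [← hM] at h1
    linarith
  have hgap : ∑ q ∈ P, Real.log q / q ≤ 11 * Real.log L := by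
    rcases P.eq_empty_or_nonempty with h | ⟨q₀, hq₀⟩
    · rw [h, sum_empty]; linarith
    have hmem : ∀ q ∈ P, q.Prime ∧ M < q ∧ q ≤ Nat.sqrt N := by
      intro q hq
      obtain ⟨hqp, hq1, hq2⟩ := hP q hq
      refine ⟨hqp, ?_, Nat.le_sqrt'.mpr hq2⟩
      rw [hM, Nat.floor_lt (by positivity), ← hsqrt]
      exact hq1
    have hMN : M ≤ Nat.sqrt N := ((hmem q₀ hq₀).2.1.le).trans (hmem q₀ hq₀).2.2
    refine (sum_log_div_le_of_lt P hM0.ne' hMN hmem).trans ?_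
    have h1 : Real.log (Nat.sqrt N) ≤ L / 2 := by
      rw [hL, ← Real.log_sqrt hN0.le]
      refine Real.log_le_log (by exact_mod_cast hM0.trans_le hMN) (Real.nat_sqrt_le_real_sqrt)
    have h2 : L / 2 - 10 * Real.log L ≤ Real.log 2 + Real.log M := by
      rw [← Real.log_mul (by norm_num) (by positivity)]
      refine le_trans (le_of_eq ?_) (Real.log_le_log (by linarith) hMhalf)
      rw [Real.log_div (by positivity) (by positivity), Real.log_pow, Real.log_pow, hlogv]
      push_cast
      ring
    have h3 : 8 ≤ Real.log L := by
      rw [Real.le_log_iff_exp_le (by linarith)]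
      have : Real.exp 8 = Real.exp 1 ^ 8 := by rw [← Real.exp_nat_mul]; norm_num
      rw [this]
      calc Real.exp 1 ^ 8 ≤ 2.72 ^ 8 := by
            gcongr; linarith [Real.exp_one_lt_d9]
        _ ≤ 10000 := by norm_num
        _ ≤ L := hLbig
    have := Real.log_two_lt_d9
    linarith
  calc _ ≤ ∑ q ∈ P, Real.log q * (84 * N / (K * Real.log L) * (1 / q)) := by
        refine sum_le_sum fun q hq => mul_le_mul_of_nonneg_left (hcount q hq) ?_
        exact Real.log_natCast_nonneg q
    _ = 84 * N / (K * Real.log L) * ∑ q ∈ P, Real.log q / q := by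
        rw [mul_sum]
        exact sum_congr rfl fun q _ => by ring
    _ ≤ 84 * N / (K * Real.log L) * (11 * Real.log L) := by gcongr
    _ = 924 / K * N := by field_simp; norm_num
    _ ≤ ε * N := by
        refine mul_le_mul_of_nonneg_right ?_ hN0.le
        rw [div_lt_iff₀ hε] at hK
        rw [div_le_iff₀ hK0]
        linarith

/-- The weighted count of primes `r ≤ N` with `d ∣ r - 1`. -/
noncomputable def progTheta (N d : ℕ) : ℝ := ∑ r ∈ Ioc 0 N with r.Prime ∧ d ∣ r - 1, Real.log r

lemma theta_natCast_eq (N : ℕ) :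
    Chebyshev.theta N = ∑ r ∈ Ioc 0 N with r.Prime, Real.log r := by
  rw [Chebyshev.theta, Nat.floor_natCast]

lemma theta_natCast_le (N : ℕ) : Chebyshev.theta N ≤ 1.4 * N := by
  have h := Chebyshev.theta_le_log4_mul_x (Nat.cast_nonneg (α := ℝ) N)
  have h4 := log_four_le
  have : (0 : ℝ) ≤ N := by positivity
  nlinarith

lemma dvd_sub_one_iff_mod_eq_one {q r : ℕ} (hq : 1 < q) (hr : 0 < r) :
    q ∣ r - 1 ↔ r % q = 1 := by
  rw [← Nat.modEq_iff_dvd' hr, Nat.ModEq, Nat.mod_eq_of_lt hq, eq_comm]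

lemma progTheta_eq_of_prime {N q : ℕ} (hq : q.Prime) :
    progTheta N q = ∑ r ∈ Ioc 0 N with r.Prime ∧ r % q = 1, Real.log r := by
  rw [progTheta]
  refine sum_congr (filter_congr fun r hr => ?_) fun _ _ => rfl
  rw [dvd_sub_one_iff_mod_eq_one hq.one_lt (mem_Ioc.mp hr).1]

lemma progTheta_le_theta (N d : ℕ) : progTheta N d ≤ Chebyshev.theta N := by
  rw [theta_natCast_eq, progTheta]
  refine sum_le_sum_of_subset_of_nonneg (fun r hr => ?_) fun r _ _ => Real.log_natCast_nonneg r
  simp only [mem_filter] at hr ⊢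
  exact ⟨hr.1, hr.2.1⟩

lemma progTheta_le (N d : ℕ) : progTheta N d ≤ Real.log N * (N / d) := by
  have h1 : progTheta N d ≤
      ((Ioc 0 N).filter fun r => r.Prime ∧ d ∣ r - 1).card • Real.log N := by
    refine sum_le_card_nsmul _ _ _ fun r hr => ?_
    have := mem_Ioc.mp (mem_filter.mp hr).1
    exact Real.log_le_log (by exact_mod_cast this.1) (by exact_mod_cast this.2)
  have h2 : ((Ioc 0 N).filter fun r => r.Prime ∧ d ∣ r - 1).card ≤ N / d := by
    rw [← Nat.Ioc_filter_dvd_card_eq_div]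
    refine card_le_card_of_injOn (fun r => r - 1) (fun r hr => ?_) (fun r hr s hs hrs => ?_)
    · obtain ⟨h1, h2, h3⟩ := mem_filter.mp hr
      have h4 := mem_Ioc.mp h1
      have := h2.two_le
      simp only [coe_filter, mem_Ioc, Set.mem_ofPred_eq]
      exact ⟨⟨by omega, by omega⟩, h3⟩
    · have h4 := mem_Ioc.mp (mem_filter.mp hr).1
      have h5 := mem_Ioc.mp (mem_filter.mp hs).1
      simp only at hrs
      omega
  have h3 : (((Ioc 0 N).filter fun r => r.Prime ∧ d ∣ r - 1).card : ℝ) ≤ (N : ℝ) / d :=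
    le_trans (by exact_mod_cast h2) Nat.cast_div_le
  rw [nsmul_eq_mul] at h1
  have := Real.log_natCast_nonneg N
  nlinarith

lemma sum_log_mul_log_sub_one_eq (N : ℕ) :
    ∑ r ∈ Ioc 0 N with r.Prime, Real.log r * Real.log ((r - 1 : ℕ) : ℝ) =
      ∑ d ∈ Ioc 0 N, ArithmeticFunction.vonMangoldt d * progTheta N d := by
  have h : ∀ r ∈ (Ioc 0 N).filter Nat.Prime, Real.log r * Real.log ((r - 1 : ℕ) : ℝ) =
      ∑ d ∈ Ioc 0 N, if d ∣ r - 1 then ArithmeticFunction.vonMangoldt d * Real.log r else 0 := by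
    intro r hr
    obtain ⟨h1, h2⟩ := mem_filter.mp hr
    have h3 := mem_Ioc.mp h1
    have h4 := h2.two_le
    rw [← ArithmeticFunction.vonMangoldt_sum (n := r - 1), ← sum_filter, mul_sum]
    refine sum_congr ?_ fun _ _ => mul_comm _ _
    ext d
    simp only [Nat.mem_divisors, mem_filter, mem_Ioc]
    constructor
    · rintro ⟨h5, h6⟩
      have := Nat.le_of_dvd (by omega) h5
      exact ⟨⟨Nat.pos_of_dvd_of_pos h5 (by omega), by omega⟩, h5⟩
    · rintro ⟨_, h5⟩
      exact ⟨h5, by omega⟩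
  rw [sum_congr rfl h, sum_comm]
  refine sum_congr rfl fun d _ => ?_
  rw [progTheta, mul_sum, ← sum_filter, filter_filter]

lemma eventually_le_sum_log_mul_log_sub_one :
    ∀ᶠ N : ℕ in atTop, Chebyshev.theta N * Real.log N - 0.02 * (N * Real.log N) ≤
      ∑ r ∈ Ioc 0 N with r.Prime, Real.log r * Real.log ((r - 1 : ℕ) : ℝ) := by
  filter_upwards [tendsto_log_natCast.eventually_ge_atTop 1400, eventually_ge_atTop 200]
    with N hL hN
  set L := Real.log N with hLdef
  have hN0 : (200 : ℝ) ≤ N := by exact_mod_cast hN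
  have h200 : Real.log 200 ≤ 6 := by
    rw [Real.log_le_iff_le_exp (by norm_num)]
    have : Real.exp 6 = Real.exp 1 ^ 6 := by rw [← Real.exp_nat_mul]; norm_num
    rw [this]
    calc (200 : ℝ) ≤ 2.7 ^ 6 := by norm_num
      _ ≤ _ := by gcongr; linarith [Real.exp_one_gt_d9]
  have hterm : ∀ r ∈ (Ioc 0 N).filter Nat.Prime, Real.log r * (L - 6) -
      (if r ≤ N / 100 then Real.log r * L else 0) ≤
        Real.log r * Real.log ((r - 1 : ℕ) : ℝ) := by
    intro r hr
    obtain ⟨h1, h2⟩ := mem_filter.mp hr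
    have hr0 := Real.log_natCast_nonneg r
    have hr1 := Real.log_natCast_nonneg (r - 1)
    split_ifs with h
    · nlinarith
    · rw [sub_zero]
      refine mul_le_mul_of_nonneg_left ?_ hr0
      have h3 : N ≤ 200 * (r - 1) := by omega
      have h4 : (N : ℝ) ≤ 200 * ((r - 1 : ℕ) : ℝ) := by exact_mod_cast h3
      have h5 : (0 : ℝ) < ((r - 1 : ℕ) : ℝ) := by linarith
      have h6 := Real.log_le_log (by linarith) h4
      rw [Real.log_mul (by norm_num) h5.ne'] at h6
      linarith
  have hsum := sum_le_sum hterm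
  rw [sum_sub_distrib, ← sum_mul, ← theta_natCast_eq, ← sum_filter, ← sum_mul, filter_filter]
    at hsum
  have hM : ∑ r ∈ Ioc 0 N with r.Prime ∧ r ≤ N / 100, Real.log r ≤ 0.014 * N := by
    have h := sum_log_le_theta ((Ioc 0 N).filter fun r => r.Prime ∧ r ≤ N / 100) (N / 100)
      fun q hq => ⟨(mem_filter.mp hq).2.1, by
        have h1 := (mem_filter.mp hq).2.2
        have h2 : q * 100 ≤ N := by omega
        rw [le_div_iff₀ (by norm_num)]
        exact_mod_cast h2⟩
    rw [max_eq_left (by linarith)] at h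
    linarith
  have hθ := theta_natCast_le N
  nlinarith

lemma eventually_sum_not_prime_le :
    ∀ᶠ N : ℕ in atTop, ∑ d ∈ Ioc 0 N with ¬ d.Prime,
      ArithmeticFunction.vonMangoldt d * progTheta N d ≤ 0.02 * (N * Real.log N) := by
  obtain ⟨Y, hY⟩ := exists_sum_vonMangoldt_div_not_prime_lt (by norm_num : (0 : ℝ) < 0.01)
  filter_upwards [tendsto_log_natCast.eventually_ge_atTop (140 * Chebyshev.psi Y)] with N hL
  have hN0 : (0 : ℝ) ≤ N := by positivity
  have hL0 := Real.log_natCast_nonneg N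
  have hΛ := fun n => ArithmeticFunction.vonMangoldt_nonneg (n := n)
  rw [← sum_filter_add_sum_filter_not _ (fun d => d ≤ Y), filter_filter, filter_filter]
  have h1 : ∑ d ∈ Ioc 0 N with ¬ d.Prime ∧ d ≤ Y,
      ArithmeticFunction.vonMangoldt d * progTheta N d ≤ Chebyshev.psi Y * (1.4 * N) := by
    rw [psi_natCast_eq, sum_mul]
    refine (sum_le_sum fun d _ => mul_le_mul_of_nonneg_left
      ((progTheta_le_theta N d).trans (theta_natCast_le N)) (hΛ d)).trans ?_
    refine sum_le_sum_of_subset_of_nonneg (fun d hd => ?_) fun d _ _ =>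
      mul_nonneg (hΛ d) (by positivity)
    obtain ⟨h2, _, h3⟩ := mem_filter.mp hd
    exact mem_Ioc.mpr ⟨(mem_Ioc.mp h2).1, h3⟩
  have h2 : ∑ d ∈ Ioc 0 N with ¬ d.Prime ∧ ¬ d ≤ Y,
      ArithmeticFunction.vonMangoldt d * progTheta N d ≤ N * Real.log N * 0.01 := by
    refine le_trans ?_ (mul_le_mul_of_nonneg_left
      (hY ((Ioc 0 N).filter fun d => ¬ d.Prime ∧ ¬ d ≤ Y) fun d hd => ?_) (by positivity))
    · rw [mul_sum]
      refine sum_le_sum fun d _ => ?_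
      calc _ ≤ ArithmeticFunction.vonMangoldt d * (Real.log N * (N / d)) :=
            mul_le_mul_of_nonneg_left (progTheta_le N d) (hΛ d)
        _ = _ := by ring
    · have := (mem_filter.mp hd).2
      exact ⟨this.1, not_le.mp this.2⟩
  nlinarith

lemma eventually_log_log_le {ε : ℝ} (hε : 0 < ε) :
    ∀ᶠ N : ℕ in atTop, Real.log (Real.log N) ^ 2 ≤ ε * Real.log N := by
  have h := (Real.isLittleO_pow_log_id_atTop (n := 2)).bound hε
  filter_upwards [tendsto_log_natCast.eventually h, tendsto_log_natCast.eventually_ge_atTop 0]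
    with N hN h0
  rw [Real.norm_of_nonneg (by positivity), id, Real.norm_of_nonneg h0] at hN
  exact hN

lemma eventually_small_le :
    ∀ᶠ N : ℕ in atTop, ∀ P : Finset ℕ, (∀ q ∈ P, q.Prime ∧ (q : ℝ) ≤ Real.log N ^ 10) →
      ∑ q ∈ P, Real.log q * progTheta N q ≤ 0.02 * (N * Real.log N) := by
  filter_upwards [eventually_log_log_le (by norm_num : (0 : ℝ) < 1e-9),
    tendsto_log_natCast.eventually_ge_atTop 1000000,
    eventually_log_pow_le_rpow 20 (by norm_num : (0 : ℝ) < 1)] with N hll hL hLN P hP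
  set L := Real.log N with hLdef
  have hN0 : (0 : ℝ) < N := by
    rcases Nat.eq_zero_or_pos N with h | h
    · rw [hLdef, h] at hL
      norm_num at hL
    · exact_mod_cast h
  have hN1 : (1 : ℝ) ≤ N := by
    have : 0 < N := by exact_mod_cast hN0
    exact_mod_cast this
  rw [Real.rpow_one] at hLN
  set y := ⌊L ^ 10⌋₊ with hy
  have hL10 : 1 ≤ L ^ 10 := one_le_pow₀ (by linarith)
  have hy0 : 0 < y := Nat.floor_pos.mpr hL10
  have hPy : ∀ q ∈ P, q.Prime ∧ q ≤ y := fun q hq => ⟨(hP q hq).1, Nat.le_floor (hP q hq).2⟩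
  have hyN : (y : ℝ) ^ 2 ≤ N := by
    calc (y : ℝ) ^ 2 ≤ (L ^ 10) ^ 2 := by
          gcongr; exact Nat.floor_le (by positivity)
      _ = L ^ 20 := by ring
      _ ≤ N := hLN
  have hlogy : Real.log y ≤ 10 * Real.log L := by
    have : Real.log y ≤ Real.log (L ^ 10) :=
      Real.log_le_log (by exact_mod_cast hy0) (Nat.floor_le (by positivity))
    rwa [Real.log_pow] at this
  have hlogL1 : 1 ≤ Real.log L := by
    rw [Real.le_log_iff_exp_le (by linarith)]
    linarith [Real.exp_one_lt_d9]
  set f : ℕ → ℝ := fun n => if n.Prime then Real.log n else 0 with hf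
  have hrange : ∀ g : ℕ → ℝ, g 0 = 0 → ∑ n ∈ range (N + 1), g n = ∑ n ∈ Ioc 0 N, g n := by
    intro g hg
    rw [range_eq_Ico, ← Finset.insert_Ico_add_one_left_eq_Ico (Nat.succ_pos N),
      sum_insert (by simp),
      hg, zero_add]
    rfl
  have hfθ : ∑ n ∈ range (N + 1), f n = Chebyshev.theta N := by
    rw [hrange f (by simp [hf]), theta_natCast_eq, sum_filter]
  have hclass : ∀ q ∈ P, classSum (N + 1) q 1 f = progTheta N q := by
    intro q hq
    rw [progTheta_eq_of_prime (hP q hq).1, classSum, sum_filter, hrange _ (by simp),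
      sum_filter]
    refine sum_congr rfl fun r _ => ?_
    simp only [hf]
    split_ifs <;> tauto
  have hf2 : ∑ n ∈ range (N + 1), f n ^ 2 ≤ 1.4 * N * L := by
    rw [hrange _ (by simp [hf])]
    calc ∑ n ∈ Ioc 0 N, f n ^ 2 ≤ ∑ n ∈ Ioc 0 N, f n * L := by
          refine sum_le_sum fun n hn => ?_
          have h1 := mem_Ioc.mp hn
          simp only [hf]
          split_ifs
          · have h2 := Real.log_natCast_nonneg n
            have h3 : Real.log n ≤ L :=
              Real.log_le_log (by exact_mod_cast h1.1) (by exact_mod_cast h1.2)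
            nlinarith
          · simp
      _ = Chebyshev.theta N * L := by
          rw [← sum_mul, ← hrange f (by simp [hf]), hfθ]
      _ ≤ 1.4 * N * L := by
          have := theta_natCast_le N
          gcongr
  have hvar := sum_mul_classVar_le P y hy0 hPy (N + 1) f
  have hvar2 : ∑ q ∈ P, (q : ℝ) * classVar (N + 1) q f ≤ 30 * N * (N * L) := by
    refine hvar.trans ?_
    push_cast
    calc 7 * ((N : ℝ) + 1 + (y : ℝ) ^ 2) * ∑ n ∈ range (N + 1), f n ^ 2
        ≤ 7 * (N + N + N) * (1.4 * N * L) := by gcongr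
      _ ≤ 30 * N * (N * L) := by
          nlinarith [mul_pos hN0 hN0, mul_pos (mul_pos hN0 hN0) (by linarith : 0 < L)]
  have hmert := sum_log_div_le P hy0.ne' hPy
  have hterm : ∀ q ∈ P, Real.log q * progTheta N q ≤
      1.4 * N * (Real.log q / q) + (10000 * N * Real.log y / 2 * (Real.log q / q) +
        (q * classVar (N + 1) q f) / (20000 * N)) := by
    intro q hq
    have hqp := (hP q hq).1
    have hq0 : (0 : ℝ) < q := by exact_mod_cast hqp.pos
    have h1 := sq_le_classVar (N + 1) hqp.one_lt f
    rw [hclass q hq, hfθ] at h1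
    set D := progTheta N q - Chebyshev.theta N / q with hD
    have h2 : progTheta N q = Chebyshev.theta N / q + D := by rw [hD]; ring
    have hlq := Real.log_natCast_nonneg q
    have hlqy : Real.log q ≤ Real.log y :=
      Real.log_le_log hq0 (by exact_mod_cast (hPy q hq).2)
    have h3 : Real.log q * D ≤ 10000 * N / 2 * (Real.log q ^ 2 / q) + q * D ^ 2 / (20000 * N) := by
      have h4 : 0 ≤ (10000 * N * Real.log q - q * D) ^ 2 / (20000 * N * q) := by positivity
      have h5 : (10000 * N * Real.log q - q * D) ^ 2 / (20000 * N * q) =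
          10000 * N / 2 * (Real.log q ^ 2 / q) + q * D ^ 2 / (20000 * N) - Real.log q * D := by
        field_simp
        ring
      linarith
    have h6 : Real.log q ^ 2 / q ≤ Real.log y * (Real.log q / q) := by
      rw [sq, mul_div_assoc]
      exact mul_le_mul_of_nonneg_right hlqy (by positivity)
    have h7 : q * D ^ 2 / (20000 * N) ≤ (q * classVar (N + 1) q f) / (20000 * N) := by gcongr
    have h8 : Real.log q * (Chebyshev.theta N / q) ≤ 1.4 * N * (Real.log q / q) := by
      calc _ = Chebyshev.theta N * (Real.log q / q) := by ring
        _ ≤ _ := mul_le_mul_of_nonneg_right (theta_natCast_le N) (by positivity)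
    rw [h2, mul_add]
    have h9 : 10000 * N / 2 * (Real.log q ^ 2 / q) ≤
        10000 * N / 2 * (Real.log y * (Real.log q / q)) := by gcongr
    have h10 : 10000 * N / 2 * (Real.log y * (Real.log q / q)) =
        10000 * N * Real.log y / 2 * (Real.log q / q) := by ring
    linarith
  have hlogy0 : 0 ≤ Real.log y := Real.log_natCast_nonneg y
  refine (sum_le_sum hterm).trans ?_
  rw [sum_add_distrib, sum_add_distrib, ← mul_sum, ← mul_sum, ← sum_div]
  have e1 : ∑ q ∈ P, Real.log q / q ≤ 16 * Real.log L := by linarith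
  have e2 : (∑ q ∈ P, (q : ℝ) * classVar (N + 1) q f) / (20000 * N) ≤ 0.0015 * (N * L) := by
    rw [div_le_iff₀ (by positivity)]
    linarith
  have e3 : 1.4 * N * ∑ q ∈ P, Real.log q / q ≤ 1.4 * N * (16 * Real.log L ^ 2) := by
    gcongr
    nlinarith
  have e4 : 10000 * N * Real.log y / 2 * ∑ q ∈ P, Real.log q / q ≤
      800000 * N * Real.log L ^ 2 := by
    calc _ ≤ 10000 * N * (10 * Real.log L) / 2 * (16 * Real.log L) := by
          gcongr
      _ = _ := by ring
  have e5 : N * Real.log L ^ 2 ≤ N * (1e-9 * L) := by gcongr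
  nlinarith

lemma eventually_mid_le :
    ∀ᶠ N : ℕ in atTop, ∀ P : Finset ℕ,
      (∀ q ∈ P, q.Prime ∧ Real.log N ^ 10 < q ∧ (q : ℝ) ≤ √N / Real.log N ^ 10) →
      ∑ q ∈ P, Real.log q * progTheta N q ≤
        Chebyshev.theta N * Real.log N / 2 + 0.02 * (N * Real.log N) := by
  filter_upwards [discrepancy_midrange_le, tendsto_log_natCast.eventually_ge_atTop 1000000,
    eventually_log_pow_le_rpow 2 (by norm_num : (0 : ℝ) < 1 / 4)] with N hdisc hL hL2 P hP
  have hd := hdisc P hP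
  set L := Real.log N with hLdef
  have hN0 : (0 : ℝ) < N := by
    rcases Nat.eq_zero_or_pos N with h | h
    · rw [hLdef, h] at hL
      norm_num at hL
    · exact_mod_cast h
  have hN1 : (1 : ℝ) ≤ N := by
    have : 0 < N := by exact_mod_cast hN0
    exact_mod_cast this
  have hLL10 : L ≤ L ^ 10 := le_self_pow₀ (by linarith) (by norm_num)
  have hψ : Chebyshev.psi N ≤ Chebyshev.theta N + 0.01 * N := by
    have h := Chebyshev.psi_sub_theta_le hN1
    have h1 : L * √N * 200 ≤ N := by
      have h2 : L ^ 2 ≤ √N := hL2.trans (by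
        rw [Real.sqrt_eq_rpow]
        exact Real.rpow_le_rpow_of_exponent_le hN1 (by norm_num))
      have h3 := Real.mul_self_sqrt hN0.le
      have h4 : L * 200 ≤ √N := by nlinarith
      nlinarith [Real.sqrt_nonneg (N : ℝ)]
    linarith
  have hterm : ∀ q ∈ P, Real.log q * progTheta N q ≤
      Real.log q * |∑ n ∈ Ioc 0 N, ArithmeticFunction.vonMangoldt n * residueKernel q n| +
        Chebyshev.psi N * ((1 + 2 / L) * (Real.log q / q)) := by
    intro q hq
    obtain ⟨hqp, hq1, hq2⟩ := hP q hq
    have hqL : L < q := by linarith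
    have hq0 : (0 : ℝ) < q := by linarith
    have hlq := Real.log_natCast_nonneg q
    have h1 : progTheta N q ≤
        ∑ n ∈ Ioc 0 N, ArithmeticFunction.vonMangoldt n * residueKernel q n +
          Chebyshev.psi N / ((q : ℝ) - 1) := by
      rw [progTheta_eq_of_prime hqp, psi_natCast_eq, sum_div, ← sum_add_distrib, sum_filter]
      refine sum_le_sum fun n _ => ?_
      have hΛ := ArithmeticFunction.vonMangoldt_nonneg (n := n)
      have hq3 : 0 < 1 / ((q : ℝ) - 1) := one_div_pos.mpr (by linarith)
      rw [residueKernel, div_eq_mul_one_div (ArithmeticFunction.vonMangoldt n), ← mul_add]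
      have h2 : 0 ≤ -(if q ∣ n then (0 : ℝ) else 1 / ((q : ℝ) - 1)) + 1 / ((q : ℝ) - 1) := by
        split_ifs <;> linarith
      split_ifs at h2 ⊢ with h3 h4 h5 h6
      all_goals first
        | (rw [← ArithmeticFunction.vonMangoldt_apply_prime h3.1]; nlinarith)
        | nlinarith
        | tauto
    have h2 : 1 / ((q : ℝ) - 1) ≤ (1 + 2 / L) * (1 / q) := by
      rw [div_le_iff₀ (by linarith)]
      have h3 : 1 + 2 / L = (L + 2) / L := by field_simp
      rw [h3, div_mul_div_comm, mul_one, div_mul_eq_mul_div, le_div_iff₀ (by positivity)]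
      nlinarith
    calc _ ≤ Real.log q * (|∑ n ∈ Ioc 0 N, ArithmeticFunction.vonMangoldt n * residueKernel q n| +
          Chebyshev.psi N * ((1 + 2 / L) * (1 / q))) := by
          refine mul_le_mul_of_nonneg_left (h1.trans (add_le_add (le_abs_self _) ?_)) hlq
          rw [div_eq_mul_one_div]
          exact mul_le_mul_of_nonneg_left h2 (Chebyshev.psi_nonneg _)
      _ = _ := by ring
  refine (sum_le_sum hterm).trans ?_
  rw [sum_add_distrib, ← mul_sum, ← mul_sum]
  have hsum : ∑ q ∈ P, Real.log q / q ≤ L / 2 + 5.4 := by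
    have hsq0 : Nat.sqrt N ≠ 0 := by
      have : 0 < N := by exact_mod_cast hN0
      exact (Nat.sqrt_pos.mpr this).ne'
    refine (sum_log_div_le P hsq0 fun q hq => ⟨(hP q hq).1, ?_⟩).trans ?_
    · rw [← Real.nat_floor_real_sqrt_eq_nat_sqrt]
      refine Nat.le_floor ((hP q hq).2.2.trans ?_)
      exact div_le_self (Real.sqrt_nonneg _) (by linarith)
    · have h1 : Real.log (Nat.sqrt N) ≤ L / 2 := by
        rw [hLdef, ← Real.log_sqrt hN0.le]
        exact Real.log_le_log (by positivity) (Real.nat_sqrt_le_real_sqrt)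
      linarith
  have hsum2 : (1 + 2 / L) * ∑ q ∈ P, Real.log q / q ≤ L / 2 + 7 := by
    calc _ ≤ (1 + 2 / L) * (L / 2 + 5.4) := by gcongr
      _ = L / 2 + 6.4 + 10.8 / L := by field_simp; ring
      _ ≤ _ := by
          have : 10.8 / L ≤ 0.6 := by rw [div_le_iff₀ (by linarith)]; linarith
          linarith
  have hψ0 := Chebyshev.psi_nonneg N
  have hθ := theta_natCast_le N
  have h1 : Chebyshev.psi N * ((1 + 2 / L) * ∑ q ∈ P, Real.log q / q) ≤
      (Chebyshev.theta N + 0.01 * N) * (L / 2 + 7) := by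
    calc _ ≤ Chebyshev.psi N * (L / 2 + 7) := by gcongr
      _ ≤ _ := by gcongr
  rw [discrepancy] at hd
  nlinarith

lemma eventually_gap_theta_le :
    ∀ᶠ N : ℕ in atTop, ∀ P : Finset ℕ,
      (∀ q ∈ P, q.Prime ∧ √(N : ℝ) / Real.log N ^ 10 < q ∧ q ^ 2 ≤ N) →
      ∑ q ∈ P, Real.log q * progTheta N q ≤ 0.01 * (N * Real.log N) := by
  filter_upwards [eventually_gap_le (by norm_num : (0 : ℝ) < 0.01)] with N hgap P hP
  have h := mul_le_mul_of_nonneg_right (hgap P hP) (Real.log_natCast_nonneg N)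
  refine le_trans ?_ (h.trans (by linarith))
  rw [sum_mul]
  refine sum_le_sum fun q hq => ?_
  rw [mul_assoc, progTheta_eq_of_prime (hP q hq).1, ← nsmul_eq_mul]
  refine mul_le_mul_of_nonneg_left (sum_le_card_nsmul _ _ _ fun r hr => ?_)
    (Real.log_natCast_nonneg q)
  have := mem_Ioc.mp (mem_filter.mp hr).1
  exact Real.log_le_log (by exact_mod_cast this.1) (by exact_mod_cast this.2)

open Classical in
/-- Primes `r ≤ N` such that `r - 1` has a prime factor exceeding `√N`. -/
noncomputable def largeFactorPrimes (N : ℕ) : Finset ℕ :=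
  (Ioc 0 N).filter fun r => r.Prime ∧ ∃ q, q.Prime ∧ N < q ^ 2 ∧ r % q = 1

lemma sum_log_mul_progTheta_le (N : ℕ) :
    ∑ q ∈ Ioc 0 N with q.Prime ∧ N < q ^ 2, Real.log q * progTheta N q ≤
      Real.log N ^ 2 * (largeFactorPrimes N).card := by
  classical
  have h1 : ∑ q ∈ Ioc 0 N with q.Prime ∧ N < q ^ 2, Real.log q * progTheta N q =
      ∑ r ∈ Ioc 0 N with r.Prime, Real.log r *
        ∑ q ∈ ((Ioc 0 N).filter fun q => q.Prime ∧ N < q ^ 2) with q ∣ r - 1, Real.log q := by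
    simp_rw [progTheta, mul_sum, ← filter_filter, sum_filter (fun q => q ∣ _ - 1),
      sum_filter (fun r => _ ∣ r - 1)]
    rw [sum_comm]
    refine sum_congr rfl fun r _ => sum_congr rfl fun q _ => ?_
    split_ifs
    · ring
    · rfl
  rw [h1, mul_comm, ← nsmul_eq_mul]
  refine le_trans ?_ (sum_le_card_nsmul (largeFactorPrimes N) (fun r => Real.log r *
    ∑ q ∈ ((Ioc 0 N).filter fun q => q.Prime ∧ N < q ^ 2) with q ∣ r - 1, Real.log q) _
    fun r hr => ?_)
  · refine le_of_eq (sum_subset (fun r hr => ?_) fun r hr hr2 => ?_).symm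
    · simp only [largeFactorPrimes, mem_filter] at hr ⊢
      exact ⟨hr.1, hr.2.1⟩
    · obtain ⟨h2, h3⟩ := mem_filter.mp hr
      rw [filter_eq_empty_iff.mpr, sum_empty, mul_zero]
      intro q hq hqr
      obtain ⟨_, h4, h5⟩ := mem_filter.mp hq
      refine hr2 ?_
      simp only [largeFactorPrimes, mem_filter]
      exact ⟨h2, h3, q, h4, h5,
        (dvd_sub_one_iff_mod_eq_one h4.one_lt (mem_Ioc.mp h2).1).mp hqr⟩
  · simp only [largeFactorPrimes, mem_filter, mem_Ioc] at hr
    have h2 := hr.2.1.two_le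
    have h3 := sum_log_filter_dvd_le ((Ioc 0 N).filter fun q => q.Prime ∧ N < q ^ 2)
      (fun q hq => (mem_filter.mp hq).2.1) (k := r - 1) (by omega)
    have h4 : Real.log ((r - 1 : ℕ) : ℝ) ≤ Real.log N :=
      Real.log_le_log (by exact_mod_cast (by omega : 0 < r - 1))
        (by exact_mod_cast (by omega : r - 1 ≤ N))
    have h5 : Real.log r ≤ Real.log N :=
      Real.log_le_log (by exact_mod_cast hr.1.1) (by exact_mod_cast hr.1.2)
    have h6 := Real.log_natCast_nonneg r
    have h7 := Real.log_natCast_nonneg (r - 1)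
    rw [sq]
    exact mul_le_mul h5 (h3.trans h4) (sum_nonneg fun q _ => Real.log_natCast_nonneg q)
      (Real.log_natCast_nonneg N)

lemma eventually_theta_ge : ∀ᶠ N : ℕ in atTop, 0.69 * (N : ℝ) ≤ Chebyshev.theta N := by
  filter_upwards [tendsto_log_natCast.eventually_ge_atTop 10000,
    eventually_log_pow_le_rpow 2 (by norm_num : (0 : ℝ) < 1 / 4)] with N hL hL2
  have hN0 : 0 < N := by
    rcases Nat.eq_zero_or_pos N with h | h
    · rw [h] at hL
      norm_num at hL
    · exact h
  have hN1 : (1 : ℝ) ≤ N := by exact_mod_cast hN0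
  have h := Chebyshev.theta_ge N
  have h2 : Real.log N ^ 2 ≤ √N := hL2.trans (by
    rw [Real.sqrt_eq_rpow]
    exact Real.rpow_le_rpow_of_exponent_le hN1 (by norm_num))
  have h3 := Real.mul_self_sqrt (by linarith : (0 : ℝ) ≤ N)
  have h4 : Real.log N * 10000 ≤ √N := by nlinarith
  have h5 : √(N : ℝ) * Real.log N * 10000 ≤ N := by nlinarith [Real.sqrt_nonneg (N : ℝ)]
  have h6 : Real.log ((N : ℝ) + 1) ≤ Real.log N + 1 := by
    have h7 : Real.log ((N : ℝ) + 1) ≤ Real.log (2 * N) :=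
      Real.log_le_log (by linarith) (by linarith)
    rw [Real.log_mul (by norm_num) (by linarith)] at h7
    linarith [Real.log_two_lt_d9]
  have h8 := Real.log_two_gt_d9
  have h9 : (1 : ℝ) ≤ √N := Real.one_le_sqrt.mpr hN1
  nlinarith

/-- Goldfeld's theorem: a positive proportion of the primes `r ≤ N` are such that `r - 1` has a
prime factor exceeding `√N`. -/
theorem eventually_card_largeFactorPrimes_ge :
    ∀ᶠ N : ℕ in atTop, (N : ℝ) / (4 * Real.log N) ≤ (largeFactorPrimes N).card := by
  filter_upwards [eventually_le_sum_log_mul_log_sub_one, eventually_sum_not_prime_le,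
    eventually_small_le, eventually_mid_le, eventually_gap_theta_le, eventually_theta_ge,
    tendsto_log_natCast.eventually_ge_atTop 1] with N h1 h2 h3 h4 h5 h6 hL
  rw [sum_log_mul_log_sub_one_eq, ← sum_filter_not_add_sum_filter _ (fun d => Nat.Prime d)] at h1
  have hsplit : ∑ d ∈ Ioc 0 N with d.Prime, ArithmeticFunction.vonMangoldt d * progTheta N d =
      ∑ q ∈ Ioc 0 N with q.Prime, Real.log q * progTheta N q :=
    sum_congr rfl fun q hq => by
      rw [ArithmeticFunction.vonMangoldt_apply_prime (mem_filter.mp hq).2]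
  rw [hsplit, ← sum_filter_add_sum_filter_not ((Ioc 0 N).filter Nat.Prime) (fun q => N < q ^ 2),
    filter_filter,
    ← sum_filter_add_sum_filter_not (((Ioc 0 N).filter Nat.Prime).filter fun q => ¬ N < q ^ 2)
      (fun q => (q : ℝ) ≤ Real.log N ^ 10),
    ← sum_filter_add_sum_filter_not ((((Ioc 0 N).filter Nat.Prime).filter
      fun q => ¬ N < q ^ 2).filter fun q : ℕ => ¬ (q : ℝ) ≤ Real.log N ^ 10)
      (fun q => (q : ℝ) ≤ √N / Real.log N ^ 10)] at h1
  have hbig := sum_log_mul_progTheta_le N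
  have e3 := h3 ((((Ioc 0 N).filter Nat.Prime).filter fun q => ¬ N < q ^ 2).filter
    fun q : ℕ => (q : ℝ) ≤ Real.log N ^ 10) fun q hq => by
      simp only [mem_filter] at hq
      exact ⟨hq.1.1.2, hq.2⟩
  have e4 := h4 (((((Ioc 0 N).filter Nat.Prime).filter fun q => ¬ N < q ^ 2).filter
    fun q : ℕ => ¬ (q : ℝ) ≤ Real.log N ^ 10).filter
      fun q : ℕ => (q : ℝ) ≤ √N / Real.log N ^ 10) fun q hq => by
      simp only [mem_filter] at hq
      exact ⟨hq.1.1.1.2, not_le.mp hq.1.2, hq.2⟩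
  have e5 := h5 (((((Ioc 0 N).filter Nat.Prime).filter fun q => ¬ N < q ^ 2).filter
    fun q : ℕ => ¬ (q : ℝ) ≤ Real.log N ^ 10).filter
      fun q : ℕ => ¬ (q : ℝ) ≤ √N / Real.log N ^ 10) fun q hq => by
      simp only [mem_filter] at hq
      exact ⟨hq.1.1.1.2, not_le.mp hq.2, not_lt.mp hq.1.1.2⟩
  have hN0 : (0 : ℝ) ≤ N := by positivity
  have hθ : 0.69 * (N : ℝ) * Real.log N ≤ Chebyshev.theta N * Real.log N := by gcongr
  have hfin : N * Real.log N / 4 ≤ Real.log N ^ 2 * (largeFactorPrimes N).card := by nlinarith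
  rw [div_le_iff₀ (by linarith)]
  have h7 : Real.log N * (N / 4) ≤ Real.log N * (Real.log N * (largeFactorPrimes N).card) := by
    linarith
  have := le_of_mul_le_mul_left h7 (by linarith)
  linarith

/-- `n` has a representation `n = k * p + r` as in the definition of `f(n) ≥ c * n ^ (3/2)`. -/
def HasRepresentation (c : ℝ) (n : ℕ) : Prop :=
  ∃ k p q r : ℕ, 1 ≤ k ∧ Nat.Prime p ∧ Nat.Prime q ∧ Nat.Prime r ∧
    n = k * p + r ∧ r % q = 1 % q ∧
    c * (n : ℝ) ^ ((3 : ℝ) / 2) ≤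
      min (min ((p : ℝ) ^ 2 * k) ((p : ℝ) * k * r)) ((q : ℝ) * r)

lemma hasRepresentation_of_mod_eq {N n p r : ℕ} (hN : 1 ≤ N) (hn : 2 * N < n) (hn2 : n ≤ 4 * N)
    (hp : p.Prime) (hpN : √(N : ℝ) ≤ 200 * p) (hr : r ∈ largeFactorPrimes N)
    (hrN : (N : ℝ) ≤ 100 * r) (hnr : n % p = r % p) :
    HasRepresentation (1 / 1600) n := by
  simp only [largeFactorPrimes, mem_filter, mem_Ioc] at hr
  obtain ⟨⟨hr0, hr1⟩, hrp, q, hq, hqN, hrq⟩ := hr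
  obtain ⟨k, hk⟩ := (Nat.modEq_iff_dvd' (by omega : r ≤ n)).mp (show r ≡ n [MOD p] from hnr.symm)
  have hN0 : (1 : ℝ) ≤ N := by exact_mod_cast hN
  have hs0 : 1 ≤ √(N : ℝ) := Real.one_le_sqrt.mpr hN0
  have hs2 : √(N : ℝ) * √(N : ℝ) = N := Real.mul_self_sqrt (by linarith)
  have hpk : (N : ℝ) ≤ p * k := by exact_mod_cast (by omega : N ≤ p * k)
  have hqs : √(N : ℝ) ≤ q := by
    rw [Real.sqrt_le_left (by positivity)]
    exact_mod_cast hqN.le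
  have hpow : (1 / 1600 : ℝ) * (n : ℝ) ^ ((3 : ℝ) / 2) ≤ √(N : ℝ) * N / 200 := by
    have h1 : (n : ℝ) ≤ 4 * N := by exact_mod_cast hn2
    have h2 : (n : ℝ) ^ ((3 : ℝ) / 2) ≤ (4 * N : ℝ) ^ ((3 : ℝ) / 2) := by gcongr
    have h3 : (4 * N : ℝ) ^ ((3 : ℝ) / 2) = 8 * (√(N : ℝ) * N) := by
      have h4 : (4 * N : ℝ) = (2 * √(N : ℝ)) ^ 2 := by rw [mul_pow, sq (√(N : ℝ)), hs2]; norm_num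
      rw [h4, ← Real.rpow_natCast, ← Real.rpow_mul (by positivity)]
      norm_num
      linear_combination (8 * √(N : ℝ)) * hs2
    linarith
  refine ⟨k, p, q, r, ?_, hp, hq, hrp, ?_, ?_, hpow.trans (le_min (le_min ?_ ?_) ?_)⟩
  · rw [Nat.one_le_iff_ne_zero]
    rintro rfl
    omega
  · rw [mul_comm k p]; omega
  · rw [hrq, Nat.mod_eq_of_lt hq.one_lt]
  · calc √(N : ℝ) * N / 200 ≤ 200 * p * (p * k) / 200 := by gcongr
      _ = _ := by ring
  · have hNs : √(N : ℝ) ≤ N := by nlinarith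
    calc √(N : ℝ) * N / 200 ≤ (100 * r) * (p * k) / 100 := by
          have : √(N : ℝ) * N ≤ 100 * r * (p * k) := by
            exact mul_le_mul (hNs.trans hrN) hpk (by linarith) (by positivity)
          have : 0 ≤ √(N : ℝ) * N := by positivity
          linarith
      _ = _ := by ring
  · calc √(N : ℝ) * N / 200 ≤ q * (100 * r) / 100 := by
          have : √(N : ℝ) * N ≤ q * (100 * r) :=
            mul_le_mul hqs hrN (by linarith) (by positivity)
          have : 0 ≤ √(N : ℝ) * N := by positivity
          linarith
      _ = _ := by ring

lemma eventually_card_prime_le :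
    ∀ᶠ N : ℕ in atTop, ∀ P : Finset ℕ, (∀ p ∈ P, p.Prime ∧ 100 * p ≤ N) →
      (P.card : ℝ) ≤ N / (20 * Real.log N) := by
  filter_upwards [tendsto_log_natCast.eventually_ge_atTop 10000,
    eventually_log_pow_le_rpow 2 (by norm_num : (0 : ℝ) < 1 / 4), eventually_ge_atTop 1]
    with N hL hL2 hN P hP
  set L := Real.log N with hLdef
  have hN1 : (1 : ℝ) ≤ N := by exact_mod_cast hN
  have h2 : L ^ 2 ≤ √N := hL2.trans (by
    rw [Real.sqrt_eq_rpow]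
    exact Real.rpow_le_rpow_of_exponent_le hN1 (by norm_num))
  have h3 := Real.mul_self_sqrt (by linarith : (0 : ℝ) ≤ N)
  have h4 : L * 10000 ≤ √N := by nlinarith
  have h5 : √(N : ℝ) * L * 10000 ≤ N := by nlinarith [Real.sqrt_nonneg (N : ℝ)]
  rw [← card_filter_add_card_filter_not (fun p => p ≤ Nat.sqrt N)]
  have h6 : ((P.filter fun p => p ≤ Nat.sqrt N).card : ℝ) ≤ √N := by
    refine le_trans ?_ Real.nat_sqrt_le_real_sqrt
    have : P.filter (fun p => p ≤ Nat.sqrt N) ⊆ Ioc 0 (Nat.sqrt N) := fun p hp => by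
      obtain ⟨h7, h8⟩ := mem_filter.mp hp
      exact mem_Ioc.mpr ⟨(hP p h7).1.pos, h8⟩
    have := card_le_card this
    rw [Nat.card_Ioc] at this
    exact_mod_cast this
  have h7 : ((P.filter fun p => ¬ p ≤ Nat.sqrt N).card : ℝ) * (L / 2) ≤ 0.014 * N := by
    have h := sum_log_le_theta (P.filter fun p => ¬ p ≤ Nat.sqrt N) (N / 100)
      fun q hq => ⟨(hP q (mem_filter.mp hq).1).1, by
        have h2 := (hP q (mem_filter.mp hq).1).2
        rw [le_div_iff₀ (by norm_num), mul_comm]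
        exact_mod_cast h2⟩
    rw [max_eq_left (by linarith)] at h
    refine le_trans ?_ (h.trans (by linarith))
    rw [← nsmul_eq_mul]
    refine card_nsmul_le_sum _ _ _ fun p hp => ?_
    have h8 := (mem_filter.mp hp).2
    rw [not_le, Nat.sqrt_lt'] at h8
    have h9 : Real.log N ≤ Real.log ((p : ℝ) ^ 2) :=
      Real.log_le_log (by linarith) (by exact_mod_cast h8.le)
    rw [Real.log_pow] at h9
    push_cast at h9
    linarith
  push_cast
  rw [le_div_iff₀ (by linarith)]
  nlinarith

lemma eventually_le_card_prime :
    ∀ᶠ N : ℕ in atTop,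
      0.6 * √(N : ℝ) / Real.log N ≤
        ((Ioc 0 (Nat.sqrt N)).filter fun p : ℕ => p.Prime ∧ √(N : ℝ) ≤ 200 * p).card := by
  have hs : Tendsto Nat.sqrt atTop atTop :=
    tendsto_atTop_atTop.mpr fun b => ⟨b ^ 2, fun a ha => Nat.le_sqrt'.mpr ha⟩
  filter_upwards [hs.eventually eventually_theta_ge, tendsto_log_natCast.eventually_ge_atTop 10,
    eventually_ge_atTop 4] with N hθ hL hN
  set L := Real.log N with hLdef
  set Q := Nat.sqrt N with hQ
  set P := (Ioc 0 Q).filter fun p : ℕ => p.Prime ∧ √(N : ℝ) ≤ 200 * p with hP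
  have hN1 : (4 : ℝ) ≤ N := by exact_mod_cast hN
  have hs2 : 2 ≤ √(N : ℝ) := Real.le_sqrt_of_sq_le (by linarith)
  have hQs : √(N : ℝ) ≤ 2 * Q := by
    have h1 : √(N : ℝ) ≤ Q + 1 := Real.real_sqrt_le_nat_sqrt_succ
    linarith
  have hQ2 : (Q : ℝ) ≤ √N := Real.nat_sqrt_le_real_sqrt
  have hQ0 : (0 : ℝ) < Q := by linarith
  have h1 : Chebyshev.theta Q ≤ ∑ p ∈ P, Real.log p + 0.014 * Q := by
    rw [theta_natCast_eq, ← sum_filter_add_sum_filter_not _ (fun p : ℕ => √(N : ℝ) ≤ 200 * p),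
      filter_filter]
    refine add_le_add le_rfl ?_
    have h := sum_log_le_theta
      (((Ioc 0 Q).filter Nat.Prime).filter fun p : ℕ => ¬ √(N : ℝ) ≤ 200 * p) (Q / 100)
      fun q hq => ⟨(mem_filter.mp (mem_filter.mp hq).1).2, by
        have h2 := (mem_filter.mp hq).2
        linarith⟩
    rw [max_eq_left (by linarith)] at h
    linarith
  have h2 : ∑ p ∈ P, Real.log p ≤ P.card * (L / 2) := by
    rw [← nsmul_eq_mul]
    refine sum_le_card_nsmul _ _ _ fun p hp => ?_
    have h3 := mem_Ioc.mp (mem_filter.mp hp).1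
    rw [hLdef, ← Real.log_sqrt (by linarith)]
    refine Real.log_le_log (by exact_mod_cast h3.1) (le_trans (by exact_mod_cast h3.2) hQ2)
  rw [div_le_iff₀ (by linarith)]
  linarith

lemma eventually_card_not_hasRepresentation_le :
    ∀ᶠ N : ℕ in atTop, ∀ E : Finset ℕ,
      (∀ n ∈ E, 2 * N < n ∧ n ≤ 4 * N ∧ ¬ HasRepresentation (1 / 1600) n) →
        (E.card : ℝ) ≤ 30000 * Real.log N ^ 3 := by
  classical
  filter_upwards [eventually_card_largeFactorPrimes_ge, eventually_card_prime_le,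
    eventually_le_card_prime, tendsto_log_natCast.eventually_ge_atTop 1, eventually_ge_atTop 1]
    with N h1 h2 h3 hL hN E hE
  set L := Real.log N with hLdef
  set P := (Ioc 0 (Nat.sqrt N)).filter fun p : ℕ => p.Prime ∧ √(N : ℝ) ≤ 200 * p with hP
  set R := (largeFactorPrimes N).filter fun r => ¬ 100 * r ≤ N with hR
  have hN1 : (1 : ℝ) ≤ N := by exact_mod_cast hN
  have hRmem : ∀ r ∈ largeFactorPrimes N, r.Prime ∧ r ≤ N := fun r hr => by
    simp only [largeFactorPrimes, mem_filter, mem_Ioc] at hr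
    exact ⟨hr.2.1, hr.1.2⟩
  have hRcard : (N : ℝ) / (5 * L) ≤ R.card := by
    have h4 := h2 ((largeFactorPrimes N).filter fun r => 100 * r ≤ N) fun p hp =>
      ⟨(hRmem p (mem_filter.mp hp).1).1, (mem_filter.mp hp).2⟩
    rw [← card_filter_add_card_filter_not (fun r => 100 * r ≤ N)] at h1
    push_cast at h1
    have h5 : (N : ℝ) / (4 * L) = N / (5 * L) + N / (20 * L) := by field_simp; norm_num
    linarith
  have hsieve := card_sq_mul_card_mul_card_le P (Nat.sqrt N) (Nat.sqrt_pos.mpr hN)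
    (fun p hp => ⟨(mem_filter.mp hp).2.1, (mem_Ioc.mp (mem_filter.mp hp).1).2⟩) (4 * N + 1) E R
    (fun n hn => mem_range.mpr (by have := (hE n hn).2.1; omega))
    (fun r hr => mem_range.mpr (by have := (hRmem r (mem_filter.mp hr).1).2; omega))
    (fun p hp n hn r hr hnr => (hE n hn).2.2
      (hasRepresentation_of_mod_eq hN (hE n hn).1 (hE n hn).2.1 (mem_filter.mp hp).2.1
        (mem_filter.mp hp).2.2 (mem_filter.mp hr).1
        (by
          have := (mem_filter.mp hr).2
          exact_mod_cast (by omega : N ≤ 100 * r)) hnr))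
  have hs : ((Nat.sqrt N : ℕ) : ℝ) ^ 2 ≤ N := by exact_mod_cast Nat.sqrt_le' N
  have hup : (7 * (((4 * N + 1 : ℕ) : ℝ) + ((Nat.sqrt N : ℕ) : ℝ) ^ 2)) ^ 2 ≤ (42 * N : ℝ) ^ 2 := by
    push_cast
    refine pow_le_pow_left₀ (by positivity) ?_ 2
    linarith
  have hPsq : 0.36 * N / L ^ 2 ≤ (P.card : ℝ) ^ 2 := by
    calc 0.36 * N / L ^ 2 = (0.6 * √(N : ℝ) / L) ^ 2 := by
          rw [div_pow, mul_pow, Real.sq_sqrt (by linarith)]; norm_num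
      _ ≤ _ := by gcongr
  have hlow : 0.36 * N / L ^ 2 * (E.card * (N / (5 * L))) ≤ (42 * N : ℝ) ^ 2 := by
    refine le_trans ?_ (hsieve.trans hup)
    gcongr
  have h6 : 0.36 * N / L ^ 2 * (E.card * (N / (5 * L))) = N ^ 2 * (0.072 * E.card / L ^ 3) := by
    field_simp
    ring
  rw [h6, mul_pow, mul_comm ((42 : ℝ) ^ 2)] at hlow
  have h7 := le_of_mul_le_mul_left hlow (by positivity)
  rw [div_le_iff₀ (by positivity)] at h7
  have : 0 ≤ L ^ 3 := by positivity
  linarith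

lemma exists_card_not_hasRepresentation_two_pow_le :
    ∃ B : ℝ, 0 < B ∧ ∀ J : ℕ, ∀ E : Finset ℕ,
      (∀ n ∈ E, 1 ≤ n ∧ n ≤ 2 ^ (J + 1) ∧ ¬ HasRepresentation (1 / 1600) n) →
        (E.card : ℝ) ≤ B + J * (30000 * (J * Real.log 2) ^ 3) := by
  obtain ⟨j₀, hj₀⟩ := eventually_atTop.mp
    ((tendsto_pow_atTop_atTop_of_one_lt (one_lt_two (α := ℕ))).eventually
      eventually_card_not_hasRepresentation_le)
  have hl2 : 0 ≤ Real.log 2 := Real.log_nonneg (by norm_num)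
  refine ⟨2 ^ (j₀ + 1), by positivity, fun J => ?_⟩
  induction J with
  | zero =>
    intro E hE
    have h1 : E ⊆ Ioc 0 2 := fun n hn => by
      have := hE n hn
      exact mem_Ioc.mpr ⟨this.1, this.2.1⟩
    have h2 := card_le_card h1
    rw [Nat.card_Ioc] at h2
    have h3 : (E.card : ℝ) ≤ 2 := by exact_mod_cast h2
    have h4 : (2 : ℝ) ≤ 2 ^ (j₀ + 1) := le_self_pow₀ (by norm_num) (by omega)
    simp only [Nat.cast_zero, zero_mul, add_zero]
    linarith
  | succ J ih =>
    intro E hE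
    rcases Nat.lt_or_ge J j₀ with hJ | hJ
    · have h1 : E ⊆ Ioc 0 (2 ^ (j₀ + 1)) := fun n hn => by
        have := hE n hn
        exact mem_Ioc.mpr ⟨this.1, this.2.1.trans (Nat.pow_le_pow_right (by norm_num) (by omega))⟩
      have h2 := card_le_card h1
      rw [Nat.card_Ioc] at h2
      have h3 : (E.card : ℝ) ≤ 2 ^ (j₀ + 1) := by exact_mod_cast h2
      have : (0 : ℝ) ≤ ((J + 1 : ℕ) : ℝ) * (30000 * (((J + 1 : ℕ) : ℝ) * Real.log 2) ^ 3) := by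
        positivity
      linarith
    · rw [← card_filter_add_card_filter_not (fun n => n ≤ 2 ^ (J + 1))]
      have h1 := ih (E.filter fun n => n ≤ 2 ^ (J + 1)) fun n hn => by
        obtain ⟨h2, h3⟩ := mem_filter.mp hn
        exact ⟨(hE n h2).1, h3, (hE n h2).2.2⟩
      have h4 := hj₀ J hJ (E.filter fun n => ¬ n ≤ 2 ^ (J + 1)) fun n hn => by
        obtain ⟨h2, h3⟩ := mem_filter.mp hn
        have h5 := (hE n h2).2.1
        rw [pow_succ] at h3
        rw [pow_succ, pow_succ] at h5
        exact ⟨by omega, by omega, (hE n h2).2.2⟩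
      push_cast at h4 ⊢
      rw [Real.log_pow] at h4
      have h5 : 30000 * (J * Real.log 2) ^ 3 ≤ 30000 * (((J : ℝ) + 1) * Real.log 2) ^ 3 := by
        gcongr
        linarith
      have h6 : J * (30000 * (J * Real.log 2) ^ 3) ≤
          J * (30000 * (((J : ℝ) + 1) * Real.log 2) ^ 3) := by gcongr
      linarith

end EvasiveNumbers

/-- There exist `c > 0` and `C > 0` such that for all `x ≥ 2`, the number
of integers `n ≤ x` with no quadruple `(k, p, q, r)`, `k ≥ 1` an integer, `p, q, r` primes,
`n = k·p + r`, `r ≡ 1 (mod q)` and `min {p²·k, p·k·r, q·r} ≥ c·n^(3/2)`, is at most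
`C·(log x)⁴`. -/
theorem evasive_almost_all_threehalves :
    ∃ c C : ℝ, 0 < c ∧ 0 < C ∧ ∀ x : ℝ, 2 ≤ x →
      (Set.ncard {n : ℕ | 1 ≤ n ∧ (n : ℝ) ≤ x ∧
          ¬ ∃ k p q r : ℕ, 1 ≤ k ∧ Nat.Prime p ∧ Nat.Prime q ∧ Nat.Prime r ∧
            n = k * p + r ∧ r % q = 1 % q ∧
            c * (n : ℝ) ^ ((3 : ℝ) / 2) ≤
              min (min ((p : ℝ) ^ 2 * k) ((p : ℝ) * k * r)) ((q : ℝ) * r)} : ℝ) ≤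
        C * Real.log x ^ 4 := by
  obtain ⟨B, hB, hcard⟩ := EvasiveNumbers.exists_card_not_hasRepresentation_two_pow_le
  refine ⟨1 / 1600, 16 * B + 60000, by norm_num, by positivity, fun x hx => ?_⟩
  set J := Nat.log 2 ⌊x⌋₊ with hJ
  have hx2 : 2 ≤ ⌊x⌋₊ := Nat.le_floor (by exact_mod_cast hx)
  have hfin : {n : ℕ | 1 ≤ n ∧ (n : ℝ) ≤ x ∧
      ¬ EvasiveNumbers.HasRepresentation (1 / 1600) n}.Finite :=
    (Set.finite_Iic ⌊x⌋₊).subset fun n hn => Nat.le_floor hn.2.1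
  have h := hcard J hfin.toFinset fun n hn => by
    obtain ⟨h1, h2, h3⟩ := hfin.mem_toFinset.mp hn
    exact ⟨h1, (Nat.le_floor h2).trans (Nat.lt_pow_succ_log_self (by norm_num) _).le, h3⟩
  rw [← Set.ncard_eq_toFinset_card _ hfin] at h
  refine le_trans h ?_
  have hlog2 : 1 / 2 ≤ Real.log 2 := by linarith [Real.log_two_gt_d9]
  have hlogx : Real.log 2 ≤ Real.log x := Real.log_le_log (by norm_num) hx
  have hJx : J * Real.log 2 ≤ Real.log x := by
    rw [← Real.log_pow]
    refine Real.log_le_log (by positivity) ?_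
    have h1 : 2 ^ J ≤ ⌊x⌋₊ := Nat.pow_log_le_self 2 (by omega)
    exact le_trans (by exact_mod_cast h1) (Nat.floor_le (by linarith))
  have hJ2 : (J : ℝ) ≤ 2 * Real.log x := by
    have : (0 : ℝ) ≤ J := by positivity
    nlinarith
  have h1 : J * (30000 * (J * Real.log 2) ^ 3) ≤
      2 * Real.log x * (30000 * Real.log x ^ 3) := by gcongr; linarith
  have h2 : 1 ≤ 16 * Real.log x ^ 4 := by
    have : (1 / 2 : ℝ) ^ 4 ≤ Real.log x ^ 4 := by
      gcongr
      linarith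
    linarith
  nlinarith
end

section
/- For every real ε with 0 < ε < 1/4 there exists N such that the following holds for all integers n ≥ N: if m is an integer with n^(1/2−2ε) ≤ m ≤ 4·n^(1/2−2ε), a is an integer with gcd(a, m) = 1, and max over reals y ≤ n/2 of |ψ(y; m, a) − y/φ(m)| < n/(10m), then ψ(n/2; m, a) − ψ(n/4; m, a) ≥ n/(4φ(m)) − n/(5m) > 0, and moreover there exists a prime r with n/4 < r ≤ n/2 and r ≡ a (mod m). -/
/-- `ψ(y; m, a) = Σ_{n ≤ y, n ≡ a (mod m)} Λ(n)`, where `Λ` is the von Mangoldt function. -/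
noncomputable def psi (y : ℝ) (m a : ℕ) : ℝ :=
  ∑ n ∈ Finset.Icc 1 ⌊y⌋₊,
    if n % m = a % m then ArithmeticFunction.vonMangoldt n else 0

/-- If no prime `r ≡ a (mod m)` lies in `(x, y]`, then `ψ(y; m, a) - ψ(x; m, a)` is bounded by the
total contribution of proper prime powers up to `y`. -/
theorem psi_sub_psi_le_of_forall_not_prime {x y : ℝ} (hx : 0 ≤ x) (hxy : x ≤ y) (m a : ℕ)
    (h : ∀ r : ℕ, r.Prime → x < r → (r : ℝ) ≤ y → r % m ≠ a % m) :
    psi y m a - psi x m a ≤ Chebyshev.psi y - Chebyshev.theta y := by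
  have hsub : Finset.Icc 1 ⌊x⌋₊ ⊆ Finset.Icc 1 ⌊y⌋₊ :=
    Finset.Icc_subset_Icc_right (Nat.floor_mono hxy)
  rw [Chebyshev.psi_sub_theta_eq_sum_not_prime, psi, psi, ← Finset.sum_sdiff hsub,
    add_sub_cancel_right, ← Finset.sum_filter]
  refine Finset.sum_le_sum_of_subset_of_nonneg (fun r hr ↦ ?_)
    fun _ _ _ ↦ ArithmeticFunction.vonMangoldt_nonneg
  simp only [Finset.mem_filter, Finset.mem_sdiff, Finset.mem_Icc, not_and, not_le] at hr
  obtain ⟨⟨⟨h1, h2⟩, h3⟩, h4⟩ := hr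
  refine Finset.mem_filter.2 ⟨Finset.mem_Ioc.2 ⟨h1, h2⟩, fun hp ↦ ?_⟩
  exact h r hp ((Nat.floor_lt hx).1 (h3 h1))
    ((Nat.le_floor_iff (hx.trans hxy)).1 h2) h4

/-- For every real `0 < ε < 1/4` there exists `N` such that for all
`n ≥ N`: if `m` is an integer with `n^(1/2−2ε) ≤ m ≤ 4·n^(1/2−2ε)`, `gcd(a, m) = 1`, and
`max_{y ≤ n/2} |ψ(y; m, a) − y/φ(m)| < n/(10m)`, then
`ψ(n/2; m, a) − ψ(n/4; m, a) ≥ n/(4φ(m)) − n/(5m) > 0`, and there exists a prime `r` with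
`n/4 < r ≤ n/2` and `r ≡ a (mod m)`. -/
theorem prime_in_progression_from_good_modulus (ε : ℝ) (hε0 : 0 < ε) (hε1 : ε < 1 / 4) :
    ∃ N : ℕ, ∀ n : ℕ, N ≤ n → ∀ m a : ℕ,
      (n : ℝ) ^ ((1 : ℝ) / 2 - 2 * ε) ≤ (m : ℝ) →
      (m : ℝ) ≤ 4 * (n : ℝ) ^ ((1 : ℝ) / 2 - 2 * ε) →
      Nat.gcd a m = 1 →
      (∀ y : ℝ, 0 < y → y ≤ (n : ℝ) / 2 →
        |psi y m a - y / (Nat.totient m : ℝ)| < (n : ℝ) / (10 * (m : ℝ))) →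
      ((n : ℝ) / (4 * (Nat.totient m : ℝ)) - (n : ℝ) / (5 * (m : ℝ)) ≤
          psi ((n : ℝ) / 2) m a - psi ((n : ℝ) / 4) m a ∧
        0 < (n : ℝ) / (4 * (Nat.totient m : ℝ)) - (n : ℝ) / (5 * (m : ℝ))) ∧
      ∃ r : ℕ, Nat.Prime r ∧ (n : ℝ) / 4 < (r : ℝ) ∧ (r : ℝ) ≤ (n : ℝ) / 2 ∧
        r % m = a % m := by
  obtain ⟨C, hC⟩ := Chebyshev.psi_sub_theta_le_mul_sqrt
  have hlim : Filter.Tendsto (fun n : ℕ ↦ (n : ℝ) ^ (2 * ε)) Filter.atTop Filter.atTop :=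
    (tendsto_rpow_atTop (by positivity)).comp tendsto_natCast_atTop_atTop
  obtain ⟨N, hN⟩ := Filter.eventually_atTop.1
    ((hlim.eventually_gt_atTop (80 * |C|)).and (Filter.eventually_ge_atTop 1))
  refine ⟨N, fun n hn m a hm1 hm2 _ hψ ↦ ?_⟩
  obtain ⟨hB, hn1⟩ := hN n hn
  have hn0 : (0 : ℝ) < n := by exact_mod_cast hn1
  have hA : 0 < (n : ℝ) ^ ((1 : ℝ) / 2 - 2 * ε) := Real.rpow_pos_of_pos hn0 _
  have hm0 : (0 : ℝ) < m := hA.trans_le hm1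
  have hmN : 0 < m := by exact_mod_cast hm0
  have hφ0 : (0 : ℝ) < Nat.totient m := by exact_mod_cast Nat.totient_pos.2 hmN
  have hφm : (Nat.totient m : ℝ) ≤ m := by exact_mod_cast Nat.totient_le m
  have hquarter : (n : ℝ) / (4 * m) ≤ n / (4 * Nat.totient m) := by gcongr
  have hgap : (n : ℝ) / (4 * m) - n / (5 * m) = n / (20 * m) := by field_simp; norm_num
  have hgap0 : (0 : ℝ) < n / (20 * m) := by positivity
  have hdiff : (n : ℝ) / (4 * (Nat.totient m : ℝ)) - (n : ℝ) / (5 * (m : ℝ)) ≤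
      psi ((n : ℝ) / 2) m a - psi ((n : ℝ) / 4) m a := by
    have h2 := (abs_lt.1 (hψ (n / 2) (by positivity) le_rfl)).1
    have h4 := (abs_lt.1 (hψ (n / 4) (by positivity) (by linarith))).2
    have e1 : (n : ℝ) / 2 / Nat.totient m - n / 4 / Nat.totient m = n / (4 * Nat.totient m) := by
      field_simp; norm_num
    have e2 : (n : ℝ) / (5 * m) = 2 * (n / (10 * m)) := by field_simp; norm_num
    linarith
  refine ⟨⟨hdiff, by linarith⟩, ?_⟩
  by_contra! hno
  have hle := psi_sub_psi_le_of_forall_not_prime (by positivity) (by linarith) m a hno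
  have hs : √((n : ℝ) / 2) ≤ √n := Real.sqrt_le_sqrt (by linarith)
  have hpow : C * √((n : ℝ) / 2) ≤ |C| * √n :=
    mul_le_mul (le_abs_self C) hs (Real.sqrt_nonneg _) (abs_nonneg C)
  have hupper : (n : ℝ) / (20 * m) ≤ |C| * √n := by linarith [hC (n / 2)]
  rw [div_le_iff₀ (by positivity)] at hupper
  have hsplit : (n : ℝ) =
      n ^ ((1 : ℝ) / 2 - 2 * ε) * (n : ℝ) ^ (2 * ε) * √n := by
    rw [Real.sqrt_eq_rpow, ← Real.rpow_add hn0, ← Real.rpow_add hn0]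
    ring_nf
    simp
  have hs0 : 0 < √(n : ℝ) := Real.sqrt_pos.2 hn0
  have hlt : (n : ℝ) ^ ((1 : ℝ) / 2 - 2 * ε) * (80 * |C|) * √n <
      n ^ ((1 : ℝ) / 2 - 2 * ε) * (n : ℝ) ^ (2 * ε) * √n := by gcongr
  have hbound : |C| * √n * (20 * m) ≤
      |C| * √n * (20 * (4 * (n : ℝ) ^ ((1 : ℝ) / 2 - 2 * ε))) := by gcongr
  linarith
end
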